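/- Let C := 17496·64^5·log(12)·log α·log √5·log 2. For every integer n ≥ 10, if (x,y) ∈ ℤ² with |y| ≥ 2 satisfies (x − F_n·y)(x − L_n·y)·x − y³ = ±1, then log|y| ≥ exp( (2·log α/(1+C))·n − log n − 5 ). -/

import Mathlib

open Real

/-- The golden ratio α = (1+√5)/2. -/
noncomputable def alpha : ℝ := (1 + Real.sqrt 5) / 2

/-- The Lucas sequence: L 0 = 2, L 1 = 1, L (n+2) = L (n+1) + L n. -/
def lucas : ℕ → ℤ
  | 0 => 2
  | 1 => 1
  | n + 2 => lucas (n + 1) + lucas n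

/-- The cubic polynomial f_n(X) = (X − F_n)(X − L_n)X − 1. -/
noncomputable def fpoly (n : ℕ) (X : ℝ) : ℝ :=
  (X - (Nat.fib n : ℝ)) * (X - (lucas n : ℝ)) * X - 1

/-- The constant C from Baker's method. -/
noncomputable def Cconst : ℝ :=
  17496 * 64 ^ 5 * Real.log 12 * Real.log alpha * Real.log (Real.sqrt 5) * Real.log 2

/-- `d` is anisotropic: the form `x ^ 2 - d * y ^ 2` has no nontrivial zero. -/
def Anisotropic {R : Type*} [CommRing R] (d : R) : Prop :=
  ∀ x y : R, x ^ 2 = d * y ^ 2 → x = 0 ∧ y = 0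

theorem Anisotropic.ne_zero {R : Type*} [CommRing R] [Nontrivial R] {d : R}
    (h : Anisotropic d) : d ≠ 0 := by
  rintro rfl
  exact one_ne_zero (h 0 1 (by simp)).2

theorem Anisotropic.pair_eq_zero {R : Type*} [CommRing R] [IsDomain R] (h2 : (2 : R) ≠ 0)
    {d e : R} (hd : Anisotropic d) (he : Anisotropic e) (hde : Anisotropic (d * e))
    {x₁ x₂ y₁ y₂ : R} (h₁ : x₁ ^ 2 + d * x₂ ^ 2 = e * (y₁ ^ 2 + d * y₂ ^ 2))
    (h₂ : x₁ * x₂ = e * (y₁ * y₂)) : (x₁ = 0 ∧ x₂ = 0) ∧ y₁ = 0 ∧ y₂ = 0 := by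
  have hd0 := hd.ne_zero
  have key : (x₁ ^ 2 - d * x₂ ^ 2 - e * (y₁ ^ 2 - d * y₂ ^ 2)) *
      (x₁ ^ 2 - d * x₂ ^ 2 + e * (y₁ ^ 2 - d * y₂ ^ 2)) = 0 := by
    linear_combination (x₁ ^ 2 + d * x₂ ^ 2 + e * (y₁ ^ 2 + d * y₂ ^ 2)) * h₁ -
      4 * d * (x₁ * x₂ + e * (y₁ * y₂)) * h₂
  rcases mul_eq_zero.1 key with h | h
  · have a : x₁ ^ 2 = e * y₁ ^ 2 := mul_left_cancel₀ h2 (by linear_combination h₁ + h)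
    have b : x₂ ^ 2 = e * y₂ ^ 2 :=
      mul_left_cancel₀ h2 (mul_left_cancel₀ hd0 (by linear_combination h₁ - h))
    exact ⟨⟨(he _ _ a).1, (he _ _ b).1⟩, (he _ _ a).2, (he _ _ b).2⟩
  · have a : x₁ ^ 2 = (d * e) * y₂ ^ 2 := mul_left_cancel₀ h2 (by linear_combination h₁ + h)
    have b : (d * x₂) ^ 2 = (d * e) * y₁ ^ 2 :=
      mul_left_cancel₀ h2 (by linear_combination d * (h₁ - h))
    have hb := hde _ _ b
    exact ⟨⟨(hde _ _ a).1, (mul_eq_zero.1 hb.1).resolve_left hd0⟩, hb.2, (hde _ _ a).2⟩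

theorem Anisotropic.adjoin {R : Type*} [CommRing R] [IsDomain R] (h2 : (2 : R) ≠ 0)
    {d e : R} (hd : Anisotropic d) (he : Anisotropic e) (hde : Anisotropic (d * e)) :
    Anisotropic (algebraMap R (QuadraticAlgebra R d 0) e) := by
  intro x y hxy
  have h₁ := congrArg QuadraticAlgebra.re hxy
  have h₂ := congrArg QuadraticAlgebra.im hxy
  simp only [pow_two, QuadraticAlgebra.re_mul, QuadraticAlgebra.im_mul,
    QuadraticAlgebra.algebraMap_re, QuadraticAlgebra.algebraMap_im] at h₁ h₂
  have := Anisotropic.pair_eq_zero h2 hd he hde (x₁ := x.re) (x₂ := x.im) (y₁ := y.re)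
    (y₂ := y.im) (by linear_combination h₁)
    (mul_left_cancel₀ h2 (by linear_combination h₂))
  exact ⟨QuadraticAlgebra.ext this.1.1 this.1.2, QuadraticAlgebra.ext this.2.1 this.2.2⟩

theorem Anisotropic.norm_eq_zero {R : Type*} [CommRing R] {d : R} (hd : Anisotropic d)
    {z : QuadraticAlgebra R d 0} (hz : z.re ^ 2 - d * z.im ^ 2 = 0) : z = 0 := by
  have := hd z.re z.im (sub_eq_zero.1 hz)
  exact QuadraticAlgebra.ext this.1 this.2

theorem Anisotropic.isDomain {R : Type*} [CommRing R] [IsDomain R] {d : R}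
    (hd : Anisotropic d) : IsDomain (QuadraticAlgebra R d 0) := by
  have : NoZeroDivisors (QuadraticAlgebra R d 0) := by
    constructor
    intro a b hab
    have h₁ := congrArg QuadraticAlgebra.re hab
    have h₂ := congrArg QuadraticAlgebra.im hab
    simp only [QuadraticAlgebra.re_mul, QuadraticAlgebra.im_mul, QuadraticAlgebra.re_zero,
      QuadraticAlgebra.im_zero] at h₁ h₂
    have h : (a.re ^ 2 - d * a.im ^ 2) * (b.re ^ 2 - d * b.im ^ 2) = 0 := by
      linear_combination (a.re * b.re + d * a.im * b.im) * h₁ -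
        d * (a.re * b.im + a.im * b.re) * h₂
    exact (mul_eq_zero.1 h).imp hd.norm_eq_zero hd.norm_eq_zero
  exact NoZeroDivisors.to_isDomain _

theorem Anisotropic.int {d : ℤ} (h : ∀ k : ℤ, k ^ 2 ≠ d) : Anisotropic d := by
  intro x y hxy
  by_cases hy : y = 0
  · subst hy
    simpa using hxy
  · have : y ^ 2 ∣ x ^ 2 := ⟨d, by linear_combination hxy⟩
    obtain ⟨k, rfl⟩ := (Int.pow_dvd_pow_iff two_ne_zero).1 this
    exact absurd (mul_left_cancel₀ (pow_ne_zero 2 hy) (by linear_combination hxy)) (h k)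

/-- A complex embedding of a ring together with a submultiplicative size dominating it. -/
structure SizedRing (R : Type*) [CommRing R] where
  toC : R →+* ℂ
  size : R → ℝ
  size_nonneg : ∀ z, 0 ≤ size z
  size_neg : ∀ z, size (-z) = size z
  size_add : ∀ z w, size (z + w) ≤ size z + size w
  size_mul : ∀ z w, size (z * w) ≤ size z * size w
  size_int : ∀ n : ℤ, size n = |(n : ℝ)|
  norm_le : ∀ z, ‖toC z‖ ≤ size z

namespace SizedRing

variable {R : Type*} [CommRing R]

/-- Adjoining a square root of `d`. -/
noncomputable def adjoin (S : SizedRing R) (d : R) (r : ℂ) (hr : r ^ 2 = S.toC d) (δ : ℝ)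
    (hδ : 0 ≤ δ) (hd : S.size d ≤ δ ^ 2) : SizedRing (QuadraticAlgebra R d 0) where
  toC :=
    { toFun := fun z => S.toC z.re + r * S.toC z.im
      map_one' := by simp [QuadraticAlgebra.re_one, QuadraticAlgebra.im_one]
      map_mul' := fun z w => by
        simp only [QuadraticAlgebra.re_mul, QuadraticAlgebra.im_mul, map_add, map_mul, ← hr,
          map_zero]
        ring
      map_zero' := by simp
      map_add' := fun z w => by simp; ring }
  size z := S.size z.re + δ * S.size z.im
  size_nonneg z := add_nonneg (S.size_nonneg _) (mul_nonneg hδ (S.size_nonneg _))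
  size_neg z := by simp [S.size_neg]
  size_add z w := by
    have h₁ := S.size_add z.re w.re
    have h₂ := mul_le_mul_of_nonneg_left (S.size_add z.im w.im) hδ
    simp only [QuadraticAlgebra.re_add, QuadraticAlgebra.im_add]
    linarith
  size_mul z w := by
    simp only [QuadraticAlgebra.re_mul, QuadraticAlgebra.im_mul, zero_mul, add_zero]
    have h₁ := S.size_add (z.re * w.re) (d * z.im * w.im)
    have h₂ := S.size_add (z.re * w.im) (z.im * w.re)
    have h₃ := S.size_mul z.re w.re
    have h₄ := S.size_mul z.re w.im
    have h₅ := S.size_mul z.im w.re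
    have h₆ : S.size (d * z.im * w.im) ≤ δ ^ 2 * (S.size z.im * S.size w.im) := by
      have := S.size_mul d (z.im * w.im)
      rw [mul_assoc]
      refine this.trans ?_
      exact mul_le_mul hd (S.size_mul _ _) (S.size_nonneg _) (by positivity)
    nlinarith [mul_le_mul_of_nonneg_left h₂ hδ, mul_le_mul_of_nonneg_left h₄ hδ,
      mul_le_mul_of_nonneg_left h₅ hδ]
  size_int n := by
    have : S.size 0 = 0 := by simpa using S.size_int 0
    simp [S.size_int, this, QuadraticAlgebra.re_intCast, QuadraticAlgebra.im_intCast]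
  norm_le z := by
    have hrδ : ‖r‖ ≤ δ := by
      refine le_of_sq_le_sq ?_ hδ
      rw [← norm_pow, hr]
      exact (S.norm_le d).trans hd
    refine (norm_add_le _ _).trans (add_le_add (S.norm_le _) ?_)
    rw [norm_mul]
    exact mul_le_mul hrδ (S.norm_le _) (norm_nonneg _) hδ

theorem adjoin_toC (S : SizedRing R) (d : R) (r : ℂ) (hr : r ^ 2 = S.toC d) (δ : ℝ)
    (hδ : 0 ≤ δ) (hd : S.size d ≤ δ ^ 2) (z : QuadraticAlgebra R d 0) :
    (S.adjoin d r hr δ hδ hd).toC z = S.toC z.re + r * S.toC z.im := rfl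

theorem adjoin_size (S : SizedRing R) (d : R) (r : ℂ) (hr : r ^ 2 = S.toC d) (δ : ℝ)
    (hδ : 0 ≤ δ) (hd : S.size d ≤ δ ^ 2) (z : QuadraticAlgebra R d 0) :
    (S.adjoin d r hr δ hδ hd).size z = S.size z.re + δ * S.size z.im := rfl

theorem size_sum (S : SizedRing R) {ι : Type*} (s : Finset ι) (f : ι → R) :
    S.size (∑ i ∈ s, f i) ≤ ∑ i ∈ s, S.size (f i) := by
  classical
  induction s using Finset.induction_on with
  | empty => simpa using (S.size_int 0).le
  | insert a s ha ih =>
    rw [Finset.sum_insert ha, Finset.sum_insert ha]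
    exact (S.size_add _ _).trans (by linarith)

theorem size_pow (S : SizedRing R) (z : R) (n : ℕ) : S.size (z ^ n) ≤ S.size z ^ n := by
  induction n with
  | zero => simpa using (S.size_int 1).le
  | succ n ih =>
    rw [pow_succ, pow_succ]
    exact (S.size_mul _ _).trans (mul_le_mul_of_nonneg_right ih (S.size_nonneg _))

/-- Liouville's inequality with exponent `n`. -/
def Liouville (S : SizedRing R) (n : ℕ) : Prop :=
  ∀ z, ‖S.toC z‖ * S.size z ^ n < 1 → z = 0

theorem Liouville.adjoin {S : SizedRing R} {n : ℕ} (h : S.Liouville n) (d : R)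
    (hA : Anisotropic d) (r : ℂ) (hr : r ^ 2 = S.toC d) (δ : ℝ)
    (hδ : 0 ≤ δ) (hd : S.size d ≤ δ ^ 2) :
    (S.adjoin d r hr δ hδ hd).Liouville (2 * n + 1) := by
  intro z hz
  set S' := S.adjoin d r hr δ hδ hd with hS'
  refine hA.norm_eq_zero (h _ ?_)
  set w : QuadraticAlgebra R d 0 := ⟨z.re, -z.im⟩ with hw
  have hsw : S'.size w = S'.size z := by
    simp only [hS', adjoin_size, hw, S.size_neg]
  have h1 : S.toC (z.re ^ 2 - d * z.im ^ 2) = S'.toC z * S'.toC w := by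
    simp only [hS', adjoin_toC, hw, map_sub, map_mul, map_pow, map_neg, ← hr]
    ring
  have h2 : ‖S.toC (z.re ^ 2 - d * z.im ^ 2)‖ ≤ ‖S'.toC z‖ * S'.size z := by
    rw [h1, norm_mul, ← hsw]
    exact mul_le_mul_of_nonneg_left (S'.norm_le _) (norm_nonneg _)
  have h3 : S.size (z.re ^ 2 - d * z.im ^ 2) ≤ S'.size z ^ 2 := by
    have a := S.size_add (z.re ^ 2) (-(d * z.im ^ 2))
    rw [S.size_neg, ← sub_eq_add_neg] at a
    have b := S.size_pow z.re 2
    have c := (S.size_mul d (z.im ^ 2)).trans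
      (mul_le_mul hd (S.size_pow z.im 2) (S.size_nonneg _) (by positivity))
    simp only [hS', adjoin_size]
    nlinarith [mul_nonneg hδ (mul_nonneg (S.size_nonneg z.re) (S.size_nonneg z.im))]
  calc _ ≤ (‖S'.toC z‖ * S'.size z) * (S'.size z ^ 2) ^ n := by
        refine mul_le_mul h2 (pow_le_pow_left₀ (S.size_nonneg _) h3 _)
          (pow_nonneg (S.size_nonneg _) _) (mul_nonneg (norm_nonneg _) (S'.size_nonneg _))
    _ = ‖S'.toC z‖ * S'.size z ^ (2 * n + 1) := by ring
    _ < 1 := hz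

end SizedRing

/-- The ring of integers of `ℚ(√5)`. -/
abbrev GoldenInt := QuadraticAlgebra ℤ 1 1

namespace GoldenInt

/-- The golden ratio as an element of `GoldenInt`. -/
def phi : GoldenInt := ⟨0, 1⟩

/-- The square root of five as an element of `GoldenInt`. -/
def sqrtFive : GoldenInt := ⟨-1, 2⟩

/-- The two real embeddings of `GoldenInt`, bundled with the larger absolute value. -/
noncomputable def sized : SizedRing GoldenInt where
  toC :=
    { toFun := fun z => (z.re : ℂ) + (goldenRatio : ℂ) * z.im
      map_one' := by simp [QuadraticAlgebra.re_one, QuadraticAlgebra.im_one]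
      map_mul' := fun z w => by
        have : (goldenRatio : ℂ) ^ 2 = goldenRatio + 1 := by exact_mod_cast goldenRatio_sq
        simp only [QuadraticAlgebra.re_mul, QuadraticAlgebra.im_mul]
        generalize (goldenRatio : ℂ) = g at this
        push_cast
        linear_combination -(z.im * w.im : ℂ) * this
      map_zero' := by simp
      map_add' := fun z w => by simp; ring }
  size z := max |(z.re : ℝ) + goldenRatio * z.im| |(z.re : ℝ) + goldenConj * z.im|
  size_nonneg z := le_max_of_le_left (abs_nonneg _)
  size_neg z := by
    simp only [QuadraticAlgebra.re_neg, QuadraticAlgebra.im_neg]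
    push_cast
    congr 1 <;> rw [← abs_neg] <;> congr 1 <;> ring
  size_add z w := by
    simp only [QuadraticAlgebra.re_add, QuadraticAlgebra.im_add]
    push_cast
    refine max_le ?_ ?_
    · refine le_trans ?_ (add_le_add (le_max_left _ _) (le_max_left _ _))
      refine le_trans (le_of_eq ?_) (abs_add_le _ _)
      congr 1; ring
    · refine le_trans ?_ (add_le_add (le_max_right _ _) (le_max_right _ _))
      refine le_trans (le_of_eq ?_) (abs_add_le _ _)
      congr 1; ring
  size_mul z w := by
    simp only [QuadraticAlgebra.re_mul, QuadraticAlgebra.im_mul]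
    push_cast
    refine max_le ?_ ?_
    · refine le_trans ?_ (mul_le_mul (le_max_left _ _) (le_max_left _ _) (abs_nonneg _)
        (le_max_of_le_left (abs_nonneg _)))
      rw [← abs_mul]
      refine le_of_eq (congrArg _ ?_)
      linear_combination -(z.im * w.im : ℝ) * goldenRatio_sq
    · refine le_trans ?_ (mul_le_mul (le_max_right _ _) (le_max_right _ _) (abs_nonneg _)
        (le_max_of_le_left (abs_nonneg _)))
      rw [← abs_mul]
      refine le_of_eq (congrArg _ ?_)
      linear_combination -(z.im * w.im : ℝ) * goldenConj_sq
  size_int n := by simp [QuadraticAlgebra.re_intCast, QuadraticAlgebra.im_intCast]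
  norm_le z := by
    refine le_trans (le_of_eq ?_) (le_max_left _ _)
    rw [← Real.norm_eq_abs, ← Complex.norm_real]
    congr 1
    simp

theorem sized_toC (z : GoldenInt) :
    sized.toC z = (z.re : ℂ) + (goldenRatio : ℂ) * z.im := rfl

theorem sized_size (z : GoldenInt) : sized.size z =
    max |(z.re : ℝ) + goldenRatio * z.im| |(z.re : ℝ) + goldenConj * z.im| := rfl

theorem eq_zero_of_norm {z : GoldenInt} (hz : z.re ^ 2 + z.re * z.im - z.im ^ 2 = 0) :
    z = 0 := by
  have h5 : Anisotropic (5 : ℤ) := Anisotropic.int fun k hk => by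
    have h1 : k < 3 := by nlinarith
    have h2 : -3 < k := by nlinarith
    interval_cases k <;> omega
  have := h5 (2 * z.re + z.im) z.im (by linear_combination 4 * hz)
  refine QuadraticAlgebra.ext ?_ this.2
  have h := this.1
  rw [this.2] at h
  simpa using h

theorem goldenConj_abs_le : |goldenConj| ≤ 1 := by
  rw [abs_le]
  exact ⟨neg_one_lt_goldenConj.le, (goldenConj_neg.trans one_pos).le⟩

theorem liouville_sized : sized.Liouville 1 := by
  intro z hz
  apply eq_zero_of_norm
  have h1 : |(z.re : ℝ) + goldenRatio * z.im| = ‖sized.toC z‖ := by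
    rw [← Real.norm_eq_abs, ← Complex.norm_real]
    congr 1
    simp [sized_toC]
  have h2 : ((z.re ^ 2 + z.re * z.im - z.im ^ 2 : ℤ) : ℝ) =
      ((z.re : ℝ) + goldenRatio * z.im) * ((z.re : ℝ) + goldenConj * z.im) := by
    push_cast
    have a := goldenRatio_add_goldenConj
    have b := goldenRatio_mul_goldenConj
    linear_combination -(z.re * z.im : ℝ) * a - (z.im : ℝ) ^ 2 * b
  have h3 : |((z.re ^ 2 + z.re * z.im - z.im ^ 2 : ℤ) : ℝ)| < 1 := by
    rw [h2, abs_mul, h1]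
    refine lt_of_le_of_lt ?_ hz
    rw [pow_one]
    exact mul_le_mul_of_nonneg_left (le_max_right _ _) (norm_nonneg _)
  rw [← Int.cast_abs] at h3
  exact Int.abs_lt_one_iff.1 (by exact_mod_cast h3)

instance : IsDomain GoldenInt := by
  have : NoZeroDivisors GoldenInt := by
    constructor
    intro a b hab
    have h₁ := congrArg QuadraticAlgebra.re hab
    have h₂ := congrArg QuadraticAlgebra.im hab
    simp only [QuadraticAlgebra.re_mul, QuadraticAlgebra.im_mul, QuadraticAlgebra.re_zero,
      QuadraticAlgebra.im_zero] at h₁ h₂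
    have h : (a.re ^ 2 + a.re * a.im - a.im ^ 2) * (b.re ^ 2 + b.re * b.im - b.im ^ 2) = 0 := by
      linear_combination (a.re * b.re + a.im * b.im + a.re * b.im + a.im * b.re
        + a.im * b.im) * h₁ -
        (a.re * b.im + a.im * b.re + a.im * b.im) * h₂
    exact (mul_eq_zero.1 h).imp eq_zero_of_norm eq_zero_of_norm
  exact NoZeroDivisors.to_isDomain _

/-- The norm is multiplicative, so a non-square norm forces anisotropy. -/
theorem anisotropic_of_norm {d : GoldenInt}
    (h : Anisotropic (d.re ^ 2 + d.re * d.im - d.im ^ 2)) : Anisotropic d := by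
  intro x y hxy
  have h₁ := congrArg QuadraticAlgebra.re hxy
  have h₂ := congrArg QuadraticAlgebra.im hxy
  simp only [pow_two, QuadraticAlgebra.re_mul, QuadraticAlgebra.im_mul] at h₁ h₂
  have key : (x.re ^ 2 + x.re * x.im - x.im ^ 2) ^ 2 = (d.re ^ 2 + d.re * d.im - d.im ^ 2) *
      (y.re ^ 2 + y.re * y.im - y.im ^ 2) ^ 2 := by
    have e1 : (x.re ^ 2 + x.re * x.im - x.im ^ 2) ^ 2 =
      (x.re * x.re + 1 * x.im * x.im) ^ 2 + (x.re * x.re + 1 * x.im * x.im) *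
      (x.re * x.im + x.im * x.re + 1 * x.im * x.im) -
      (x.re * x.im + x.im * x.re + 1 * x.im * x.im) ^ 2 := by ring
    rw [e1, h₁, h₂]
    ring
  have := h _ _ key
  exact ⟨eq_zero_of_norm this.1, eq_zero_of_norm this.2⟩

theorem anisotropic_two : Anisotropic (2 : GoldenInt) := by
  have hn : ∀ d : ℤ, (d = 5 ∨ d = 2 ∨ d = 10) → Anisotropic d := by
    intro d hd
    refine Anisotropic.int fun k hk => ?_
    have h1 : k < 4 := by rcases hd with h | h | h <;> nlinarith
    have h2 : -4 < k := by rcases hd with h | h | h <;> nlinarith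
    interval_cases k <;> omega
  intro x y hxy
  have h₁ := congrArg QuadraticAlgebra.re hxy
  have h₂ := congrArg QuadraticAlgebra.im hxy
  have e1 : (2 : GoldenInt).re = 2 := rfl
  have e2 : (2 : GoldenInt).im = 0 := rfl
  simp only [pow_two, QuadraticAlgebra.re_mul, QuadraticAlgebra.im_mul, e1, e2] at h₁ h₂
  have := Anisotropic.pair_eq_zero (R := ℤ) two_ne_zero (hn 5 (by simp)) (hn 2 (by simp))
    (hn (5 * 2) (by simp)) (x₁ := 2 * x.re + x.im) (x₂ := x.im) (y₁ := 2 * y.re + y.im)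
    (y₂ := y.im) (by linear_combination 4 * h₁ + 2 * h₂) (by linear_combination h₂)
  obtain ⟨⟨a, b⟩, c, d⟩ := this
  rw [b] at a
  rw [d] at c
  exact ⟨QuadraticAlgebra.ext (by simpa using a) b, QuadraticAlgebra.ext (by simpa using c) d⟩

theorem anisotropic_of_norm_eq {d : GoldenInt} (N : ℤ)
    (hN : d.re ^ 2 + d.re * d.im - d.im ^ 2 = N) (h : N < 0 ∨ N = 5 ∨ N = 20) :
    Anisotropic d := by
  apply anisotropic_of_norm
  rw [hN]
  refine Anisotropic.int fun k hk => ?_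
  rcases h with h | h | h
  · nlinarith
  all_goals
    have h1 : k < 5 := by nlinarith
    have h2 : -5 < k := by nlinarith
    interval_cases k <;> omega

theorem toC_phi : sized.toC phi = goldenRatio := by simp [sized_toC, phi]

theorem toC_sqrtFive : sized.toC sqrtFive = (√5 : ℝ) := by
  rw [sized_toC, sqrtFive, Complex.ext_iff]
  simp [goldenRatio]

theorem size_phi : sized.size phi = goldenRatio := by
  have h := goldenConj_abs_le
  have h2 := one_lt_goldenRatio
  have : |goldenRatio| = goldenRatio := abs_of_pos goldenRatio_pos
  simp [sized_size, phi, this, goldenConj_abs_le.trans h2.le]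

theorem size_sqrtFive : sized.size sqrtFive = √5 := by
  have e1 : (-1 : ℝ) + goldenRatio * 2 = √5 := by simp [goldenRatio]
  have e2 : (-1 : ℝ) + goldenConj * 2 = -√5 := by simp [goldenConj]; ring
  simp only [sized_size, sqrtFive]
  push_cast
  rw [e1, e2, abs_neg, max_self, abs_of_nonneg (Real.sqrt_nonneg _)]

/-- Linear independence over `GoldenInt` of products of square roots of `φ`, `√5` and `2`,
in the quantitative form of Liouville's inequality. -/
theorem eq_zero_of_small (x : ℕ × ℕ × ℕ → GoldenInt)
    (h : ‖∑ e ∈ Finset.range 2 ×ˢ Finset.range 2 ×ˢ Finset.range 2, sized.toC (x e) *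
        ((√goldenRatio ^ e.1 * √√5 ^ e.2.1 * √2 ^ e.2.2 : ℝ) : ℂ)‖ *
      (∑ e ∈ Finset.range 2 ×ˢ Finset.range 2 ×ˢ Finset.range 2, sized.size (x e) *
        (√goldenRatio ^ e.1 * √√5 ^ e.2.1 * √2 ^ e.2.2)) ^ 15 < 1) :
    ∀ e ∈ Finset.range 2 ×ˢ Finset.range 2 ×ˢ Finset.range 2, x e = 0 := by
  have a2 := anisotropic_two
  have a5 : Anisotropic sqrtFive := anisotropic_of_norm_eq (-5) (by decide) (by simp)
  have aφ : Anisotropic phi := anisotropic_of_norm_eq (-1) (by decide) (by simp)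
  have a25 : Anisotropic (2 * sqrtFive) := anisotropic_of_norm_eq (-20) (by decide) (by simp)
  have a2φ : Anisotropic (2 * phi) := anisotropic_of_norm_eq (-4) (by decide) (by simp)
  have a5φ : Anisotropic (sqrtFive * phi) := anisotropic_of_norm_eq 5 (by decide) (by simp)
  have a25φ : Anisotropic (2 * (sqrtFive * phi)) :=
    anisotropic_of_norm_eq 20 (by decide) (by simp)
  have two0 : (2 : GoldenInt) ≠ 0 := by decide
  let S₁ := sized.adjoin 2 ((√2 : ℝ) : ℂ) (by
    rw [← Complex.ofReal_pow, Real.sq_sqrt (by norm_num), map_ofNat]; simp) (√2) (Real.sqrt_nonneg _)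
    (by rw [Real.sq_sqrt (by norm_num)]; exact (sized.size_int 2).le.trans (by simp))
  have l₁ : S₁.Liouville 3 := liouville_sized.adjoin _ a2 _ _ _ _ _
  have dom₁ : IsDomain (QuadraticAlgebra GoldenInt 2 0) := a2.isDomain
  have two1 : (2 : QuadraticAlgebra GoldenInt 2 0) ≠ 0 := by decide
  have b5 := a2.adjoin two0 a5 a25
  have bφ := a2.adjoin two0 aφ a2φ
  have b5φ := a2.adjoin two0 a5φ a25φ
  rw [map_mul] at b5φ
  set f₁ := algebraMap GoldenInt (QuadraticAlgebra GoldenInt 2 0) with hf₁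
  have sz1 : ∀ z, S₁.size (f₁ z) = sized.size z := fun z => by
    have : sized.size 0 = 0 := by simpa using sized.size_int 0
    simp [S₁, SizedRing.adjoin_size, hf₁, this]
  have tc1 : ∀ z, S₁.toC (f₁ z) = sized.toC z := fun z => by
    simp [S₁, SizedRing.adjoin_toC, hf₁]
  let S₂ := S₁.adjoin (f₁ sqrtFive) ((√√5 : ℝ) : ℂ) (by
    rw [tc1, toC_sqrtFive, ← Complex.ofReal_pow, Real.sq_sqrt (Real.sqrt_nonneg _)])
    (√√5) (Real.sqrt_nonneg _)
    (by rw [sz1, size_sqrtFive, Real.sq_sqrt (Real.sqrt_nonneg _)])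
  have l₂ : S₂.Liouville 7 := l₁.adjoin _ b5 _ _ _ _ _
  have dom₂ : IsDomain (QuadraticAlgebra (QuadraticAlgebra GoldenInt 2 0) (f₁ sqrtFive) 0) :=
    b5.isDomain
  have cφ := b5.adjoin two1 bφ b5φ
  set f₂ := algebraMap (QuadraticAlgebra GoldenInt 2 0)
    (QuadraticAlgebra (QuadraticAlgebra GoldenInt 2 0) (f₁ sqrtFive) 0) with hf₂
  have sz2 : ∀ z, S₂.size (f₂ z) = S₁.size z := fun z => by
    have : S₁.size 0 = 0 := by simpa using S₁.size_int 0
    simp [S₂, SizedRing.adjoin_size, hf₂, this]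
  have tc2 : ∀ z, S₂.toC (f₂ z) = S₁.toC z := fun z => by
    simp [S₂, SizedRing.adjoin_toC, hf₂]
  let S₃ := S₂.adjoin (f₂ (f₁ phi)) ((√goldenRatio : ℝ) : ℂ) (by
    rw [tc2, tc1, toC_phi, ← Complex.ofReal_pow, Real.sq_sqrt goldenRatio_pos.le])
    (√goldenRatio) (Real.sqrt_nonneg _)
    (by rw [sz2, sz1, size_phi, Real.sq_sqrt goldenRatio_pos.le])
  have l₃ : S₃.Liouville 15 := l₂.adjoin _ cφ _ _ _ _ _
  have := l₃ ⟨⟨⟨x (0, 0, 0), x (0, 0, 1)⟩, ⟨x (0, 1, 0), x (0, 1, 1)⟩⟩,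
    ⟨⟨x (1, 0, 0), x (1, 0, 1)⟩, ⟨x (1, 1, 0), x (1, 1, 1)⟩⟩⟩ (by
    refine lt_of_eq_of_lt ?_ h
    simp only [S₃, S₂, S₁, SizedRing.adjoin_size, SizedRing.adjoin_toC,
      Finset.sum_product, Finset.sum_range_succ, Finset.sum_range_zero]
    push_cast
    congr 2
    · ring
    · ring)
  simp only [QuadraticAlgebra.ext_iff, QuadraticAlgebra.re_zero, QuadraticAlgebra.im_zero] at this
  obtain ⟨⟨⟨⟨a1, a2⟩, a3, a4⟩, ⟨a5, a6⟩, a7, a8⟩, ⟨⟨a9, a10⟩, a11, a12⟩, ⟨a13, a14⟩, a15, a16⟩ := this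
  rintro ⟨e1, e2, e3⟩ he
  simp only [Finset.mem_product, Finset.mem_range] at he
  obtain ⟨h1, h2, h3⟩ := he
  interval_cases e1 <;> interval_cases e2 <;> interval_cases e3 <;>
    (refine QuadraticAlgebra.ext ?_ ?_ <;> assumption)

end GoldenInt

/-! ### Entire functions with prescribed zeros -/

theorem Differentiable.dslope_complex {f : ℂ → ℂ} (hf : Differentiable ℂ f) (x : ℂ) :
    Differentiable ℂ (dslope f x) := by
  rw [← differentiableOn_univ] at hf ⊢
  exact (Complex.differentiableOn_dslope Filter.univ_mem).2 hf

theorem exists_entire_factor {f : ℂ → ℂ} (hf : Differentiable ℂ f) {m : ℕ} {x : ℂ}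
    (h : (m : ℕ∞) ≤ analyticOrderAt f x) :
    ∃ q : ℂ → ℂ, Differentiable ℂ q ∧ ∀ w, f w = (w - x) ^ m * q w := by
  induction m generalizing f with
  | zero => exact ⟨f, hf, by simp⟩
  | succ m ih =>
    have hx : f x = 0 := by
      apply apply_eq_zero_of_analyticOrderAt_ne_zero
      intro h0
      rw [h0] at h
      simp at h
    have hd := hf.dslope_complex x
    have hfd : f = (fun w => w - x) * dslope f x := by
      ext w
      have := sub_smul_dslope f x w
      simp only [smul_eq_mul, hx, sub_zero] at this
      simp [this]
    have ho : analyticOrderAt (fun w : ℂ => w - x) x = 1 := by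
      have := (analyticAt_id (𝕜 := ℂ) (z := x)).analyticOrderAt_sub_eq_one_of_deriv_ne_zero
        (by simp)
      exact this
    rw [hfd, analyticOrderAt_mul (by fun_prop) (hd.analyticAt x), ho, Nat.cast_add, Nat.cast_one,
      add_comm] at h
    obtain ⟨q, hq, hq'⟩ := ih hd ((ENat.add_le_add_iff_left (by simp)).1 h)
    refine ⟨q, hq, fun w => ?_⟩
    rw [hfd, Pi.mul_apply, hq' w]
    ring

theorem le_analyticOrderAt_of_eq {f q : ℂ → ℂ} {m : ℕ} {x : ℂ} (hq : Differentiable ℂ q)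
    (h : ∀ w, f w = (w - x) ^ m * q w) : (m : ℕ∞) ≤ analyticOrderAt f x := by
  have hf : f = fun w => (w - x) ^ m * q w := funext h
  have hfa : AnalyticAt ℂ f x := by
    rw [hf]
    exact ((analyticAt_id.sub analyticAt_const).pow m).mul (hq.analyticAt x)
  exact (natCast_le_analyticOrderAt hfa).2
    ⟨q, hq.analyticAt x, Filter.Eventually.of_forall fun w => by rw [h w, smul_eq_mul]⟩

theorem exists_entire_prod_factor {f : ℂ → ℂ} (hf : Differentiable ℂ f) {m : ℕ} (s : Finset ℂ)
    (h : ∀ x ∈ s, (m : ℕ∞) ≤ analyticOrderAt f x) :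
    ∃ q : ℂ → ℂ, Differentiable ℂ q ∧ ∀ w, f w = (∏ x ∈ s, (w - x)) ^ m * q w := by
  classical
  induction s using Finset.induction_on with
  | empty => exact ⟨f, hf, by simp⟩
  | insert a s ha ih =>
    obtain ⟨q, hq, hq'⟩ := ih fun x hx => h x (Finset.mem_insert_of_mem hx)
    have hp : Differentiable ℂ fun w : ℂ => (∏ x ∈ s, (w - x)) ^ m := by fun_prop
    have h0 : analyticOrderAt (fun w : ℂ => (∏ x ∈ s, (w - x)) ^ m) a = 0 := by
      rw [AnalyticAt.analyticOrderAt_eq_zero (hp.analyticAt a)]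
      refine pow_ne_zero _ (Finset.prod_ne_zero_iff.2 fun x hx => sub_ne_zero.2 ?_)
      rintro rfl
      exact ha hx
    have hfe : f = (fun w : ℂ => (∏ x ∈ s, (w - x)) ^ m) * q := funext hq'
    have h1 := h a (Finset.mem_insert_self _ _)
    rw [hfe, analyticOrderAt_mul (hp.analyticAt a) (hq.analyticAt a), h0, zero_add] at h1
    obtain ⟨r, hr, hr'⟩ := exists_entire_factor hq h1
    refine ⟨r, hr, fun w => ?_⟩
    rw [hq' w, hr' w, Finset.prod_insert ha, mul_pow]
    ring

theorem prod_abs_sub_odd_le (N : ℕ) {w : ℝ} (h0 : 0 ≤ w) (h1 : w ≤ 2 * N) :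
    ∏ i ∈ Finset.range N, |w - (2 * i + 1)| ≤ (N : ℝ) ^ N := by
  have hsq : (∏ i ∈ Finset.range N, |w - (2 * i + 1)|) ^ 2 ≤ ((N : ℝ) ^ N) ^ 2 := by
    have hr : ∏ i ∈ Finset.range N, |w - (2 * i + 1)| =
        ∏ i ∈ Finset.range N, |w - (2 * ((N - 1 - i : ℕ) : ℝ) + 1)| :=
      (Finset.prod_range_reflect (fun i : ℕ => |w - (2 * (i : ℝ) + 1)|) N).symm
    have : (∏ i ∈ Finset.range N, |w - (2 * i + 1)|) ^ 2 =
        ∏ i ∈ Finset.range N, (|w - (2 * i + 1)| * |w - (2 * ((N - 1 - i : ℕ) : ℝ) + 1)|) := by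
      rw [Finset.prod_mul_distrib, ← hr, pow_two]
    rw [this, ← pow_mul, mul_comm N 2, pow_mul]
    calc _ ≤ ∏ _i ∈ Finset.range N, (N : ℝ) ^ 2 := by
          refine Finset.prod_le_prod (fun i _ => by positivity) fun i hi => ?_
          have hi' := Finset.mem_range.1 hi
          have hc : ((N - 1 - i : ℕ) : ℝ) = N - 1 - i := by
            rw [Nat.cast_sub (by omega), Nat.cast_sub (by omega)]; simp
          have hiN : (i : ℝ) + 1 ≤ N := by exact_mod_cast hi'
          have hi0 : (0 : ℝ) ≤ i := Nat.cast_nonneg _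
          rw [← abs_mul, hc, abs_le]
          have hA : (w - N) ^ 2 ≤ (N : ℝ) ^ 2 := by nlinarith
          have hB : ((N : ℝ) - 1 - 2 * i) ^ 2 ≤ (N : ℝ) ^ 2 := by nlinarith
          constructor <;> nlinarith [sq_nonneg (w - N), sq_nonneg ((N : ℝ) - 1 - 2 * i)]
      _ = _ := by simp
  exact le_of_sq_le_sq hsq (by positivity)

/-- Schwarz's lemma for an entire function vanishing to order `m` at the first `N` odd
numbers. -/
theorem norm_le_of_vanish_odd {f : ℂ → ℂ} (hf : Differentiable ℂ f) {m N : ℕ} (hN : 0 < N)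
    (h : ∀ i < N, (m : ℕ∞) ≤ analyticOrderAt f (2 * i + 1)) {A : ℝ}
    (hA : ∀ z ∈ Metric.sphere (N : ℂ) (17 * N), ‖f z‖ ≤ A) {w : ℝ} (h0 : 0 ≤ w)
    (h1 : w ≤ 2 * N) : ‖f w‖ ≤ A * (1 / 16 : ℝ) ^ (N * m) := by
  classical
  have hNr : (0 : ℝ) < N := by exact_mod_cast hN
  have hinj : Function.Injective (fun i : ℕ => (2 * i + 1 : ℂ)) := fun a b hab => by
    have : (2 * a + 1 : ℂ) = 2 * b + 1 := hab
    exact_mod_cast mul_left_cancel₀ two_ne_zero (add_right_cancel this)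
  obtain ⟨q, hq, hq'⟩ := exists_entire_prod_factor hf (m := m)
    ((Finset.range N).image (fun i : ℕ => (2 * i + 1 : ℂ))) (fun x hx => by
      obtain ⟨i, hi, rfl⟩ := Finset.mem_image.1 hx
      exact h i (Finset.mem_range.1 hi))
  simp only [Finset.prod_image hinj.injOn] at hq'
  have hD : (0 : ℝ) < ((16 * N : ℝ) ^ N) ^ m := by positivity
  have hbound : ∀ z ∈ Metric.sphere (N : ℂ) (17 * N), ‖q z‖ ≤ A / ((16 * N : ℝ) ^ N) ^ m := by
    intro z hz
    rw [le_div_iff₀ hD, mul_comm]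
    refine le_trans ?_ (hA z hz)
    rw [hq' z, norm_mul, norm_pow, norm_prod]
    refine mul_le_mul_of_nonneg_right (pow_le_pow_left₀ (by positivity) ?_ _) (norm_nonneg _)
    calc (16 * N : ℝ) ^ N = ∏ _i ∈ Finset.range N, (16 * N : ℝ) := by simp
      _ ≤ _ := by
        refine Finset.prod_le_prod (fun i _ => by positivity) fun i hi => ?_
        have hi' : (i : ℝ) + 1 ≤ N := by exact_mod_cast Finset.mem_range.1 hi
        have hi0 : (0 : ℝ) ≤ i := Nat.cast_nonneg _
        rw [mem_sphere_iff_norm] at hz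
        have e : z - (2 * i + 1) = (z - N) - (((2 * i + 1 - N : ℝ)) : ℂ) := by push_cast; ring
        have hn : ‖(((2 * i + 1 - N : ℝ)) : ℂ)‖ ≤ N := by
          rw [Complex.norm_real, Real.norm_eq_abs, abs_le]
          constructor <;> linarith
        rw [e]
        have := norm_sub_norm_le (z - N) (((2 * i + 1 - N : ℝ)) : ℂ)
        linarith
  have hw : (w : ℂ) ∈ closure (Metric.ball (N : ℂ) (17 * N)) := by
    apply subset_closure
    rw [mem_ball_iff_norm]
    have e : (w : ℂ) - N = ((w - N : ℝ) : ℂ) := by push_cast; ring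
    rw [e, Complex.norm_real, Real.norm_eq_abs, abs_lt]
    constructor <;> linarith
  have hqw : ‖q w‖ ≤ A / ((16 * N : ℝ) ^ N) ^ m := by
    refine Complex.norm_le_of_forall_mem_frontier_norm_le Metric.isBounded_ball
      hq.diffContOnCl (fun z hz => hbound z ?_) hw
    rwa [frontier_ball _ (by positivity)] at hz
  have hp : ‖∏ i ∈ Finset.range N, ((w : ℂ) - (2 * i + 1))‖ ≤ (N : ℝ) ^ N := by
    rw [norm_prod]
    refine le_trans (le_of_eq (Finset.prod_congr rfl fun i _ => ?_)) (prod_abs_sub_odd_le N h0 h1)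
    rw [← Real.norm_eq_abs, ← Complex.norm_real]
    push_cast
    rfl
  rw [hq' w, norm_mul, norm_pow]
  calc _ ≤ ((N : ℝ) ^ N) ^ m * (A / ((16 * N : ℝ) ^ N) ^ m) :=
        mul_le_mul (pow_le_pow_left₀ (norm_nonneg _) hp _) hqw (norm_nonneg _) (by positivity)
    _ = _ := by
      have : (N : ℝ) ≠ 0 := hNr.ne'
      rw [mul_pow, mul_pow, ← pow_mul, ← pow_mul, div_pow, one_pow]
      field_simp

/-! ### A trigonometric correction to the identity -/

/-- A trigonometric polynomial vanishing at odd integers whose derivative there is `-1` to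
high order. -/
noncomputable def oddCorrection (k : ℕ) (w : ℂ) : ℂ :=
  ∑ j ∈ (Finset.range (2 * k + 1)).erase k, ((2 * k).choose j / (2 * k).choose k : ℂ) *
    ((Complex.exp ((j - k : ℂ) * w * (π * Complex.I)) -
      Complex.exp ((j - k : ℂ) * (π * Complex.I))) / ((j - k : ℂ) * (π * Complex.I)))

theorem differentiable_oddCorrection (k : ℕ) : Differentiable ℂ (oddCorrection k) := by
  unfold oddCorrection
  fun_prop

theorem oddCorrection_odd (k i : ℕ) : oddCorrection k (2 * i + 1) = 0 := by
  refine Finset.sum_eq_zero fun j _ => ?_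
  have : Complex.exp ((j - k : ℂ) * (2 * i + 1) * (π * Complex.I)) =
      Complex.exp ((j - k : ℂ) * (π * Complex.I)) := by
    rw [Complex.exp_eq_exp_iff_exists_int]
    exact ⟨((j : ℤ) - k) * i, by push_cast; ring⟩
  rw [this]
  simp

theorem hasDerivAt_oddCorrection (k : ℕ) (w : ℂ) : HasDerivAt (oddCorrection k)
    ((Complex.exp (w * (π * Complex.I) / 2) + Complex.exp (-(w * (π * Complex.I) / 2))) ^ (2 * k)
      / (2 * k).choose k - 1) w := by
  have hc : ((2 * k).choose k : ℂ) ≠ 0 := by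
    exact_mod_cast (Nat.choose_pos (by omega)).ne'
  have h1 : HasDerivAt (oddCorrection k) (∑ j ∈ (Finset.range (2 * k + 1)).erase k,
      ((2 * k).choose j / (2 * k).choose k : ℂ) *
      Complex.exp ((j - k : ℂ) * w * (π * Complex.I))) w := by
    refine HasDerivAt.fun_sum fun j hj => HasDerivAt.const_mul _ ?_
    have hjk : (j - k : ℂ) * (π * Complex.I) ≠ 0 := by
      refine mul_ne_zero (sub_ne_zero.2 ?_) (by simp [Real.pi_ne_zero])
      exact_mod_cast Finset.ne_of_mem_erase hj
    have : HasDerivAt (fun w : ℂ => Complex.exp ((j - k : ℂ) * w * (π * Complex.I)))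
        (Complex.exp ((j - k : ℂ) * w * (π * Complex.I)) * ((j - k : ℂ) * (π * Complex.I))) w := by
      have hl : HasDerivAt (fun w : ℂ => (j - k : ℂ) * w * (π * Complex.I))
          ((j - k : ℂ) * (π * Complex.I)) w := by
        simpa using ((hasDerivAt_id w).const_mul (j - k : ℂ)).mul_const (π * Complex.I)
      exact hl.cexp
    convert (this.sub_const _).div_const ((j - k : ℂ) * (π * Complex.I)) using 1
    rw [mul_div_assoc, div_self hjk, mul_one]
  convert h1 using 1
  have h2 : (∑ j ∈ Finset.range (2 * k + 1), ((2 * k).choose j / (2 * k).choose k : ℂ) *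
      Complex.exp ((j - k : ℂ) * w * (π * Complex.I))) =
      (Complex.exp (w * (π * Complex.I) / 2) + Complex.exp (-(w * (π * Complex.I) / 2))) ^ (2 * k)
      / (2 * k).choose k := by
    rw [add_pow, Finset.sum_div]
    refine Finset.sum_congr rfl fun j hj => ?_
    have hj' : j ≤ 2 * k := by simpa [Nat.lt_succ_iff] using hj
    rw [← Complex.exp_nat_mul, ← Complex.exp_nat_mul, ← Complex.exp_add, Nat.cast_sub hj']
    push_cast
    rw [show (j : ℂ) * (w * (π * Complex.I) / 2) + (2 * k - j) * -(w * (π * Complex.I) / 2)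
      = (j - k : ℂ) * w * (π * Complex.I) by ring]
    ring
  rw [← h2, ← Finset.add_sum_erase _ _ (Finset.mem_range.2 (by omega : k < 2 * k + 1))]
  simp [hc]

theorem exists_factor_add_oddCorrection (k i : ℕ) : ∃ q : ℂ → ℂ, Differentiable ℂ q ∧
    ∀ w, w + oddCorrection k w - (2 * i + 1) = (w - (2 * i + 1)) ^ (2 * k) * q w := by
  set x : ℂ := 2 * i + 1 with hx
  have hd := differentiable_oddCorrection k
  set f : ℂ → ℂ := fun w => w + oddCorrection k w with hf
  have hfd : Differentiable ℂ f := by fun_prop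
  have hfx : f x = x := by simp [hf, hx, oddCorrection_odd]
  have hder : deriv f = fun w => ((Complex.exp (w * (π * Complex.I) / 2) +
      Complex.exp (-(w * (π * Complex.I) / 2))) ^ (2 * k)) * ((2 * k).choose k : ℂ)⁻¹ := by
    ext w
    refine (((hasDerivAt_id w).add (hasDerivAt_oddCorrection k w)).congr_deriv ?_).deriv
    ring
  have hbase : AnalyticAt ℂ (fun w : ℂ => Complex.exp (w * (π * Complex.I) / 2) +
      Complex.exp (-(w * (π * Complex.I) / 2))) x := by fun_prop
  have hx0 : Complex.exp (x * (π * Complex.I) / 2) +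
      Complex.exp (-(x * (π * Complex.I) / 2)) = 0 := by
    have : Complex.exp (x * (π * Complex.I) / 2) =
        Complex.exp (-(x * (π * Complex.I) / 2)) * Complex.exp (π * Complex.I) := by
      rw [← Complex.exp_add, Complex.exp_eq_exp_iff_exists_int]
      exact ⟨i, by rw [hx]; push_cast; ring⟩
    rw [this, Complex.exp_pi_mul_I]
    ring
  have ho : ((2 * k : ℕ) : ℕ∞) ≤ analyticOrderAt (deriv f) x := by
    rw [hder]
    have e : (fun w => ((Complex.exp (w * (π * Complex.I) / 2) +
      Complex.exp (-(w * (π * Complex.I) / 2))) ^ (2 * k)) * ((2 * k).choose k : ℂ)⁻¹) =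
      (fun w : ℂ => Complex.exp (w * (π * Complex.I) / 2) +
      Complex.exp (-(w * (π * Complex.I) / 2))) ^ (2 * k) * fun _ => ((2 * k).choose k : ℂ)⁻¹ := by
      ext w; simp
    rw [e, analyticOrderAt_mul (hbase.pow _) analyticAt_const, analyticOrderAt_pow hbase]
    have h1 : 1 ≤ analyticOrderAt (fun w : ℂ => Complex.exp (w * (π * Complex.I) / 2) +
      Complex.exp (-(w * (π * Complex.I) / 2))) x := by
      rw [Order.one_le_iff_ne_zero, hbase.analyticOrderAt_ne_zero]
      exact hx0
    refine le_trans ?_ le_self_add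
    rw [nsmul_eq_mul]
    exact le_mul_of_one_le_right (by simp) h1
  have ho' : ((2 * k : ℕ) : ℕ∞) ≤ analyticOrderAt (f · - x) x := by
    have := (hfd.analyticAt x).analyticOrderAt_deriv_add_one
    rw [hfx] at this
    rw [← this]
    exact ho.trans le_self_add
  exact exists_entire_factor (by fun_prop) ho'

theorem norm_oddCorrection_le (k : ℕ) {w : ℂ} {y : ℝ} (hy : |w.im| ≤ y) :
    ‖oddCorrection k w‖ ≤ 2 * k * Real.exp (π * k * y) := by
  have hy0 : 0 ≤ y := (abs_nonneg _).trans hy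
  have hcard : ((Finset.range (2 * k + 1)).erase k).card = 2 * k := by
    rw [Finset.card_erase_of_mem (Finset.mem_range.2 (by omega))]; simp
  calc ‖oddCorrection k w‖ ≤ ∑ _j ∈ (Finset.range (2 * k + 1)).erase k,
        Real.exp (π * k * y) := by
        refine norm_sum_le_of_le _ fun j hj => ?_
        have hjk := Finset.ne_of_mem_erase hj
        have hj2 : j ≤ 2 * k := by
          have := Finset.mem_range.1 (Finset.mem_of_mem_erase hj); omega
        have e1 : ∀ z : ℝ, ‖Complex.exp ((j - k : ℂ) * z * (π * Complex.I))‖ = 1 := by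
          intro z
          have : (j - k : ℂ) * z * (π * Complex.I) = (((j - k) * z * π : ℝ) : ℂ) * Complex.I := by
            push_cast; ring
          rw [this, Complex.norm_exp_ofReal_mul_I]
        have hE : (1 : ℝ) ≤ Real.exp (π * k * y) := Real.one_le_exp (by positivity)
        have hjk' : |((j : ℝ) - k)| ≤ k := by
          have : (j : ℝ) ≤ 2 * k := by exact_mod_cast hj2
          rw [abs_le]; constructor <;> linarith [(Nat.cast_nonneg j : (0 : ℝ) ≤ j)]
        have e2 : ‖Complex.exp ((j - k : ℂ) * w * (π * Complex.I))‖ ≤ Real.exp (π * k * y) := by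
          rw [Complex.norm_exp]
          apply Real.exp_le_exp.2
          have : ((j - k : ℂ) * w * (π * Complex.I)).re = -(π * (((j : ℝ) - k) * w.im)) := by
            have : (j - k : ℂ) * w * (π * Complex.I) = (((j - k) * π : ℝ) : ℂ) * (w * Complex.I) := by
              push_cast; ring
            rw [this, Complex.re_ofReal_mul, Complex.mul_I_re]
            ring
          rw [this]
          have h3 : |((j : ℝ) - k) * w.im| ≤ k * y := by
            rw [abs_mul]; exact mul_le_mul hjk' hy (abs_nonneg _) (by positivity)
          have h4 := (abs_le.1 h3).1
          nlinarith [Real.pi_pos]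
        have e3 : (2 : ℝ) ≤ ‖(j - k : ℂ) * (π * Complex.I)‖ := by
          have h1 : (1 : ℝ) ≤ ‖(j - k : ℂ)‖ := by
            have h2 : (j - k : ℂ) = (((j : ℤ) - k : ℤ) : ℂ) := by push_cast; ring
            rw [h2, Complex.norm_intCast]
            have h3 : (j : ℤ) - k ≠ 0 := sub_ne_zero.2 (by exact_mod_cast hjk)
            have h4 := Int.one_le_abs h3
            rw [← Int.cast_abs]
            exact_mod_cast h4
          rw [norm_mul, norm_mul, Complex.norm_I, mul_one, Complex.norm_real, Real.norm_eq_abs,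
            abs_of_pos Real.pi_pos]
          nlinarith [Real.pi_gt_three]
        have e4 : ‖((2 * k).choose j / (2 * k).choose k : ℂ)‖ ≤ 1 := by
          rw [norm_div, Complex.norm_natCast, Complex.norm_natCast]
          refine div_le_one_of_le₀ ?_ (Nat.cast_nonneg _)
          have := Nat.choose_le_middle j (2 * k)
          rw [Nat.mul_div_cancel_left k two_pos] at this
          exact_mod_cast this
        rw [norm_mul]
        have e5 : ‖Complex.exp ((j - k : ℂ) * w * (π * Complex.I)) -
            Complex.exp ((j - k : ℂ) * (π * Complex.I))‖ ≤ 2 * Real.exp (π * k * y) := by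
          refine (norm_sub_le _ _).trans ?_
          have := e1 1
          simp only [Complex.ofReal_one, mul_one] at this
          linarith
        refine (mul_le_of_le_one_left (norm_nonneg _) e4).trans ?_
        rw [norm_div, div_le_iff₀ (by linarith)]
        nlinarith
    _ = _ := by simp [hcard]

/-- Binomial coefficients `z (z - 1) ⋯ (z - i + 1) / i!` in a complex algebra. -/
noncomputable def genBinom {A : Type*} [CommRing A] [Algebra ℂ A] (z : A) (i : ℕ) : A :=
  algebraMap ℂ A ((i.factorial : ℂ)⁻¹) * ∏ a ∈ Finset.range i, (z - (a : A))

section genBinom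

variable {A : Type*} [CommRing A] [Algebra ℂ A]

theorem genBinom_zero (z : A) : genBinom z 0 = 1 := by simp [genBinom]

theorem succ_mul_genBinom (z : A) (n : ℕ) :
    ((n : A) + 1) * genBinom z (n + 1) = (z - n) * genBinom z n := by
  have h : ((n : A) + 1) = algebraMap ℂ A ((n : ℂ) + 1) := by simp
  have h2 : ((n : ℂ) + 1) * (((n + 1).factorial : ℂ)⁻¹) = ((n.factorial : ℂ)⁻¹) := by
    have : ((n : ℂ) + 1) ≠ 0 := by exact_mod_cast n.succ_ne_zero
    rw [Nat.factorial_succ]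
    push_cast
    field_simp
  rw [genBinom, h, ← mul_assoc, ← map_mul, h2, genBinom, Finset.prod_range_succ]
  ring

theorem genBinom_add (x y : A) (n : ℕ) : genBinom (x + y) n =
    ∑ p ∈ Finset.HasAntidiagonal.antidiagonal n, genBinom x p.1 * genBinom y p.2 := by
  induction n with
  | zero => simp [genBinom_zero]
  | succ n ih =>
    have hu : IsUnit ((n : A) + 1) := by
      have h : ((n : A) + 1) = algebraMap ℂ A ((n : ℂ) + 1) := by simp
      rw [h]
      exact (IsUnit.mk0 _ (by exact_mod_cast n.succ_ne_zero)).map _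
    apply hu.mul_left_cancel
    rw [succ_mul_genBinom, ih, Finset.mul_sum]
    have h1 : ∑ p ∈ Finset.HasAntidiagonal.antidiagonal (n + 1), (p.1 : A) * (genBinom x p.1 * genBinom y p.2) =
        ∑ p ∈ Finset.HasAntidiagonal.antidiagonal n, (x - p.1) * (genBinom x p.1 * genBinom y p.2) := by
      rw [Finset.Nat.sum_antidiagonal_succ]
      simp only [Nat.cast_zero, zero_mul, zero_add]
      refine Finset.sum_congr rfl fun p _ => ?_
      rw [← mul_assoc, Nat.cast_add, Nat.cast_one, succ_mul_genBinom]
      ring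
    have h2 : ∑ p ∈ Finset.HasAntidiagonal.antidiagonal (n + 1), (p.2 : A) * (genBinom x p.1 * genBinom y p.2) =
        ∑ p ∈ Finset.HasAntidiagonal.antidiagonal n, (y - p.2) * (genBinom x p.1 * genBinom y p.2) := by
      rw [Finset.Nat.sum_antidiagonal_succ']
      simp only [Nat.cast_zero, zero_mul, zero_add]
      refine Finset.sum_congr rfl fun p _ => ?_
      have := succ_mul_genBinom y p.2
      rw [Nat.cast_add, Nat.cast_one]
      linear_combination genBinom x p.1 * this
    have h3 : ((n : A) + 1) * ∑ p ∈ Finset.HasAntidiagonal.antidiagonal (n + 1), genBinom x p.1 * genBinom y p.2 =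
        ∑ p ∈ Finset.HasAntidiagonal.antidiagonal (n + 1), (p.1 : A) * (genBinom x p.1 * genBinom y p.2) +
        ∑ p ∈ Finset.HasAntidiagonal.antidiagonal (n + 1), (p.2 : A) * (genBinom x p.1 * genBinom y p.2) := by
      rw [Finset.mul_sum, ← Finset.sum_add_distrib]
      refine Finset.sum_congr rfl fun p hp => ?_
      have : ((p.1 + p.2 : ℕ) : A) = ((n + 1 : ℕ) : A) := by rw [Finset.HasAntidiagonal.mem_antidiagonal.1 hp]
      push_cast at this
      linear_combination -(genBinom x p.1 * genBinom y p.2) * this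
    rw [h3, h1, h2, ← Finset.sum_add_distrib]
    refine Finset.sum_congr rfl fun p hp => ?_
    have : ((p.1 + p.2 : ℕ) : A) = (n : A) := by rw [Finset.HasAntidiagonal.mem_antidiagonal.1 hp]
    push_cast at this
    linear_combination (genBinom x p.1 * genBinom y p.2) * this

theorem genBinom_algebraMap (x : ℂ) (i : ℕ) :
    genBinom (algebraMap ℂ A x) i = algebraMap ℂ A (genBinom x i) := by
  simp only [genBinom, map_mul, map_prod, map_sub, map_natCast, Algebra.algebraMap_self,
    RingHom.id_apply]

end genBinom

/-- The coefficients `2 ^ v * binom (s / 2 ^ e, i)` are integral. -/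
theorem exists_int_genBinom_two_pow (s : ℤ) (e i : ℕ) :
    ∃ n : ℤ, (2 ^ (e + 1) : ℂ) ^ i * genBinom ((s : ℂ) / 2 ^ e) i = n := by
  obtain ⟨v, c, hc, hvc⟩ := Nat.exists_eq_two_pow_mul_odd (Nat.factorial_ne_zero i)
  have hvi : v ≤ i := by
    rcases Nat.eq_zero_or_pos i with rfl | hi
    · by_contra hv
      have hd : 2 ∣ 1 := by
        rw [Nat.factorial_zero] at hvc
        rw [hvc]
        exact (dvd_pow_self 2 (by omega)).mul_right _
      omega
    · have h1 := Nat.emultiplicity_two_factorial_lt (n := i) hi.ne'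
      have h2 : (v : ℕ∞) ≤ emultiplicity 2 i.factorial :=
        le_emultiplicity_of_pow_dvd ⟨c, hvc⟩
      exact_mod_cast (h2.trans_lt h1).le
  have hcop : IsCoprime ((2 : ℤ) ^ e) c := by
    apply IsCoprime.pow_left
    have : Nat.Coprime 2 c := (Nat.coprime_two_left).2 hc
    exact_mod_cast Nat.isCoprime_iff_coprime.2 this
  obtain ⟨t, r, htr⟩ := hcop
  have hc0 : (0 : ℤ) < c := by exact_mod_cast hc.pos
  have hdvd : (c : ℤ) ∣ ∏ a ∈ Finset.range i, (s - 2 ^ e * a) := by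
    set n : ℕ := ((s * t) % c).toNat + c * i with hn
    have hns : (n : ℤ) ≡ s * t [ZMOD c] := by
      rw [hn]
      push_cast
      rw [Int.toNat_of_nonneg (Int.emod_nonneg _ hc0.ne')]
      have : (s * t % c + c * i : ℤ) ≡ s * t % c [ZMOD c] := by
        rw [Int.modEq_iff_dvd]
        exact ⟨-i, by ring⟩
      exact this.trans (Int.mod_modEq _ _)
    have hni : i ≤ n := by nlinarith [hc.pos, Nat.zero_le ((s * t % c).toNat)]
    have h1 : ∏ a ∈ Finset.range i, (s - 2 ^ e * a : ℤ) ≡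
        ∏ a ∈ Finset.range i, (2 ^ e * (n - a) : ℤ) [ZMOD c] := by
      refine Int.ModEq.prod fun a _ => ?_
      have h2 : (2 ^ e * (n - a) : ℤ) ≡ 2 ^ e * (s * t - a) [ZMOD c] :=
        (hns.sub_right _).mul_left _
      refine Int.ModEq.trans ?_ h2.symm
      rw [Int.modEq_iff_dvd]
      exact ⟨-(s * r), by linear_combination s * htr⟩
    have h3 : (c : ℤ) ∣ ∏ a ∈ Finset.range i, (2 ^ e * (n - a) : ℤ) := by
      rw [Finset.prod_mul_distrib]
      refine Dvd.dvd.mul_left ?_ _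
      have h4 : ∏ a ∈ Finset.range i, ((n : ℤ) - a) = (n.descFactorial i : ℤ) := by
        rw [Nat.descFactorial_eq_prod_range, Nat.cast_prod]
        refine Finset.prod_congr rfl fun a ha => ?_
        rw [Nat.cast_sub (by have := Finset.mem_range.1 ha; omega)]
      rw [h4]
      exact_mod_cast (Dvd.intro_left _ hvc.symm).trans (Nat.factorial_dvd_descFactorial n i)
    exact (Int.ModEq.dvd_iff h1).2 h3
  obtain ⟨g, hg⟩ := hdvd
  refine ⟨2 ^ (i - v) * g, ?_⟩
  have hfac : (i.factorial : ℂ) = 2 ^ v * c := by rw [hvc]; push_cast; rfl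
  have hcc : (c : ℂ) ≠ 0 := by exact_mod_cast hc.pos.ne'
  have hprod : (2 ^ e : ℂ) ^ i * ∏ a ∈ Finset.range i, ((s : ℂ) / 2 ^ e - a) = c * g := by
    have : (2 ^ e : ℂ) ^ i = ∏ _a ∈ Finset.range i, (2 ^ e : ℂ) := by simp
    rw [this, ← Finset.prod_mul_distrib]
    have hg' : ((∏ a ∈ Finset.range i, (s - 2 ^ e * a) : ℤ) : ℂ) = c * g := by
      rw [hg]; push_cast; rfl
    rw [← hg']
    push_cast
    refine Finset.prod_congr rfl fun a _ => ?_
    have : (2 ^ e : ℂ) ≠ 0 := pow_ne_zero _ two_ne_zero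
    field_simp
  have h2 : (2 : ℂ) ^ i = 2 ^ (i - v) * 2 ^ v := by rw [← pow_add]; congr 1; omega
  rw [genBinom, hfac, Algebra.algebraMap_self, RingHom.id_apply, pow_succ, mul_pow]
  push_cast
  calc _ = 2 ^ i * (2 ^ v * (c : ℂ))⁻¹ *
        ((2 ^ e : ℂ) ^ i * ∏ a ∈ Finset.range i, ((s : ℂ) / 2 ^ e - a)) := by ring
    _ = _ := by
      rw [hprod, h2]
      field_simp

theorem exists_int_genBinom_int (s : ℤ) (i : ℕ) : ∃ n : ℤ, genBinom (s : ℂ) i = n := by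
  refine ⟨Ring.choose s i, ?_⟩
  have h := Ring.descPochhammer_eq_factorial_smul_choose s i
  have h2 : ((∏ a ∈ Finset.range i, (s - a) : ℤ) : ℂ) = i.factorial * (Ring.choose s i : ℤ) := by
    rw [← descPochhammer_eval_eq_prod_range, Polynomial.eval_eq_smeval, h]
    simp
  rw [genBinom]
  push_cast at h2
  rw [h2, Algebra.algebraMap_self, RingHom.id_apply,
    inv_mul_cancel_left₀ (by exact_mod_cast Nat.factorial_ne_zero i)]

/-! ### Feldman polynomials -/

/-- The Feldman polynomial `binom(X, h) ^ i * binom(X, j)`. -/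
noncomputable def feldman (h i j : ℕ) : Polynomial ℂ :=
  genBinom Polynomial.X h ^ i * genBinom Polynomial.X j

open Polynomial in
theorem genBinom_X (i : ℕ) : genBinom (X : ℂ[X]) i =
    C ((i.factorial : ℂ)⁻¹) * ∏ a ∈ Finset.range i, (X - C (a : ℂ)) := by
  simp [genBinom]

open Polynomial in
theorem natDegree_genBinom_X (i : ℕ) : (genBinom (X : ℂ[X]) i).natDegree = i := by
  rw [genBinom_X, natDegree_C_mul (by simp [Nat.factorial_ne_zero]),
    natDegree_prod_of_monic _ _ fun a _ => monic_X_sub_C _]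
  simp only [natDegree_X_sub_C]
  simp

open Polynomial in
theorem genBinom_X_ne_zero (i : ℕ) : genBinom (X : ℂ[X]) i ≠ 0 := by
  rw [genBinom_X]
  refine mul_ne_zero (by simp [Nat.factorial_ne_zero]) ?_
  exact (monic_prod_of_monic _ _ fun a _ => monic_X_sub_C _).ne_zero

theorem feldman_ne_zero (h i j : ℕ) : feldman h i j ≠ 0 :=
  mul_ne_zero (pow_ne_zero _ (genBinom_X_ne_zero h)) (genBinom_X_ne_zero j)

theorem natDegree_feldman (h i j : ℕ) : (feldman h i j).natDegree = h * i + j := by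
  rw [feldman, Polynomial.natDegree_mul (pow_ne_zero _ (genBinom_X_ne_zero h))
    (genBinom_X_ne_zero j), Polynomial.natDegree_pow, natDegree_genBinom_X, natDegree_genBinom_X]
  ring

/-- A nontrivial combination of Feldman polynomials is nonzero. -/
theorem sum_feldman_ne_zero {h T' : ℕ} (c : ℕ × ℕ → ℂ) {k : ℕ × ℕ}
    (hk : k ∈ Finset.range T' ×ˢ Finset.range h) (hck : c k ≠ 0) :
    ∑ k ∈ Finset.range T' ×ˢ Finset.range h, c k • feldman h k.1 k.2 ≠ 0 := by
  set s := Finset.range T' ×ˢ Finset.range h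
  have hs : ∀ p ∈ s, p.2 < h := fun p hp => by simpa using (Finset.mem_product.1 hp).2
  obtain ⟨m, hm, hmax⟩ := Finset.exists_max_image (s.filter fun p => c p ≠ 0)
    (fun p => h * p.1 + p.2) ⟨k, by simp [hk, hck]⟩
  obtain ⟨hms, hcm⟩ := Finset.mem_filter.1 hm
  intro h0
  have h1 := congrArg (fun P => Polynomial.coeff P (h * m.1 + m.2)) h0
  simp only [Polynomial.finsetSum_coeff, Polynomial.coeff_smul, Polynomial.coeff_zero,
    smul_eq_mul] at h1
  rw [Finset.sum_eq_single m] at h1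
  · have h2 : (feldman h m.1 m.2).coeff (h * m.1 + m.2) ≠ 0 := by
      rw [← natDegree_feldman]
      exact Polynomial.leadingCoeff_ne_zero.2 (feldman_ne_zero _ _ _)
    exact (mul_ne_zero hcm h2) h1
  · intro p hp hpm
    by_cases hcp : c p = 0
    · simp [hcp]
    · have h3 := hmax p (Finset.mem_filter.2 ⟨hp, hcp⟩)
      have hlt : h * p.1 + p.2 < h * m.1 + m.2 := by
        refine lt_of_le_of_ne h3 fun he => hpm ?_
        have ha := hs p hp
        have hb := hs m hms
        have hpos : 0 < h := by omega
        have e1 : (h * p.1 + p.2) / h = p.1 := by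
          rw [Nat.mul_add_div hpos, Nat.div_eq_of_lt ha, add_zero]
        have e2 : (h * m.1 + m.2) / h = m.1 := by
          rw [Nat.mul_add_div hpos, Nat.div_eq_of_lt hb, add_zero]
        have e3 : p.1 = m.1 := by rw [← e1, ← e2, he]
        refine Prod.ext e3 ?_
        simp only [e3] at he
        omega
      rw [Polynomial.coeff_eq_zero_of_natDegree_lt (by rw [natDegree_feldman]; exact hlt), mul_zero]
  · intro h; exact absurd hms h

/-- Coefficientwise domination of a complex polynomial by a real one. -/
def Majorizes (G : Polynomial ℝ) (P : Polynomial ℂ) : Prop :=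
  ∀ k, ‖P.coeff k‖ ≤ G.coeff k

namespace Majorizes

variable {G G' : Polynomial ℝ} {P P' : Polynomial ℂ}

theorem mul (h : Majorizes G P) (h' : Majorizes G' P') : Majorizes (G * G') (P * P') := by
  intro k
  rw [Polynomial.coeff_mul, Polynomial.coeff_mul]
  refine norm_sum_le_of_le _ fun p _ => ?_
  rw [norm_mul]
  exact mul_le_mul (h _) (h' _) (norm_nonneg _) ((norm_nonneg _).trans (h _))

theorem one : Majorizes 1 1 := by
  intro k
  rw [Polynomial.coeff_one, Polynomial.coeff_one]
  split_ifs <;> simp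

theorem pow (h : Majorizes G P) (n : ℕ) : Majorizes (G ^ n) (P ^ n) := by
  induction n with
  | zero => simpa using one
  | succ n ih => rw [pow_succ, pow_succ]; exact ih.mul h

theorem prod {ι : Type*} (s : Finset ι) {g : ι → Polynomial ℝ} {p : ι → Polynomial ℂ}
    (h : ∀ i ∈ s, Majorizes (g i) (p i)) : Majorizes (∏ i ∈ s, g i) (∏ i ∈ s, p i) := by
  classical
  induction s using Finset.induction_on with
  | empty => simpa using one
  | insert a s ha ih =>
    rw [Finset.prod_insert ha, Finset.prod_insert ha]
    exact (h a (Finset.mem_insert_self _ _)).mul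
      (ih fun i hi => h i (Finset.mem_insert_of_mem hi))

theorem C {z : ℂ} {b : ℝ} (h : ‖z‖ ≤ b) : Majorizes (Polynomial.C b) (Polynomial.C z) := by
  intro k
  rw [Polynomial.coeff_C, Polynomial.coeff_C]
  split_ifs <;> simp [h]

theorem X_add_C {z : ℂ} {b : ℝ} (h : ‖z‖ ≤ b) :
    Majorizes (Polynomial.X + Polynomial.C b) (Polynomial.X + Polynomial.C z) := by
  intro k
  rw [Polynomial.coeff_add, Polynomial.coeff_add, Polynomial.coeff_C, Polynomial.coeff_C,
    Polynomial.coeff_X, Polynomial.coeff_X]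
  split_ifs <;> simp_all

theorem norm_coeff_le (h : Majorizes G P) (k : ℕ) : ‖P.coeff k‖ ≤ G.eval 1 := by
  have h0 : ∀ i, 0 ≤ G.coeff i := fun i => (norm_nonneg _).trans (h i)
  rw [Polynomial.eval_eq_sum_range]
  simp only [one_pow, mul_one]
  by_cases hk : k ≤ G.natDegree
  · exact (h k).trans (Finset.single_le_sum (f := fun i => G.coeff i) (fun i _ => h0 i)
      (Finset.mem_range.2 (by omega)))
  · refine (h k).trans ?_
    rw [Polynomial.coeff_eq_zero_of_natDegree_lt (by omega)]
    exact Finset.sum_nonneg fun i _ => h0 i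

end Majorizes

open Polynomial in
theorem exists_majorizes_genBinom (x : ℂ) {h i : ℕ} (hi : i ≤ h) :
    ∃ G : ℝ[X], Majorizes G (taylor x (genBinom (X : ℂ[X]) i)) ∧ 0 ≤ G.eval 1 ∧
      G.eval 1 ≤ (‖x‖ + h) ^ i / i.factorial := by
  refine ⟨C ((i.factorial : ℝ)⁻¹) * ∏ a ∈ Finset.range i, (X + C (‖x‖ + a)), ?_, ?_, ?_⟩
  · rw [genBinom_X, taylor_mul, taylor_C, ← taylorAlgHom_apply, map_prod]
    refine (Majorizes.C (by simp)).mul (Majorizes.prod _ fun a _ => ?_)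
    have : (taylorAlgHom x) (X - C (a : ℂ)) = X + C (x - a) := by
      rw [taylorAlgHom_apply, map_sub, taylor_X, taylor_C, C_sub]; ring
    rw [this]
    refine Majorizes.X_add_C ((norm_sub_le _ _).trans ?_)
    simp
  · rw [eval_mul, eval_prod]
    simp only [eval_C, eval_add, eval_X]
    positivity
  · rw [eval_mul, eval_prod]
    simp only [eval_C, eval_add, eval_X]
    rw [div_eq_inv_mul]
    refine mul_le_mul_of_nonneg_left ?_ (by positivity)
    calc _ ≤ ∏ _a ∈ Finset.range i, (‖x‖ + h) := by
          refine Finset.prod_le_prod (fun a _ => by positivity) fun a ha => ?_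
          have : (a : ℝ) + 1 ≤ h := by
            exact_mod_cast (Finset.mem_range.1 ha).trans_le hi
          linarith
      _ = _ := by simp

theorem pow_div_factorial_le {h i : ℕ} (hh : 0 < h) (hi : i ≤ h) {y : ℝ} (hy : (h : ℝ) ≤ y) :
    y ^ i / i.factorial ≤ (Real.exp 1 * y / h) ^ h := by
  have hr : (0 : ℝ) < h := by exact_mod_cast hh
  have h1 : (h : ℝ) ^ i / i.factorial ≤ Real.exp h :=
    Real.pow_div_factorial_le_exp _ hr.le _
  have h2 : 1 ≤ y / h := (one_le_div hr).2 hy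
  calc y ^ i / i.factorial = (y / h) ^ i * (h ^ i / i.factorial) := by
        rw [div_pow]; field_simp
    _ ≤ (y / h) ^ h * Real.exp h :=
        mul_le_mul (pow_le_pow_right₀ h2 hi) h1 (by positivity) (by positivity)
    _ = _ := by
        have : Real.exp h = Real.exp 1 ^ h := by rw [← Real.exp_nat_mul, mul_one]
        rw [this, ← mul_pow]
        congr 1
        ring

theorem norm_hasseDeriv_feldman_le {h i j T' : ℕ} (hi : i < T') (hj : j < h) (k : ℕ) (x : ℂ) :
    ‖(Polynomial.hasseDeriv k (feldman h i j)).eval x‖ ≤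
      (Real.exp 1 * (‖x‖ + h) / h) ^ (h * T') := by
  rw [← Polynomial.taylor_coeff]
  obtain ⟨G, hG, hG0, hG1⟩ := exists_majorizes_genBinom x (le_refl h)
  obtain ⟨G', hG', hG'0, hG'1⟩ := exists_majorizes_genBinom x hj.le
  have hh : 0 < h := by omega
  have hr : (0 : ℝ) < h := by exact_mod_cast hh
  have hy : (h : ℝ) ≤ ‖x‖ + h := by linarith [norm_nonneg x]
  set E := Real.exp 1 * (‖x‖ + h) / h with hE
  have hE1 : 1 ≤ E := by
    rw [hE, le_div_iff₀ hr]
    nlinarith [Real.add_one_le_exp 1]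
  have hm : Majorizes (G ^ i * G') (Polynomial.taylor x (feldman h i j)) := by
    rw [feldman, Polynomial.taylor_mul, Polynomial.taylor_pow]
    exact (hG.pow i).mul hG'
  refine (hm.norm_coeff_le k).trans ?_
  rw [Polynomial.eval_mul, Polynomial.eval_pow]
  have a := hG1.trans (pow_div_factorial_le hh le_rfl hy)
  have b := hG'1.trans (pow_div_factorial_le hh hj.le hy)
  calc _ ≤ (E ^ h) ^ i * E ^ h :=
        mul_le_mul (pow_le_pow_left₀ hG0 a _) b hG'0 (by positivity)
    _ = E ^ (h * (i + 1)) := by rw [← pow_mul, ← pow_add]; congr 1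
    _ ≤ _ := pow_le_pow_right₀ hE1 (Nat.mul_le_mul_left _ hi)

open Polynomial in
/-- `D * P(x + ν X)` has integer coefficients. -/
def IntegralAt (x : ℂ) (ν : ℕ) (D : ℕ) (P : ℂ[X]) : Prop :=
  ∃ g : ℤ[X], (D : ℂ[X]) * P.comp (C x + C (ν : ℂ) * X) = g.map (Int.castRingHom ℂ)

namespace IntegralAt

open Polynomial

variable {x : ℂ} {ν D D' : ℕ} {P P' : ℂ[X]}

theorem mul (h : IntegralAt x ν D P) (h' : IntegralAt x ν D' P') :
    IntegralAt x ν (D * D') (P * P') := by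
  obtain ⟨g, hg⟩ := h
  obtain ⟨g', hg'⟩ := h'
  refine ⟨g * g', ?_⟩
  rw [Polynomial.map_mul, ← hg, ← hg', mul_comp]
  push_cast
  ring

theorem pow (h : IntegralAt x ν D P) (n : ℕ) : IntegralAt x ν (D ^ n) (P ^ n) := by
  induction n with
  | zero => exact ⟨1, by simp⟩
  | succ n ih => rw [pow_succ, pow_succ]; exact ih.mul h

theorem of_dvd (h : IntegralAt x ν D P) (hd : D ∣ D') : IntegralAt x ν D' P := by
  obtain ⟨g, hg⟩ := h
  obtain ⟨c, rfl⟩ := hd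
  refine ⟨c * g, ?_⟩
  rw [Polynomial.map_mul, ← hg]
  push_cast
  simp
  ring

theorem exists_int (h : IntegralAt x ν D P) {k M : ℕ} (hk : k ≤ M) :
    ∃ n : ℤ, (D : ℂ) * (ν : ℂ) ^ M * (hasseDeriv k P).eval x = n := by
  obtain ⟨g, hg⟩ := h
  have h1 := congrArg (fun Q => coeff Q k) hg
  have h2 : P.comp (C x + C (ν : ℂ) * X) = (taylor x P).comp (C (ν : ℂ) * X) := by
    rw [taylor_apply, comp_assoc]
    simp [add_comm]
  rw [h2] at h1
  simp only [coeff_map] at h1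
  rw [show (D : ℂ[X]) = C (D : ℂ) by simp, coeff_C_mul, comp_C_mul_X_coeff, taylor_coeff] at h1
  refine ⟨ν ^ (M - k) * g.coeff k, ?_⟩
  have h3 : (ν : ℂ) ^ M = ν ^ (M - k) * ν ^ k := by rw [← pow_add]; congr 1; omega
  rw [h3]
  simp only [eq_intCast] at h1
  push_cast
  rw [← h1]
  ring

theorem genBinom_C_mul_X {ν h l : ℕ} (hl : l ≤ h) (hν : Nat.lcmUpto h ∣ ν) :
    ∃ g : ℤ[X], genBinom (C (ν : ℂ) * X) l = g.map (Int.castRingHom ℂ) := by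
  rcases l with _ | l
  · exact ⟨1, by simp [genBinom_zero]⟩
  have hd : ∀ a, 1 ≤ a → a ≤ h → a ∣ ν := fun a h1 h2 =>
    (Finset.dvd_lcm (f := id) (Finset.mem_Icc.2 ⟨h1, h2⟩)).trans hν
  choose! f hf using hd
  refine ⟨C (f (l + 1) : ℤ) * X * ∏ a ∈ Finset.range l, (C (f (a + 1) : ℤ) * X - 1), ?_⟩
  rw [genBinom, Finset.prod_range_succ', Polynomial.map_mul, Polynomial.map_prod]
  have h1 : ∏ a ∈ Finset.range l, (C (ν : ℂ) * X - ((a + 1 : ℕ) : ℂ[X])) =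
      C (l.factorial : ℂ) * ∏ a ∈ Finset.range l,
        ((C (f (a + 1) : ℤ) * X - 1 : ℤ[X]).map (Int.castRingHom ℂ)) := by
    rw [← Finset.prod_range_add_one_eq_factorial, Nat.cast_prod, map_prod,
      ← Finset.prod_mul_distrib]
    refine Finset.prod_congr rfl fun a ha => ?_
    have := hf (a + 1) (by omega) (by have := Finset.mem_range.1 ha; omega)
    rw [this]
    simp
    ring
  rw [h1]
  have h2 := hf (l + 1) (by omega) hl
  have h3 : ((l + 1).factorial : ℂ)⁻¹ * l.factorial * ν = f (l + 1) := by
    rw [Nat.factorial_succ, h2]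
    have : (l.factorial : ℂ) ≠ 0 := by exact_mod_cast Nat.factorial_ne_zero l
    have : ((l : ℂ) + 1) ≠ 0 := by exact_mod_cast l.succ_ne_zero
    push_cast
    field_simp
  have h4 : (C ((f (l + 1) : ℤ)) * X : ℤ[X]).map (Int.castRingHom ℂ) =
      C (((l + 1).factorial : ℂ)⁻¹ * l.factorial * ν) * X := by
    rw [h3]; simp
  rw [h4, algebraMap_eq, C_mul, C_mul]
  simp only [Nat.cast_zero, sub_zero]
  ring

theorem genBinom_X {ν h D : ℕ} {x : ℂ} (hν : Nat.lcmUpto h ∣ ν)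
    (hx : ∀ i, ∃ n : ℤ, (D : ℂ) ^ i * genBinom x i = n) {i : ℕ} (hi : i ≤ h) :
    IntegralAt x ν (D ^ i) (genBinom X i) := by
  choose n hn using hx
  have hg : ∀ l : ℕ, l ≤ h → ∃ g : ℤ[X], genBinom (C (ν : ℂ) * X) l = g.map (Int.castRingHom ℂ) :=
    fun l hl => genBinom_C_mul_X hl hν
  choose! g hg using hg
  refine ⟨∑ p ∈ Finset.HasAntidiagonal.antidiagonal i, (D ^ p.2 : ℕ) * C (n p.1) * g p.2, ?_⟩
  have h1 : (genBinom (X : ℂ[X]) i).comp (C x + C (ν : ℂ) * X) =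
      genBinom (C x + C (ν : ℂ) * X) i := by
    rw [_root_.genBinom_X, genBinom, mul_comp, C_comp, prod_comp]
    simp [algebraMap_eq]
  rw [h1, genBinom_add, Finset.mul_sum, Polynomial.map_sum]
  refine Finset.sum_congr rfl fun p hp => ?_
  have hpi := Finset.HasAntidiagonal.mem_antidiagonal.1 hp
  have hx' : genBinom (C x : ℂ[X]) p.1 = C (genBinom x p.1) := genBinom_algebraMap x p.1
  rw [hg p.2 (by omega), hx', Polynomial.map_mul, Polynomial.map_mul, Polynomial.map_natCast, map_C,
    eq_intCast, ← hn p.1, ← hpi, pow_add]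
  simp only [C_mul, C_pow, map_natCast]
  push_cast
  ring

theorem feldman {ν h D T' : ℕ} {x : ℂ} (hν : Nat.lcmUpto h ∣ ν)
    (hx : ∀ i, ∃ n : ℤ, (D : ℂ) ^ i * genBinom x i = n) {i j : ℕ} (hi : i < T') (hj : j < h) :
    IntegralAt x ν (D ^ (h * T')) (feldman h i j) := by
  refine (((genBinom_X hν hx le_rfl).pow i).mul (genBinom_X hν hx hj.le)).of_dvd ?_
  rw [← pow_mul, ← pow_add]
  refine pow_dvd_pow _ ?_
  calc h * i + j ≤ h * i + h := by omega
    _ = h * (i + 1) := by ring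
    _ ≤ h * T' := Nat.mul_le_mul_left _ hi

end IntegralAt

/-! ### Functions vanishing to a given order -/

/-- `f` and `g` agree up to order `m` at `x`, through an entire cofactor. -/
def EqUpTo (m : ℕ) (x : ℂ) (f g : ℂ → ℂ) : Prop :=
  ∃ q : ℂ → ℂ, Differentiable ℂ q ∧ ∀ w, f w = g w + (w - x) ^ m * q w

namespace EqUpTo

variable {m : ℕ} {x : ℂ} {f g f' g' : ℂ → ℂ}

theorem refl (f : ℂ → ℂ) : EqUpTo m x f f := ⟨fun _ => 0, by fun_prop, by simp⟩

theorem trans (h : EqUpTo m x f g) (h' : EqUpTo m x g f') : EqUpTo m x f f' := by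
  obtain ⟨q, hq, h⟩ := h
  obtain ⟨q', hq', h'⟩ := h'
  exact ⟨fun w => q w + q' w, by fun_prop, fun w => by rw [h, h']; ring⟩

theorem mul (h : EqUpTo m x f g) (h' : EqUpTo m x f' g') (hf : Differentiable ℂ f')
    (hg : Differentiable ℂ g) : EqUpTo m x (fun w => f w * f' w) (fun w => g w * g' w) := by
  obtain ⟨q, hq, h⟩ := h
  obtain ⟨q', hq', h'⟩ := h'
  exact ⟨fun w => q w * f' w + g w * q' w, by fun_prop, fun w => by
    simp only [h w]; linear_combination g w * h' w⟩

theorem sum {ι : Type*} (s : Finset ι) {f g : ι → ℂ → ℂ} (h : ∀ i, EqUpTo m x (f i) (g i)) :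
    EqUpTo m x (fun w => ∑ i ∈ s, f i w) (fun w => ∑ i ∈ s, g i w) := by
  choose q hq h using h
  refine ⟨fun w => ∑ i ∈ s, q i w, by fun_prop, fun w => ?_⟩
  simp only [h, Finset.sum_add_distrib, Finset.mul_sum]

theorem pow_of_le {n : ℕ} (h : m ≤ n) (c : ℂ) :
    EqUpTo m x (fun w => c * (w - x) ^ n) (fun _ => 0) :=
  ⟨fun w => c * (w - x) ^ (n - m), by fun_prop, fun w => by
    have : (w - x) ^ n = (w - x) ^ m * (w - x) ^ (n - m) := by rw [← pow_add]; congr 1; omega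
    simp only [this]; ring⟩

theorem le_analyticOrderAt (h : EqUpTo m x f (fun _ => 0)) : (m : ℕ∞) ≤ analyticOrderAt f x := by
  obtain ⟨q, hq, h⟩ := h
  exact le_analyticOrderAt_of_eq hq fun w => by rw [h, zero_add]

theorem expTail_order (m : ℕ) : (m : ℕ∞) ≤ analyticOrderAt
    (fun z : ℂ => Complex.exp z - ∑ r ∈ Finset.range m, z ^ r / (r.factorial : ℂ)) 0 := by
  induction m with
  | zero => simp
  | succ m ih =>
    set f : ℂ → ℂ := fun z : ℂ =>
      Complex.exp z - ∑ r ∈ Finset.range (m + 1), z ^ r / (r.factorial : ℂ) with hf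
    have hfd : Differentiable ℂ f := by fun_prop
    have h0 : f 0 = 0 := by
      simp [hf, Finset.sum_range_succ']
    have hd : deriv f = fun z : ℂ =>
        Complex.exp z - ∑ r ∈ Finset.range m, z ^ r / (r.factorial : ℂ) := by
      ext z
      have h1 : ∀ r ∈ Finset.range (m + 1), HasDerivAt (fun z : ℂ => z ^ r / (r.factorial : ℂ))
          (r * z ^ (r - 1) / (r.factorial : ℂ)) z := fun r _ => (hasDerivAt_pow r z).div_const _
      have h2 := (Complex.hasDerivAt_exp z).sub (HasDerivAt.fun_sum h1)
      refine h2.deriv.trans ?_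
      rw [Finset.sum_range_succ']
      congr 1
      simp only [Nat.cast_zero, zero_mul, zero_div, add_zero]
      refine Finset.sum_congr rfl fun r _ => ?_
      rw [Nat.factorial_succ]
      have : (r.factorial : ℂ) ≠ 0 := by exact_mod_cast r.factorial_ne_zero
      have : ((r : ℂ) + 1) ≠ 0 := by exact_mod_cast r.succ_ne_zero
      push_cast
      field_simp
    have h3 := (hfd.analyticAt 0).analyticOrderAt_deriv_add_one
    simp only [h0, sub_zero] at h3
    change _ ≤ analyticOrderAt f 0
    rw [← h3, hd]
    push_cast
    gcongr

theorem exp (m : ℕ) (x c : ℂ) : EqUpTo m x (fun w => Complex.exp (c * (w - x)))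
    (fun w => ∑ r ∈ Finset.range m, c ^ r / (r.factorial : ℂ) * (w - x) ^ r) := by
  obtain ⟨q, hq, h⟩ := exists_entire_factor (by fun_prop) (expTail_order m)
  refine ⟨fun w => c ^ m * q (c * (w - x)), by fun_prop, fun w => ?_⟩
  have := h (c * (w - x))
  rw [sub_eq_iff_eq_add, sub_zero, mul_pow] at this
  simp only [this]
  rw [add_comm]
  congr 1
  · exact Finset.sum_congr rfl fun r _ => by rw [mul_pow]; ring
  · ring

theorem exp_mul {g : ℂ → ℂ} (hg : Differentiable ℂ g) (m : ℕ) (x : ℂ) :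
    EqUpTo m x (fun w => Complex.exp ((w - x) ^ m * g w)) (fun _ => 1) := by
  obtain ⟨q, hq, h⟩ := exists_entire_factor (by fun_prop) (expTail_order 1)
  refine ⟨fun w => g w * q ((w - x) ^ m * g w), by fun_prop, fun w => ?_⟩
  have := h ((w - x) ^ m * g w)
  simp only [Finset.range_one, Finset.sum_singleton, pow_zero, Nat.factorial_zero, Nat.cast_one,
    div_one, sub_zero, pow_one] at this
  rw [sub_eq_iff_eq_add] at this
  simp only [this]; ring

open Polynomial in
theorem polynomial (m : ℕ) (x q : ℂ) (P : ℂ[X]) : EqUpTo m x (fun w => P.eval (w / q))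
    (fun w => ∑ k ∈ Finset.range m,
      (hasseDeriv k P).eval (x / q) / q ^ k * (w - x) ^ k) := by
  set d := P.natDegree + 1
  have h1 : ∀ w, P.eval (w / q) = ∑ k ∈ Finset.range (m + d),
      (hasseDeriv k P).eval (x / q) / q ^ k * (w - x) ^ k := by
    intro w
    rw [← taylor_eval_sub (x / q), eval_eq_sum_range' (n := m + d)]
    · refine Finset.sum_congr rfl fun k _ => ?_
      rw [taylor_coeff, ← sub_div, div_pow]
      ring
    · rw [natDegree_taylor]; omega
  refine ⟨fun w => ∑ k ∈ Finset.range d,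
    (hasseDeriv (m + k) P).eval (x / q) / q ^ (m + k) * (w - x) ^ k, by fun_prop, fun w => ?_⟩
  simp only [h1, Finset.sum_range_add, Finset.mul_sum]
  congr 1
  refine Finset.sum_congr rfl fun k _ => ?_
  rw [pow_add (w - x)]
  ring

end EqUpTo

open Polynomial in
/-- Order of vanishing of the corrected exponential polynomial at the odd integers. -/
theorem le_analyticOrderAt_exp_sum {ι : Type*} (s : Finset ι) (P : ι → ℂ[X]) (u v t : ι → ℂ)
    (c d q : ℂ) (k i σ0 σ1 σ2 : ℕ) (hσ : σ0 + σ1 + σ2 < 2 * k)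
    (h : ∀ τ0 τ1 τ2 : ℕ, τ0 + τ1 + τ2 < 4 * k →
      ∑ l ∈ s, (hasseDeriv τ0 (P l)).eval ((2 * i + 1) / q) * u l ^ τ1 * v l ^ τ2 *
        Complex.exp ((2 * i + 1) * (c * u l + d * v l + t l) / q) = 0) :
    ((2 * k : ℕ) : ℕ∞) ≤ analyticOrderAt (fun w => ∑ l ∈ s,
      (hasseDeriv σ0 (P l)).eval (w / q) * u l ^ σ1 * v l ^ σ2 *
        Complex.exp ((w * (c * u l + d * v l + t l) + oddCorrection k w * t l) / q))
      (2 * i + 1) := by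
  refine EqUpTo.le_analyticOrderAt ?_
  obtain ⟨g, hg, hgw⟩ := exists_factor_add_oddCorrection k i
  set x : ℂ := 2 * i + 1 with hx
  set m := 2 * k with hm
  have step : ∀ l, EqUpTo m x (fun w => (hasseDeriv σ0 (P l)).eval (w / q) * u l ^ σ1 * v l ^ σ2 *
        Complex.exp ((w * (c * u l + d * v l + t l) + oddCorrection k w * t l) / q))
      (fun w => ∑ a ∈ Finset.range m, ∑ r ∈ Finset.range m,
        (u l ^ σ1 * v l ^ σ2 * Complex.exp (x * (c * u l + d * v l + t l) / q) *
        ((hasseDeriv a (hasseDeriv σ0 (P l))).eval (x / q) / q ^ a *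
        (((c * u l + d * v l) / q) ^ r / (r.factorial : ℂ)))) * (w - x) ^ (a + r)) := by
    intro l
    have e1 := EqUpTo.polynomial m x q (hasseDeriv σ0 (P l))
    have e2 := EqUpTo.exp m x ((c * u l + d * v l) / q)
    have e3 := EqUpTo.exp_mul (g := fun w => g w * (t l / q)) (by fun_prop) m x
    have e4 := (e1.mul e2 (by fun_prop) (by fun_prop)).mul e3
      (by fun_prop) (by fun_prop)
    have e5 := (EqUpTo.refl (m := m) (x := x) (fun _ => u l ^ σ1 * v l ^ σ2 *
      Complex.exp (x * (c * u l + d * v l + t l) / q))).mul e4 (by fun_prop) (by fun_prop)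
    convert e5 using 1
    · ext w
      have : (w * (c * u l + d * v l + t l) + oddCorrection k w * t l) / q =
          x * (c * u l + d * v l + t l) / q + (c * u l + d * v l) / q * (w - x) +
            (w - x) ^ m * (g w * (t l / q)) := by
        rw [show (w - x) ^ m * (g w * (t l / q)) = (w - x) ^ m * g w * (t l / q) by ring, ← hgw w]
        ring
      rw [this, Complex.exp_add, Complex.exp_add]
      ring
    · ext w
      rw [mul_one, Finset.sum_mul_sum, Finset.mul_sum]
      refine Finset.sum_congr rfl fun a _ => ?_
      rw [Finset.mul_sum]
      refine Finset.sum_congr rfl fun r _ => ?_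
      rw [pow_add]; ring
  refine (EqUpTo.sum s step).trans ?_
  have swap : ∀ w, ∑ l ∈ s, ∑ a ∈ Finset.range m, ∑ r ∈ Finset.range m,
        (u l ^ σ1 * v l ^ σ2 * Complex.exp (x * (c * u l + d * v l + t l) / q) *
        ((hasseDeriv a (hasseDeriv σ0 (P l))).eval (x / q) / q ^ a *
        (((c * u l + d * v l) / q) ^ r / (r.factorial : ℂ)))) * (w - x) ^ (a + r) =
      ∑ a ∈ Finset.range m, ∑ r ∈ Finset.range m, (∑ l ∈ s,
        (u l ^ σ1 * v l ^ σ2 * Complex.exp (x * (c * u l + d * v l + t l) / q) *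
        ((hasseDeriv a (hasseDeriv σ0 (P l))).eval (x / q) / q ^ a *
        (((c * u l + d * v l) / q) ^ r / (r.factorial : ℂ))))) * (w - x) ^ (a + r) := by
    intro w
    rw [Finset.sum_comm]
    refine Finset.sum_congr rfl fun a _ => ?_
    rw [Finset.sum_comm]
    exact Finset.sum_congr rfl fun r _ => by rw [Finset.sum_mul]
  simp only [swap]
  have zero : ∀ a r, EqUpTo m x (fun w => (∑ l ∈ s,
        (u l ^ σ1 * v l ^ σ2 * Complex.exp (x * (c * u l + d * v l + t l) / q) *
        ((hasseDeriv a (hasseDeriv σ0 (P l))).eval (x / q) / q ^ a *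
        (((c * u l + d * v l) / q) ^ r / (r.factorial : ℂ))))) * (w - x) ^ (a + r))
      (fun _ => 0) := by
    intro a r
    by_cases har : m ≤ a + r
    · exact EqUpTo.pow_of_le har _
    · have hz : ∑ l ∈ s,
          (u l ^ σ1 * v l ^ σ2 * Complex.exp (x * (c * u l + d * v l + t l) / q) *
          ((hasseDeriv a (hasseDeriv σ0 (P l))).eval (x / q) / q ^ a *
          (((c * u l + d * v l) / q) ^ r / (r.factorial : ℂ)))) = 0 := by
        have key : ∀ l, (u l ^ σ1 * v l ^ σ2 * Complex.exp (x * (c * u l + d * v l + t l) / q) *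
          ((hasseDeriv a (hasseDeriv σ0 (P l))).eval (x / q) / q ^ a *
          (((c * u l + d * v l) / q) ^ r / (r.factorial : ℂ)))) =
          ∑ b ∈ Finset.range (r + 1), ((a + σ0).choose a / q ^ a / q ^ r / (r.factorial : ℂ) *
            c ^ b * d ^ (r - b) * (r.choose b)) *
            ((hasseDeriv (a + σ0) (P l)).eval (x / q) * u l ^ (σ1 + b) * v l ^ (σ2 + (r - b)) *
            Complex.exp (x * (c * u l + d * v l + t l) / q)) := by
          intro l
          have := LinearMap.congr_fun (hasseDeriv_comp (R := ℂ) a σ0) (P l)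
          simp only [LinearMap.comp_apply, LinearMap.smul_apply] at this
          rw [this, div_pow, add_pow, nsmul_eq_mul, eval_mul, eval_natCast]
          simp only [Finset.sum_div, Finset.mul_sum]
          refine Finset.sum_congr rfl fun b _ => ?_
          rw [mul_pow, mul_pow, pow_add, pow_add]
          ring
        simp only [key]
        rw [Finset.sum_comm]
        refine Finset.sum_eq_zero fun b hb => ?_
        rw [← Finset.mul_sum, h _ _ _ (by have := Finset.mem_range.1 hb; omega), mul_zero]
      simp only [hz, zero_mul]
      exact EqUpTo.refl _
  have := EqUpTo.sum (Finset.range m) fun a => EqUpTo.sum (Finset.range m) (zero a)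
  simpa using this

/-! ### The auxiliary function -/

/-- The linear form `l₁ log φ + l₂ log √5 + l₃ log 2`. -/
noncomputable def logWeight (l : ℕ × ℕ × ℕ) : ℝ :=
  l.1 * log goldenRatio + l.2.1 * log √5 + l.2.2 * log 2

theorem log_goldenRatio_pos : 0 < log goldenRatio := log_pos one_lt_goldenRatio

theorem log_sqrt_five_pos : 0 < log √5 :=
  log_pos (by rw [show (1 : ℝ) = √1 by simp]; exact sqrt_lt_sqrt (by norm_num) (by norm_num))

theorem log_sum_le_two : log goldenRatio + log √5 + log 2 ≤ 2 := by
  have h5 : √5 ^ 2 = 5 := sq_sqrt (by norm_num)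
  have h5' : √5 < 2.24 := by rw [sqrt_lt' (by norm_num)]; norm_num
  rw [← log_mul goldenRatio_ne_zero (by positivity), ← log_mul (by have := goldenRatio_ne_zero; positivity)
    (by norm_num), log_le_iff_le_exp (by have := goldenRatio_pos; positivity)]
  have he := exp_one_gt_d9
  have : exp 2 = exp 1 ^ 2 := by rw [← exp_nat_mul]; norm_num
  rw [this, goldenRatio]
  nlinarith

theorem logWeight_nonneg (l : ℕ × ℕ × ℕ) : 0 ≤ logWeight l := by
  have := log_goldenRatio_pos
  have := log_sqrt_five_pos
  have := log_pos (show (1 : ℝ) < 2 by norm_num)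
  unfold logWeight
  positivity

/-- The index set `[0, T) ^ 3`. -/
def cube (T : ℕ) : Finset (ℕ × ℕ × ℕ) :=
  Finset.range T ×ˢ Finset.range T ×ˢ Finset.range T

theorem mem_cube {T : ℕ} {l : ℕ × ℕ × ℕ} : l ∈ cube T ↔ l.1 < T ∧ l.2.1 < T ∧ l.2.2 < T := by
  simp [cube]

theorem logWeight_le {T : ℕ} {l : ℕ × ℕ × ℕ} (hl : l ∈ cube T) : logWeight l ≤ 2 * T := by
  obtain ⟨h1, h2, h3⟩ := mem_cube.1 hl
  have a := log_goldenRatio_pos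
  have b := log_sqrt_five_pos
  have c := log_pos (show (1 : ℝ) < 2 by norm_num)
  have h1' : (l.1 : ℝ) ≤ T := by exact_mod_cast h1.le
  have h2' : (l.2.1 : ℝ) ≤ T := by exact_mod_cast h2.le
  have h3' : (l.2.2 : ℝ) ≤ T := by exact_mod_cast h3.le
  unfold logWeight
  calc _ ≤ T * log goldenRatio + T * log √5 + T * log 2 := by gcongr
    _ = (log goldenRatio + log √5 + log 2) * T := by ring
    _ ≤ _ := by have := log_sum_le_two; gcongr

namespace GoldenInt

/-- The algebraic number `exp (s * logWeight l)`. -/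
def monomial (s : ℕ) (l : ℕ × ℕ × ℕ) : GoldenInt :=
  phi ^ (s * l.1) * sqrtFive ^ (s * l.2.1) * 2 ^ (s * l.2.2)

theorem exp_logWeight (s : ℕ) (l : ℕ × ℕ × ℕ) : exp (s * logWeight l) =
    goldenRatio ^ (s * l.1) * √5 ^ (s * l.2.1) * 2 ^ (s * l.2.2) := by
  have e : ∀ (x : ℝ) (n : ℕ), 0 < x → x ^ n = exp (n * log x) := fun x n hx => by
    rw [exp_nat_mul, exp_log hx]
  rw [e _ _ goldenRatio_pos, e √5 _ (by positivity), e 2 _ (by norm_num), ← exp_add, ← exp_add,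
    logWeight]
  push_cast
  ring_nf

theorem toC_monomial (s : ℕ) (l : ℕ × ℕ × ℕ) :
    sized.toC (monomial s l) = Complex.exp (s * logWeight l) := by
  have : Complex.exp (s * logWeight l) = ((exp (s * logWeight l) : ℝ) : ℂ) := by push_cast; rfl
  rw [this, exp_logWeight, monomial, map_mul, map_mul, map_pow, map_pow, map_pow, toC_phi,
    toC_sqrtFive, map_ofNat]
  push_cast
  rfl

theorem size_monomial_le (s : ℕ) (l : ℕ × ℕ × ℕ) :
    sized.size (monomial s l) ≤ exp (s * logWeight l) := by
  have h2 : sized.size 2 = 2 := by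
    have := sized.size_int 2
    simpa using this
  rw [exp_logWeight]
  refine (sized.size_mul _ _).trans (mul_le_mul ((sized.size_mul _ _).trans
    (mul_le_mul ?_ ?_ (sized.size_nonneg _) ?_)) ?_ (sized.size_nonneg _) ?_)
  · exact (sized.size_pow _ _).trans_eq (by rw [size_phi])
  · exact (sized.size_pow _ _).trans_eq (by rw [size_sqrtFive])
  · have := goldenRatio_pos; positivity
  · exact (sized.size_pow _ _).trans_eq (by rw [h2])
  · have := goldenRatio_pos; positivity

theorem abs_im_le_size (z : GoldenInt) : |(z.im : ℝ)| ≤ sized.size z := by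
  have h5 : √5 ^ 2 = 5 := sq_sqrt (by norm_num)
  have h5' : 2 ≤ √5 := le_sqrt_of_sq_le (by norm_num)
  have h1 := le_max_left |(z.re : ℝ) + goldenRatio * z.im| |(z.re : ℝ) + goldenConj * z.im|
  have h2 := le_max_right |(z.re : ℝ) + goldenRatio * z.im| |(z.re : ℝ) + goldenConj * z.im|
  rw [← sized_size] at h1 h2
  have h3 : √5 * (z.im : ℝ) = (z.re + goldenRatio * z.im) - (z.re + goldenConj * z.im) := by
    rw [← goldenRatio_sub_goldenConj]; ring
  have h4 : √5 * |(z.im : ℝ)| ≤ 2 * sized.size z := by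
    rw [← abs_of_nonneg (sqrt_nonneg 5), ← abs_mul, h3]
    exact (abs_sub _ _).trans (by linarith)
  nlinarith [abs_nonneg (z.im : ℝ)]

theorem abs_re_le_size (z : GoldenInt) : |(z.re : ℝ)| ≤ sized.size z := by
  have h5 : √5 ^ 2 = 5 := sq_sqrt (by norm_num)
  have h5' : 2 ≤ √5 := le_sqrt_of_sq_le (by norm_num)
  have h1 := le_max_left |(z.re : ℝ) + goldenRatio * z.im| |(z.re : ℝ) + goldenConj * z.im|
  have h2 := le_max_right |(z.re : ℝ) + goldenRatio * z.im| |(z.re : ℝ) + goldenConj * z.im|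
  rw [← sized_size] at h1 h2
  have h3 : √5 * (z.re : ℝ) = goldenRatio * (z.re + goldenConj * z.im) +
      (-goldenConj) * (z.re + goldenRatio * z.im) := by
    rw [← goldenRatio_sub_goldenConj]; ring
  have h4 : √5 * |(z.re : ℝ)| ≤ √5 * sized.size z := by
    rw [← abs_of_nonneg (sqrt_nonneg 5), ← abs_mul, h3, abs_of_nonneg (sqrt_nonneg 5)]
    refine (abs_add_le _ _).trans ?_
    rw [abs_mul, abs_mul, abs_of_pos goldenRatio_pos, abs_of_pos (neg_pos.2 goldenConj_neg),
      ← goldenRatio_sub_goldenConj]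
    have := goldenRatio_pos
    have := goldenConj_neg
    nlinarith
  exact le_of_mul_le_mul_left h4 (by positivity)

end GoldenInt

/-- The exponents congruent to `r` modulo `q`. -/
def residueClass (T q : ℕ) (r : ℕ × ℕ × ℕ) : Finset (ℕ × ℕ × ℕ) :=
  (cube T).filter fun l => l.1 % q = r.1 ∧ l.2.1 % q = r.2.1 ∧ l.2.2 % q = r.2.2

/-- An integer combination of Feldman polynomials. -/
noncomputable def feldmanComb (h T' : ℕ) (p : ℕ × ℕ → ℤ) : Polynomial ℂ :=
  ∑ k ∈ Finset.range T' ×ˢ Finset.range h, (p k : ℂ) • feldman h k.1 k.2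

/-- The value at `s / q` of a derivative of the auxiliary function, restricted to a set of
exponents; `u` and `v` are the exponents after elimination of `log 2`. -/
noncomputable def auxSum (h T' : ℕ) (p : ℕ × ℕ × ℕ → ℕ × ℕ → ℤ) (u v : ℕ × ℕ × ℕ → ℤ)
    (q : ℕ) (C : Finset (ℕ × ℕ × ℕ)) (σ : ℕ × ℕ × ℕ) (s : ℕ) : ℂ :=
  ∑ l ∈ C, (Polynomial.hasseDeriv σ.1 (feldmanComb h T' (p l))).eval ((s : ℂ) / q) *
    (u l : ℂ) ^ σ.2.1 * (v l : ℂ) ^ σ.2.2 * Complex.exp (s * logWeight l / q)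

/-- The vanishing statement at level `q`. -/
def Vanishing (h T' T : ℕ) (p : ℕ × ℕ × ℕ → ℕ × ℕ → ℤ) (u v : ℕ × ℕ × ℕ → ℤ)
    (q N M : ℕ) : Prop :=
  ∀ r, ∀ i < N, ∀ σ : ℕ × ℕ × ℕ, σ.1 + σ.2.1 + σ.2.2 < M →
    auxSum h T' p u v q (residueClass T q r) σ (2 * i + 1) = 0

/-- Indices for triples with sum less than `M`. -/
abbrev TripleIndex (M : ℕ) := (c : Fin M) × (b : Fin (c.1 + 1)) × Fin (b.1 + 1)

theorem card_tripleIndex (M : ℕ) :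
    6 * Fintype.card (TripleIndex M) = M * (M + 1) * (M + 2) := by
  have h1 : ∀ c, 2 * ∑ b ∈ Finset.range (c + 1), (b + 1) = (c + 1) * (c + 2) := by
    intro c
    induction c with
    | zero => simp
    | succ c ih => rw [Finset.sum_range_succ, mul_add, ih]; ring
  have h2 : Fintype.card (TripleIndex M) =
      ∑ c ∈ Finset.range M, ∑ b ∈ Finset.range (c + 1), (b + 1) := by
    simp only [Fintype.card_sigma, Fintype.card_fin]
    rw [← Fin.sum_univ_eq_sum_range (fun c => ∑ b ∈ Finset.range (c + 1), (b + 1))]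
    refine Finset.sum_congr rfl fun c _ => ?_
    rw [← Fin.sum_univ_eq_sum_range (fun b => b + 1)]
  rw [h2, show 6 = 3 * 2 by norm_num, mul_assoc, Finset.mul_sum, Finset.sum_congr rfl fun c _ => h1 c]
  induction M with
  | zero => simp
  | succ M ih => rw [Finset.sum_range_succ, mul_add, ih (by simp [Fintype.card_sigma, ← Fin.sum_univ_eq_sum_range])]; ring

attribute [local instance] Matrix.seminormedAddCommGroup in
theorem exists_int_solution {α β : Type*} [Fintype α] [Fintype β] (A : Matrix α β ℤ) {c : ℝ}
    (hc : 1 ≤ c) (hA : ∀ i j, |(A i j : ℝ)| ≤ c) (hn : 5 * Fintype.card α ≤ Fintype.card β)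
    (hm : 0 < Fintype.card α) : ∃ t : β → ℤ, t ≠ 0 ∧ A.mulVec t = 0 ∧
      ∀ j, |(t j : ℝ)| ≤ (Fintype.card β * c) ^ (1 / 4 : ℝ) := by
  obtain ⟨t, ht0, ht, hle⟩ := Int.Matrix.exists_ne_zero_int_vec_norm_le A (by omega) hm
  refine ⟨t, ht0, ht, fun j => ?_⟩
  have hnorm : ‖A‖ ≤ c := (Matrix.norm_le_iff (by linarith)).2 fun i j => by
    rw [Int.norm_eq_abs]; exact hA i j
  have h1 : |(t j : ℝ)| ≤ ‖t‖ := by rw [← Int.norm_eq_abs]; exact norm_le_pi_norm t j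
  refine h1.trans (hle.trans ?_)
  have hm' : (0 : ℝ) < Fintype.card α := by exact_mod_cast hm
  have hn' : 5 * (Fintype.card α : ℝ) ≤ Fintype.card β := by exact_mod_cast hn
  have hmax : max 1 ‖A‖ ≤ c := max_le hc hnorm
  have hb : 1 ≤ (Fintype.card β : ℝ) := by
    exact_mod_cast (show 1 ≤ Fintype.card β by omega)
  calc _ ≤ (Fintype.card β * c) ^ ((Fintype.card α : ℝ) / (Fintype.card β - Fintype.card α)) :=
        rpow_le_rpow (by positivity) (by gcongr) (div_nonneg hm'.le (by linarith))
    _ ≤ _ := rpow_le_rpow_of_exponent_le (by nlinarith) (by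
        rw [div_le_div_iff₀ (by linarith) (by norm_num)]; linarith)

theorem exists_vanishing_one {h T' T : ℕ} (u v : ℕ × ℕ × ℕ → ℤ) {B : ℝ} (hB : 1 ≤ B)
    (hu : ∀ l ∈ cube T, |(u l : ℝ)| ≤ B) (hv : ∀ l ∈ cube T, |(v l : ℝ)| ≤ B) {S M : ℕ}
    (hS : 0 < S) (hM : 0 < M) (hh : 0 < h)
    (hcard : 10 * S * (M * (M + 1) * (M + 2)) ≤ 6 * (T' * h * T ^ 3)) :
    ∃ p : ℕ × ℕ × ℕ → ℕ × ℕ → ℤ,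
      (∃ l ∈ cube T, ∃ k ∈ Finset.range T' ×ˢ Finset.range h, p l k ≠ 0) ∧
      (∀ l k, |(p l k : ℝ)| ≤ (T' * h * T ^ 3 * ((Nat.lcmUpto h : ℝ) ^ M *
        (exp 1 * (2 * S + h) / h) ^ (h * T') * B ^ M * exp (4 * S * T))) ^ (1 / 4 : ℝ)) ∧
      Vanishing h T' T p u v 1 S M := by
  classical
  set K := Finset.range T' ×ˢ Finset.range h with hK
  set ν := Nat.lcmUpto h with hν
  have hν1 : 1 ≤ (ν : ℝ) := by exact_mod_cast Nat.lcmUpto_pos h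
  have hhr : (0 : ℝ) < h := by exact_mod_cast hh
  have hint : ∀ k ∈ K, ∀ (i σ : ℕ), σ < M → ∃ n : ℤ, (ν : ℂ) ^ M *
      (Polynomial.hasseDeriv σ (feldman h k.1 k.2)).eval ((2 * i + 1 : ℕ) : ℂ) = n := by
    intro k hk i σ hσ
    rw [hK, Finset.mem_product, Finset.mem_range, Finset.mem_range] at hk
    have h1 := IntegralAt.feldman (ν := ν) (h := h) (D := 1) (T' := T')
      (x := ((2 * i + 1 : ℕ) : ℂ)) dvd_rfl
      (fun j => by
        obtain ⟨n, hn⟩ := exists_int_genBinom_int (2 * i + 1 : ℕ) j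
        exact ⟨n, by rw [← hn]; simp⟩) hk.1 hk.2
    obtain ⟨n, hn⟩ := h1.exists_int hσ.le
    exact ⟨n, by rw [← hn]; simp⟩
  choose! f hf using hint
  set E := (exp 1 * (2 * S + h) / h) ^ (h * T') with hE
  have hE1 : 1 ≤ E := by
    refine one_le_pow₀ ?_
    rw [le_div_iff₀ hhr]
    have := add_one_le_exp (1 : ℝ)
    nlinarith [show (0 : ℝ) ≤ S by positivity]
  have hfle : ∀ k ∈ K, ∀ i < S, ∀ σ < M, |(f k i σ : ℝ)| ≤ ν ^ M * E := by
    intro k hk i hi σ hσ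
    have h1 := hf k hk i σ hσ
    rw [hK, Finset.mem_product, Finset.mem_range, Finset.mem_range] at hk
    have h2 : |(f k i σ : ℝ)| = ‖(f k i σ : ℂ)‖ := by simp
    rw [h2, ← h1, norm_mul, norm_pow, Complex.norm_natCast]
    refine mul_le_mul_of_nonneg_left ?_ (by positivity)
    refine (norm_hasseDeriv_feldman_le hk.1 hk.2 _ _).trans ?_
    rw [Complex.norm_natCast]
    have : ((2 * i + 1 : ℕ) : ℝ) ≤ 2 * S := by exact_mod_cast (by omega)
    rw [hE]
    gcongr
  let co : Bool → GoldenInt → ℤ := fun e z => if e then z.re else z.im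
  have hco : ∀ e z, |(co e z : ℝ)| ≤ GoldenInt.sized.size z := by
    intro e z
    cases e
    · exact GoldenInt.abs_im_le_size z
    · exact GoldenInt.abs_re_le_size z
  let A : Matrix (TripleIndex M × Fin S × Bool) {x // x ∈ K ×ˢ cube T} ℤ := fun a x =>
    f x.1.1 a.2.1 a.1.2.2 * u x.1.2 ^ (a.1.2.1.1 - a.1.2.2.1) *
      v x.1.2 ^ (a.1.1.1 - a.1.2.1.1) *
      co a.2.2 (GoldenInt.monomial (2 * a.2.1 + 1) x.1.2)
  have hA : ∀ a x, |(A a x : ℝ)| ≤ ν ^ M * E * B ^ M * exp (4 * S * T) := by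
    rintro ⟨⟨c, b, a⟩, i, e⟩ ⟨⟨k, l⟩, hx⟩
    obtain ⟨hk, hl⟩ := Finset.mem_product.1 hx
    simp only [A]
    push_cast
    rw [abs_mul, abs_mul, abs_mul, abs_pow, abs_pow, mul_assoc (|(f k i a : ℝ)|)]
    have hc := c.2
    have hb := b.2
    have ha := a.2
    have e1 : |(u l : ℝ)| ^ (b.1 - a.1) * |(v l : ℝ)| ^ (c.1 - b.1) ≤ B ^ M := by
      calc _ ≤ B ^ (b.1 - a.1) * B ^ (c.1 - b.1) := by
            have := hu l hl; have := hv l hl; gcongr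
        _ = B ^ ((b.1 - a.1) + (c.1 - b.1)) := by rw [pow_add]
        _ ≤ _ := pow_le_pow_right₀ hB (by omega)
    have e2 : |(co e (GoldenInt.monomial (2 * i + 1) l) : ℝ)| ≤ exp (4 * S * T) := by
      refine (hco _ _).trans ((GoldenInt.size_monomial_le _ _).trans (exp_le_exp.2 ?_))
      have h1 := logWeight_le hl
      have h2 := logWeight_nonneg l
      have h3 : ((2 * i.1 + 1 : ℕ) : ℝ) ≤ 2 * S := by exact_mod_cast (by have := i.2; omega)
      calc _ ≤ (2 * S : ℝ) * (2 * T) := mul_le_mul h3 h1 h2 (by positivity)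
        _ = _ := by ring
    have e3 := hfle k hk i i.2 a (by omega)
    have := (abs_nonneg (f k i a : ℝ)).trans e3
    gcongr
  have hcα : 6 * Fintype.card (TripleIndex M × Fin S × Bool) = 2 * S * (M * (M + 1) * (M + 2)) := by
    rw [Fintype.card_prod, Fintype.card_prod, ← card_tripleIndex M]
    simp only [Fintype.card_fin, Fintype.card_bool]
    ring
  have hcβ : Fintype.card {x // x ∈ K ×ˢ cube T} = T' * h * T ^ 3 := by
    rw [Fintype.card_coe, hK, cube]
    simp only [Finset.card_product, Finset.card_range]
    ring
  have hbig : 1 ≤ ν ^ M * E * B ^ M * exp (4 * S * T) := by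
    have a1 : (1 : ℝ) ≤ ν ^ M := one_le_pow₀ hν1
    have a2 : 1 ≤ B ^ M := one_le_pow₀ hB
    have a3 : 1 ≤ exp (4 * S * T) := one_le_exp (by positivity)
    exact one_le_mul_of_one_le_of_one_le (one_le_mul_of_one_le_of_one_le
      (one_le_mul_of_one_le_of_one_le a1 hE1) a2) a3
  obtain ⟨t, ht0, ht, hle⟩ := exists_int_solution A hbig hA
    (by rw [hcβ]; have := hcard; nlinarith [hcα])
    (by
      have : 0 < 6 * Fintype.card (TripleIndex M × Fin S × Bool) := by rw [hcα]; positivity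
      omega)
  refine ⟨fun l k => if hx : (k, l) ∈ K ×ˢ cube T then t ⟨(k, l), hx⟩ else 0, ?_, ?_, ?_⟩
  · obtain ⟨⟨⟨k, l⟩, hx⟩, hxt⟩ := Function.ne_iff.1 ht0
    obtain ⟨hk, hl⟩ := Finset.mem_product.1 hx
    exact ⟨l, hl, k, hk, by simpa [hx] using hxt⟩
  · intro l k
    rw [hcβ] at hle
    push_cast at hle
    dsimp only
    split_ifs with hx
    · exact hle _
    · simp only [Int.cast_zero, abs_zero]
      exact rpow_nonneg (mul_nonneg (by positivity) (by linarith)) _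
  · intro r i hi σ hσ
    by_cases hr : r = (0, 0, 0)
    swap
    · have : residueClass T 1 r = ∅ := by
        refine Finset.filter_eq_empty_iff.2 fun l _ hl => hr ?_
        simp only [Nat.mod_one] at hl
        exact Prod.ext hl.1.symm (Prod.ext hl.2.1.symm hl.2.2.symm)
      rw [auxSum, this, Finset.sum_empty]
    have hC : residueClass T 1 r = cube T := by
      refine Finset.filter_true_of_mem fun l _ => ?_
      simp [hr, Nat.mod_one]
    obtain ⟨σ0, σ1, σ2⟩ := σ
    dsimp only at hσ
    have hrow : ∀ e : Bool, ∑ x : {x // x ∈ K ×ˢ cube T}, (f x.1.1 i σ0 * u x.1.2 ^ σ1 *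
        v x.1.2 ^ σ2 * co e (GoldenInt.monomial (2 * i + 1) x.1.2)) * t x = 0 := by
      intro e
      have := congrFun ht (⟨⟨σ0 + σ1 + σ2, hσ⟩, ⟨σ0 + σ1, by dsimp only; omega⟩,
        ⟨σ0, by dsimp only; omega⟩⟩, ⟨i, hi⟩, e)
      simp only [Matrix.mulVec, dotProduct, A, Pi.zero_apply, Nat.add_sub_cancel_left] at this
      exact this
    have hz : ∑ x : {x // x ∈ K ×ˢ cube T}, ((f x.1.1 i σ0 * u x.1.2 ^ σ1 *
        v x.1.2 ^ σ2 * t x : ℤ) : ℂ) *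
        GoldenInt.sized.toC (GoldenInt.monomial (2 * i + 1) x.1.2) = 0 := by
      have h1 := hrow true
      have h2 := hrow false
      simp only [co, if_true, Bool.false_eq_true, if_false] at h1 h2
      have h1' := congrArg (fun n : ℤ => (n : ℂ)) h1
      have h2' := congrArg (fun n : ℤ => (n : ℂ)) h2
      simp only [Int.cast_sum, Int.cast_zero] at h1' h2'
      have : ∀ a b c : ℂ, a = 0 → b = 0 → a + c * b = 0 := by intro a b c h h'; simp [h, h']
      rw [← this _ _ (goldenRatio : ℂ) h1' h2', Finset.mul_sum, ← Finset.sum_add_distrib]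
      refine Finset.sum_congr rfl fun x _ => ?_
      rw [GoldenInt.sized_toC]
      generalize (goldenRatio : ℂ) = g
      push_cast
      ring
    have hν0 : (ν : ℂ) ^ M ≠ 0 := pow_ne_zero _ (by exact_mod_cast (Nat.lcmUpto_pos h).ne')
    have hz' : ∑ x ∈ K ×ˢ cube T, ((f x.1 i σ0 * u x.2 ^ σ1 * v x.2 ^ σ2 *
        (if hx : x ∈ K ×ˢ cube T then t ⟨x, hx⟩ else 0) : ℤ) : ℂ) *
        GoldenInt.sized.toC (GoldenInt.monomial (2 * i + 1) x.2) = 0 := by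
      rw [← Finset.sum_coe_sort, ← hz]
      exact Finset.sum_congr rfl fun x _ => by rw [dif_pos x.2]
    rw [Finset.sum_product_right] at hz'
    refine (mul_eq_zero.1 (?_ : (ν : ℂ) ^ M * _ = 0)).resolve_left hν0
    rw [auxSum, hC, ← hz', Finset.mul_sum]
    refine Finset.sum_congr rfl fun l hl => ?_
    rw [feldmanComb, map_sum, Polynomial.eval_finsetSum]
    simp only [Finset.sum_mul, Finset.mul_sum]
    refine Finset.sum_congr rfl fun k hk => ?_
    have h1 := hf k hk i σ0 (by omega)
    rw [GoldenInt.toC_monomial, Int.cast_mul, Int.cast_mul, Int.cast_mul, ← h1]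
    simp only [map_smul, Polynomial.eval_smul, smul_eq_mul, Nat.cast_one, div_one]
    push_cast
    ring

theorem residueClass_subset (T q : ℕ) (r : ℕ × ℕ × ℕ) : residueClass T q r ⊆ cube T :=
  Finset.filter_subset _ _

theorem card_le_of_subset_cube {T : ℕ} {C : Finset (ℕ × ℕ × ℕ)} (hC : C ⊆ cube T) :
    (C.card : ℝ) ≤ T ^ 3 := by
  have := Finset.card_le_card hC
  rw [cube, Finset.card_product, Finset.card_product, Finset.card_range] at this
  have h2 : (C.card : ℝ) ≤ ((T * (T * T) : ℕ) : ℝ) := by exact_mod_cast this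
  refine h2.trans_eq ?_
  push_cast
  ring

theorem norm_hasseDeriv_feldmanComb_le {h T' : ℕ} {p : ℕ × ℕ → ℤ} {P : ℝ}
    (hp : ∀ k, |(p k : ℝ)| ≤ P) (σ : ℕ) {x : ℂ} {X : ℝ} (hx : ‖x‖ ≤ X) :
    ‖(Polynomial.hasseDeriv σ (feldmanComb h T' p)).eval x‖ ≤
      T' * h * P * (exp 1 * (X + h) / h) ^ (h * T') := by
  rw [feldmanComb, map_sum, Polynomial.eval_finsetSum]
  refine (norm_sum_le _ _).trans ?_
  have : ∀ k ∈ Finset.range T' ×ˢ Finset.range h,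
      ‖(Polynomial.hasseDeriv σ ((p k : ℂ) • feldman h k.1 k.2)).eval x‖ ≤
        P * (exp 1 * (X + h) / h) ^ (h * T') := by
    intro k hk
    rw [Finset.mem_product, Finset.mem_range, Finset.mem_range] at hk
    rw [map_smul, Polynomial.eval_smul, smul_eq_mul, norm_mul]
    have h1 : ‖(p k : ℂ)‖ ≤ P := by simpa using hp k
    refine mul_le_mul h1 ((norm_hasseDeriv_feldman_le hk.1 hk.2 σ x).trans ?_) (norm_nonneg _)
      ((norm_nonneg _).trans h1)
    gcongr
  refine (Finset.sum_le_card_nsmul _ _ _ this).trans_eq ?_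
  rw [Finset.card_product, Finset.card_range, Finset.card_range, nsmul_eq_mul]
  push_cast
  ring

theorem norm_coeff_le {h T' T : ℕ} {p : ℕ × ℕ × ℕ → ℕ × ℕ → ℤ} {u v : ℕ × ℕ × ℕ → ℤ}
    {P B : ℝ} (hp : ∀ l k, |(p l k : ℝ)| ≤ P) (hB : 1 ≤ B)
    (hu : ∀ l ∈ cube T, |(u l : ℝ)| ≤ B) (hv : ∀ l ∈ cube T, |(v l : ℝ)| ≤ B)
    {m : ℕ} {σ : ℕ × ℕ × ℕ} (hσ : σ.1 + σ.2.1 + σ.2.2 < m) {x : ℂ} {X : ℝ} (hx : ‖x‖ ≤ X)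
    {l : ℕ × ℕ × ℕ} (hl : l ∈ cube T) :
    ‖(Polynomial.hasseDeriv σ.1 (feldmanComb h T' (p l))).eval x * (u l : ℂ) ^ σ.2.1 *
      (v l : ℂ) ^ σ.2.2‖ ≤ T' * h * P * (exp 1 * (X + h) / h) ^ (h * T') * B ^ m := by
  have h1 := norm_hasseDeriv_feldmanComb_le (h := h) (T' := T') (hp l) σ.1 hx
  have h2 : ‖(u l : ℂ)‖ ≤ B := by simpa using hu l hl
  have h3 : ‖(v l : ℂ)‖ ≤ B := by simpa using hv l hl
  rw [norm_mul, norm_mul, norm_pow, norm_pow, mul_assoc]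
  refine mul_le_mul h1 ?_ (by positivity) ((norm_nonneg _).trans h1)
  calc _ ≤ B ^ σ.2.1 * B ^ σ.2.2 := by gcongr
    _ = B ^ (σ.2.1 + σ.2.2) := by rw [pow_add]
    _ ≤ _ := pow_le_pow_right₀ hB (by omega)

theorem norm_sum_le_of_subset_cube {T : ℕ} {C : Finset (ℕ × ℕ × ℕ)} (hC : C ⊆ cube T)
    {F : ℕ × ℕ × ℕ → ℂ} {b : ℝ} (hb : 0 ≤ b) (hF : ∀ l ∈ cube T, ‖F l‖ ≤ b) :
    ‖∑ l ∈ C, F l‖ ≤ T ^ 3 * b := by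
  refine (norm_sum_le _ _).trans ((Finset.sum_le_card_nsmul _ _ _ fun l hl => hF l (hC hl)).trans ?_)
  rw [nsmul_eq_mul]
  exact mul_le_mul_of_nonneg_right (card_le_of_subset_cube hC) hb

/-- Extrapolation: the auxiliary function is small at half-integer points. -/
theorem norm_auxSum_le {h T' T : ℕ} {p : ℕ × ℕ × ℕ → ℕ × ℕ → ℤ} {u v : ℕ × ℕ × ℕ → ℤ}
    {P B : ℝ} (hP : 0 ≤ P) (hp : ∀ l k, |(p l k : ℝ)| ≤ P) (hB : 1 ≤ B)
    (hu : ∀ l ∈ cube T, |(u l : ℝ)| ≤ B) (hv : ∀ l ∈ cube T, |(v l : ℝ)| ≤ B)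
    {c d δ : ℝ} {t : ℕ × ℕ × ℕ → ℝ} (hw : ∀ l, logWeight l = c * u l + d * v l + t l)
    (ht : ∀ l ∈ cube T, |t l| ≤ δ) {q S k : ℕ} (hq : 0 < q) (hS : 0 < S)
    (hδ : 2 * k * exp (π * k * (17 * (q * S))) * δ ≤ 1)
    (hvan : Vanishing h T' T p u v q (q * S) (4 * k)) (r : ℕ × ℕ × ℕ) {σ : ℕ × ℕ × ℕ}
    (hσ : σ.1 + σ.2.1 + σ.2.2 < 2 * k) {s : ℕ} (hs : s ≤ 4 * (q * S)) :
    ‖auxSum h T' p u v (2 * q) (residueClass T q r) σ s‖ ≤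
      T ^ 3 * (T' * h * P * (exp 1 * (18 * S + h) / h) ^ (h * T') * B ^ (2 * k) *
        exp (36 * S * T + 1)) * (1 / 16) ^ (q * S * (2 * k)) +
      T ^ 3 * (T' * h * P * (exp 1 * (2 * S + h) / h) ^ (h * T') * B ^ (2 * k) *
        exp (4 * S * T) * (4 * k * δ)) := by
  have hqr : (1 : ℝ) ≤ q := by exact_mod_cast hq
  have hqc : (q : ℂ) ≠ 0 := by exact_mod_cast hq.ne'
  have hC := residueClass_subset T q r
  set C := residueClass T q r with hCdef
  have hδ0 : ∀ l ∈ cube T, 0 ≤ δ := fun l hl => (abs_nonneg _).trans (ht l hl)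
  set f : ℂ → ℂ := fun w => ∑ l ∈ C,
      (Polynomial.hasseDeriv σ.1 (feldmanComb h T' (p l))).eval (w / q) * (u l : ℂ) ^ σ.2.1 *
        (v l : ℂ) ^ σ.2.2 *
        Complex.exp ((w * ((c : ℂ) * u l + d * v l + t l) + oddCorrection k w * t l) / q) with hf
  have hfd : Differentiable ℂ f := by
    have := differentiable_oddCorrection k
    fun_prop
  have hwc : ∀ l, (logWeight l : ℂ) = (c : ℂ) * u l + d * v l + t l := fun l => by
    rw [hw l]; push_cast; rfl
  have hord : ∀ i < q * S, ((2 * k : ℕ) : ℕ∞) ≤ analyticOrderAt f (2 * i + 1) := by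
    intro i hi
    refine le_analyticOrderAt_exp_sum C (fun l => feldmanComb h T' (p l)) (fun l => (u l : ℂ))
      (fun l => (v l : ℂ)) (fun l => (t l : ℂ)) c d q k i σ.1 σ.2.1 σ.2.2 hσ
      fun τ0 τ1 τ2 hτ => ?_
    have := hvan r i hi (τ0, τ1, τ2) hτ
    rw [auxSum, ← hCdef] at this
    simp only [hwc] at this
    push_cast at this
    exact this
  have hE : ∀ x : ℝ, 0 ≤ x → 0 ≤ T' * h * P * (exp 1 * (x + h) / h) ^ (h * T') * B ^ (2 * k) := by
    intro x hx
    have : 0 ≤ B := by linarith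
    positivity
  have hkq : ∀ l ∈ cube T, ∀ z : ℂ, ‖oddCorrection k z * t l / q‖ ≤ ‖oddCorrection k z‖ * δ := by
    intro l hl z
    rw [norm_div, norm_mul, Complex.norm_natCast, Complex.norm_real, Real.norm_eq_abs]
    refine (div_le_self (by positivity) hqr).trans ?_
    have := ht l hl
    gcongr
  have hsph : ∀ z ∈ Metric.sphere ((q * S : ℕ) : ℂ) (17 * (q * S : ℕ)), ‖f z‖ ≤
      T ^ 3 * (T' * h * P * (exp 1 * (18 * S + h) / h) ^ (h * T') * B ^ (2 * k) *
        exp (36 * S * T + 1)) := by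
    intro z hz
    rw [mem_sphere_iff_norm] at hz
    have hz1 : ‖z‖ ≤ 18 * (q * S) := by
      have := norm_add_le (z - (q * S : ℕ)) ((q * S : ℕ) : ℂ)
      rw [sub_add_cancel, hz, Complex.norm_natCast] at this
      push_cast at this
      linarith
    have hz2 : |z.im| ≤ 17 * (q * S) := by
      have := Complex.abs_im_le_norm (z - (q * S : ℕ))
      rw [hz, Complex.sub_im, Complex.natCast_im, sub_zero] at this
      push_cast at this
      exact this
    have hz3 : ‖z / q‖ ≤ 18 * S := by
      rw [norm_div, Complex.norm_natCast, div_le_iff₀ (by linarith)]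
      linarith
    refine norm_sum_le_of_subset_cube hC (mul_nonneg (hE _ (by positivity)) (exp_pos _).le)
      fun l hl => ?_
    rw [norm_mul]
    refine mul_le_mul (norm_coeff_le hp hB hu hv hσ hz3 hl) ?_ (norm_nonneg _)
      (hE _ (by positivity))
    rw [Complex.norm_exp]
    refine exp_le_exp.2 ((Complex.re_le_norm _).trans ?_)
    rw [add_div]
    refine (norm_add_le _ _).trans (add_le_add ?_ ?_)
    · rw [← hwc, mul_div_right_comm, norm_mul, Complex.norm_real, Real.norm_eq_abs,
        abs_of_nonneg (logWeight_nonneg l)]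
      calc _ ≤ (18 * S : ℝ) * (2 * T) :=
            mul_le_mul hz3 (logWeight_le hl) (logWeight_nonneg l) (by positivity)
        _ = _ := by ring
    · have h1 := norm_oddCorrection_le k hz2
      have h2 := hδ0 l hl
      refine (hkq l hl z).trans (le_trans ?_ hδ)
      gcongr
  have hw0 : ((s / 2 : ℝ)) ≤ 2 * (q * S : ℕ) := by
    have : (s : ℝ) ≤ 4 * (q * S) := by exact_mod_cast hs
    push_cast
    linarith
  have hsch := norm_le_of_vanish_odd hfd (by positivity) hord hsph (by positivity) hw0
  refine (norm_le_norm_add_norm_sub' _ (f ((s / 2 : ℝ) : ℂ))).trans (add_le_add hsch ?_)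
  rw [auxSum, hf, ← Finset.sum_sub_distrib]
  have hsq : (((s / 2 : ℝ) : ℂ)) / q = (s : ℂ) / ((2 * q : ℕ) : ℂ) := by
    push_cast; field_simp
  rcases (cube T).eq_empty_or_nonempty with h0 | ⟨l0, hl0⟩
  · have hC0 : C = ∅ := Finset.subset_empty.1 (by rw [← h0]; exact hC)
    have hT : T = 0 := by
      by_contra hT
      have : ((0, 0, 0) : ℕ × ℕ × ℕ) ∈ cube T := by rw [mem_cube]; simp; omega
      rw [h0] at this
      simp at this
    rw [hC0, Finset.sum_empty, norm_zero]
    simp [hT]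
  have hδn := hδ0 l0 hl0
  have hkr : 2 * k * δ ≤ 1 := by
    have h2 : 1 ≤ exp (π * k * (17 * (q * S))) := one_le_exp (by have := pi_pos; positivity)
    refine le_trans ?_ hδ
    have : 2 * k * 1 * δ ≤ 2 * k * exp (π * k * (17 * (q * S))) * δ := by gcongr
    linarith
  have hsS : (s : ℝ) / (2 * q) ≤ 2 * S := by
    have : (s : ℝ) ≤ 4 * (q * S) := by exact_mod_cast hs
    rw [div_le_iff₀ (by linarith)]; linarith
  refine norm_sum_le_of_subset_cube hC ?_ fun l hl => ?_
  · have := hE (2 * S) (by positivity)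
    positivity
  have hx : ‖(s : ℂ) / ((2 * q : ℕ) : ℂ)‖ ≤ 2 * S := by
    rw [norm_div, Complex.norm_natCast, Complex.norm_natCast]
    push_cast
    exact hsS
  have e1 : (((s / 2 : ℝ) : ℂ) * ((c : ℂ) * u l + d * v l + t l) +
      oddCorrection k ((s / 2 : ℝ) : ℂ) * t l) / q =
      s * logWeight l / ((2 * q : ℕ) : ℂ) + oddCorrection k ((s / 2 : ℝ) : ℂ) * t l / q := by
    rw [hwc, add_div, mul_div_right_comm, hsq]
    ring
  rw [e1, hsq, Complex.exp_add, ← mul_assoc, ← mul_one_sub, norm_mul, norm_mul]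
  have e2 : ‖oddCorrection k ((s / 2 : ℝ) : ℂ) * t l / q‖ ≤ 2 * k * δ := by
    refine (hkq l hl _).trans ?_
    have h1 := norm_oddCorrection_le k (w := ((s / 2 : ℝ) : ℂ)) (y := 0) (by simp)
    rw [mul_zero, exp_zero, mul_one] at h1
    gcongr
  have e3 : ‖1 - Complex.exp (oddCorrection k ((s / 2 : ℝ) : ℂ) * t l / q)‖ ≤ 4 * k * δ := by
    rw [norm_sub_rev]
    refine (Complex.norm_exp_sub_one_le (e2.trans hkr)).trans ?_
    linarith
  have e4 : ‖Complex.exp (s * logWeight l / ((2 * q : ℕ) : ℂ))‖ ≤ exp (4 * S * T) := by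
    rw [Complex.norm_exp]
    refine exp_le_exp.2 ((Complex.re_le_norm _).trans ?_)
    rw [mul_div_right_comm, norm_mul, Complex.norm_real, Real.norm_eq_abs,
        abs_of_nonneg (logWeight_nonneg l)]
    calc _ ≤ (2 * S : ℝ) * (2 * T) :=
            mul_le_mul hx (logWeight_le hl) (logWeight_nonneg l) (by positivity)
        _ = _ := by ring
  have e5 := norm_coeff_le (h := h) (T' := T') hp hB hu hv hσ hx hl
  have := hE (2 * S) (by positivity)
  exact mul_le_mul (mul_le_mul e5 e4 (norm_nonneg _) this) e3 (norm_nonneg _) (by positivity)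

/-- The parities of the quotients of the exponents by `q`. -/
def quotParity (q : ℕ) (l : ℕ × ℕ × ℕ) : ℕ × ℕ × ℕ :=
  (l.1 / q % 2, l.2.1 / q % 2, l.2.2 / q % 2)

/-- The quotients of the exponents by `2 * q`. -/
def quotHalf (q : ℕ) (l : ℕ × ℕ × ℕ) : ℕ × ℕ × ℕ :=
  (l.1 / q / 2, l.2.1 / q / 2, l.2.2 / q / 2)

theorem quotParity_mem (q : ℕ) (l : ℕ × ℕ × ℕ) :
    quotParity q l ∈ Finset.range 2 ×ˢ Finset.range 2 ×ˢ Finset.range 2 := by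
  simp only [quotParity, Finset.mem_product, Finset.mem_range]
  omega

theorem logWeight_eq_of_mem_residueClass {T q : ℕ} {r l : ℕ × ℕ × ℕ}
    (hl : l ∈ residueClass T q r) : logWeight l =
      logWeight r + q * (logWeight (quotParity q l) + 2 * logWeight (quotHalf q l)) := by
  have key : ∀ a b : ℕ, a % q = b → (a : ℝ) = b + q * ((a / q % 2 : ℕ) + 2 * (a / q / 2 : ℕ)) := by
    intro a b hab
    have h1 := Nat.mod_add_div a q
    have h2 := Nat.mod_add_div (a / q) 2
    rw [hab] at h1
    rw [← h2] at h1
    nth_rewrite 1 [← h1]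
    push_cast
    ring
  obtain ⟨h1, h2, h3⟩ := (Finset.mem_filter.1 hl).2
  have e1 := key _ _ h1
  have e2 := key _ _ h2
  have e3 := key _ _ h3
  unfold logWeight quotParity quotHalf
  dsimp only
  generalize log goldenRatio = a
  rw [e1, e2, e3]
  ring

theorem sqrt_monomial_eq (e : ℕ × ℕ × ℕ) :
    √goldenRatio ^ e.1 * √√5 ^ e.2.1 * √2 ^ e.2.2 = exp (logWeight e / 2) := by
  have key : ∀ (x : ℝ) (n : ℕ), 0 < x → √x ^ n = exp (n * log x / 2) := fun x n hx => by
    rw [mul_div_assoc, ← log_sqrt hx.le, exp_nat_mul, exp_log (sqrt_pos.2 hx)]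
  rw [key _ _ goldenRatio_pos, key √5 _ (by positivity), key 2 _ (by norm_num), ← exp_add, ← exp_add,
    logWeight]
  ring_nf

theorem residueClass_two_mul (T q : ℕ) (r : ℕ × ℕ × ℕ) : residueClass T (2 * q) r =
    (residueClass T q (r.1 % q, r.2.1 % q, r.2.2 % q)).filter
      fun l => quotParity q l = (r.1 / q, r.2.1 / q, r.2.2 / q) := by
  have key : ∀ a b : ℕ, a % (2 * q) = b ↔ a % q = b % q ∧ a / q % 2 = b / q := by
    intro a b
    rw [mul_comm, Nat.mod_mul]
    constructor
    · rintro rfl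
      rcases q.eq_zero_or_pos with rfl | hq
      · simp
      · constructor
        · simp
        · rw [Nat.add_mul_div_left _ _ hq, Nat.div_eq_of_lt (Nat.mod_lt _ hq), zero_add]
    · rintro ⟨h1, h2⟩
      rw [h1, h2, Nat.mod_add_div]
  ext l
  simp only [residueClass, quotParity, Finset.mem_filter, Prod.mk.injEq, key]
  tauto

theorem exists_int_coeff {h T' J m : ℕ} (p : ℕ × ℕ → ℤ) (u v : ℤ) {σ : ℕ × ℕ × ℕ}
    (hσ : σ.1 + σ.2.1 + σ.2.2 < m) (s : ℕ) : ∃ N : ℤ,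
      (((2 ^ (J + 2)) ^ (h * T') * Nat.lcmUpto h ^ m : ℕ) : ℂ) *
        ((Polynomial.hasseDeriv σ.1 (feldmanComb h T' p)).eval
          ((s : ℂ) / ((2 ^ (J + 1) : ℕ) : ℂ)) * (u : ℂ) ^ σ.2.1 * (v : ℂ) ^ σ.2.2) = N := by
  have hint : ∀ k ∈ Finset.range T' ×ˢ Finset.range h, ∃ n : ℤ,
      (((2 ^ (J + 2)) ^ (h * T') * Nat.lcmUpto h ^ m : ℕ) : ℂ) *
      (Polynomial.hasseDeriv σ.1 (feldman h k.1 k.2)).eval ((s : ℂ) / ((2 ^ (J + 1) : ℕ) : ℂ)) = n := by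
    intro k hk
    rw [Finset.mem_product, Finset.mem_range, Finset.mem_range] at hk
    have h1 := IntegralAt.feldman (ν := Nat.lcmUpto h) (h := h) (D := 2 ^ (J + 2)) (T' := T')
      (x := (s : ℂ) / ((2 ^ (J + 1) : ℕ) : ℂ)) dvd_rfl
      (fun j => by
        obtain ⟨n, hn⟩ := exists_int_genBinom_two_pow s (J + 1) j
        exact ⟨n, by rw [← hn]; push_cast; rfl⟩) hk.1 hk.2
    obtain ⟨n, hn⟩ := h1.exists_int (k := σ.1) (M := m) (by omega)
    exact ⟨n, by rw [← hn]; push_cast; rfl⟩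
  choose! f hf using hint
  refine ⟨(∑ k ∈ Finset.range T' ×ˢ Finset.range h, p k * f k) * u ^ σ.2.1 * v ^ σ.2.2, ?_⟩
  rw [feldmanComb, map_sum, Polynomial.eval_finsetSum]
  push_cast
  rw [← mul_assoc, ← mul_assoc]
  congr 2
  rw [Finset.mul_sum]
  refine Finset.sum_congr rfl fun k hk => ?_
  rw [← hf k hk, map_smul, Polynomial.eval_smul, smul_eq_mul]
  push_cast
  ring

/-- The Liouville inequality separates the parts of the auxiliary function lying in
different square classes. -/
theorem auxSum_filter_eq_zero {h T' T : ℕ} {p : ℕ × ℕ × ℕ → ℕ × ℕ → ℤ} {u v : ℕ × ℕ × ℕ → ℤ}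
    {P B : ℝ} (hP : 0 ≤ P) (hp : ∀ l k, |(p l k : ℝ)| ≤ P) (hB : 1 ≤ B)
    (hu : ∀ l ∈ cube T, |(u l : ℝ)| ≤ B) (hv : ∀ l ∈ cube T, |(v l : ℝ)| ≤ B)
    {J S m i : ℕ} (r : ℕ × ℕ × ℕ) {σ : ℕ × ℕ × ℕ} (hσ : σ.1 + σ.2.1 + σ.2.2 < m)
    (hi : 2 * i + 1 ≤ 4 * (2 ^ J * S)) {D : ℕ}
    (hD : D = (2 ^ (J + 2)) ^ (h * T') * Nat.lcmUpto h ^ m)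
    (hsmall : ‖auxSum h T' p u v (2 ^ (J + 1)) (residueClass T (2 ^ J) r) σ (2 * i + 1)‖ * D *
      (T ^ 3 * (D * (T' * h * P * (exp 1 * (2 * S + h) / h) ^ (h * T') * B ^ m) *
        exp (4 * S * T))) ^ 15 < 1) (e : ℕ × ℕ × ℕ) :
    auxSum h T' p u v (2 ^ (J + 1)) ((residueClass T (2 ^ J) r).filter
      fun l => quotParity (2 ^ J) l = e) σ (2 * i + 1) = 0 := by
  have hC := residueClass_subset T (2 ^ J) r
  have hCl : ∀ l ∈ residueClass T (2 ^ J) r, _ := fun l hl => logWeight_eq_of_mem_residueClass hl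
  set C := residueClass T (2 ^ J) r with hCdef
  set q := 2 ^ J with hq
  set s := 2 * i + 1 with hs
  have hq0 : 0 < q := by positivity
  have hqr : (0 : ℝ) < q := by exact_mod_cast hq0
  have hq2 : 2 ^ (J + 1) = 2 * q := by rw [hq]; ring
  have hD0 : (D : ℂ) ≠ 0 := by
    have := Nat.lcmUpto_pos h
    have : 0 < D := by rw [hD]; positivity
    exact_mod_cast this.ne'
  have hco : ∀ l, ∃ N : ℤ, (D : ℂ) * ((Polynomial.hasseDeriv σ.1 (feldmanComb h T' (p l))).eval
      ((s : ℂ) / ((2 ^ (J + 1) : ℕ) : ℂ)) * (u l : ℂ) ^ σ.2.1 * (v l : ℂ) ^ σ.2.2) = N := by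
    intro l
    rw [hD]
    exact exists_int_coeff (p l) (u l) (v l) hσ s
  choose N hN using hco
  set A := T' * h * P * (exp 1 * (2 * S + h) / h) ^ (h * T') * B ^ m with hA
  have hA0 : 0 ≤ A := by
    have : 0 ≤ B := by linarith
    positivity
  have hsq : (s : ℝ) / (2 * q) ≤ 2 * S := by
    have : (s : ℝ) ≤ 4 * (q * S) := by exact_mod_cast hi
    rw [div_le_iff₀ (by positivity)]; linarith
  have hNle : ∀ l ∈ cube T, |(N l : ℝ)| ≤ D * A := by
    intro l hl
    have h1 : |(N l : ℝ)| = ‖(N l : ℂ)‖ := by simp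
    rw [h1, ← hN, norm_mul, Complex.norm_natCast]
    refine mul_le_mul_of_nonneg_left (norm_coeff_le hp hB hu hv hσ ?_ hl) (by positivity)
    rw [norm_div, Complex.norm_natCast, Complex.norm_natCast, hq2]
    push_cast
    exact hsq
  set W : ℕ × ℕ × ℕ → ℝ := fun e => √goldenRatio ^ e.1 * √√5 ^ e.2.1 * √2 ^ e.2.2 with hW
  let y : ℕ × ℕ × ℕ → GoldenInt := fun l =>
    N l * (GoldenInt.monomial s (quotHalf q l) * GoldenInt.monomial i (quotParity q l))
  have hexp : ∀ l ∈ C, (s : ℝ) * logWeight l / (2 * q) = s * logWeight r / (2 * q) +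
      (s * logWeight (quotHalf q l) + i * logWeight (quotParity q l) +
        logWeight (quotParity q l) / 2) := by
    intro l hl
    rw [hCl l hl, hs]
    push_cast
    field_simp
    ring
  have hyC : ∀ l ∈ C, Complex.exp (s * logWeight r / (2 * q)) *
      (GoldenInt.sized.toC (y l) * (W (quotParity q l) : ℂ)) =
      N l * Complex.exp (s * logWeight l / ((2 ^ (J + 1) : ℕ) : ℂ)) := by
    intro l hl
    have h1 := congrArg (fun x : ℝ => Complex.exp (x : ℂ)) (hexp l hl)
    push_cast at h1
    rw [hq2]
    push_cast
    rw [h1, Complex.exp_add, Complex.exp_add, Complex.exp_add, ← GoldenInt.toC_monomial,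
      ← GoldenInt.toC_monomial]
    simp only [y, W, map_mul, map_intCast]
    rw [sqrt_monomial_eq]
    push_cast
    ring
  have hysize : ∀ l ∈ C, GoldenInt.sized.size (y l) * W (quotParity q l) ≤
      D * A * exp (4 * S * T) := by
    intro l hl
    have h1 : GoldenInt.sized.size (y l) ≤ |(N l : ℝ)| *
        (exp (s * logWeight (quotHalf q l)) * exp (i * logWeight (quotParity q l))) := by
      refine (GoldenInt.sized.size_mul _ _).trans ?_
      rw [GoldenInt.sized.size_int]
      refine mul_le_mul_of_nonneg_left ((GoldenInt.sized.size_mul _ _).trans ?_) (abs_nonneg _)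
      exact mul_le_mul (GoldenInt.size_monomial_le _ _) (GoldenInt.size_monomial_le _ _)
        (GoldenInt.sized.size_nonneg _) (exp_pos _).le
    have h2 : W (quotParity q l) = exp (logWeight (quotParity q l) / 2) := sqrt_monomial_eq _
    calc _ ≤ |(N l : ℝ)| * (exp (s * logWeight (quotHalf q l)) *
          exp (i * logWeight (quotParity q l))) * exp (logWeight (quotParity q l) / 2) := by
          rw [h2]; gcongr
      _ = |(N l : ℝ)| * exp (s * logWeight (quotHalf q l) + i * logWeight (quotParity q l) +
        logWeight (quotParity q l) / 2) := by rw [exp_add, exp_add]; ring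
      _ ≤ _ := by
        refine mul_le_mul (hNle l (hC hl)) (exp_le_exp.2 ?_) (exp_pos _).le (by positivity)
        have h3 := hexp l hl
        have h4 : 0 ≤ s * logWeight r / (2 * q) := by
          have := logWeight_nonneg r
          positivity
        have h5 : s * logWeight l / (2 * q) ≤ 4 * S * T := by
          rw [mul_div_right_comm]
          calc _ ≤ (2 * S : ℝ) * (2 * T) :=
            mul_le_mul hsq (logWeight_le (hC hl)) (logWeight_nonneg l) (by positivity)
            _ = _ := by ring
        linarith
  let x : ℕ × ℕ × ℕ → GoldenInt := fun e => ∑ l ∈ C.filter fun l => quotParity q l = e, y l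
  have hx : ∀ e, Complex.exp (s * logWeight r / (2 * q)) * (GoldenInt.sized.toC (x e) * (W e : ℂ)) =
      D * auxSum h T' p u v (2 ^ (J + 1)) (C.filter fun l => quotParity q l = e) σ s := by
    intro e
    rw [auxSum, Finset.mul_sum]
    simp only [x]
    rw [map_sum, Finset.sum_mul, Finset.mul_sum]
    refine Finset.sum_congr rfl fun l hl => ?_
    obtain ⟨hl1, hl2⟩ := Finset.mem_filter.1 hl
    rw [← mul_assoc (D : ℂ), hN, ← hyC l hl1, hl2]
  set R := Finset.range 2 ×ˢ Finset.range 2 ×ˢ Finset.range 2 with hR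
  have hfib : ∑ e ∈ R, auxSum h T' p u v (2 ^ (J + 1)) (C.filter fun l => quotParity q l = e) σ s =
      auxSum h T' p u v (2 ^ (J + 1)) C σ s := by
    simp only [auxSum]
    exact Finset.sum_fiberwise_of_maps_to (fun l _ => quotParity_mem q l) _
  have hsum : ‖∑ e ∈ R, GoldenInt.sized.toC (x e) * (W e : ℂ)‖ ≤
      ‖auxSum h T' p u v (2 ^ (J + 1)) C σ s‖ * D := by
    have h1 : Complex.exp (s * logWeight r / (2 * q)) *
        ∑ e ∈ R, GoldenInt.sized.toC (x e) * (W e : ℂ) =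
        D * auxSum h T' p u v (2 ^ (J + 1)) C σ s := by
      rw [Finset.mul_sum, ← hfib, Finset.mul_sum]
      exact Finset.sum_congr rfl fun e _ => hx e
    have h2 : 1 ≤ ‖Complex.exp (s * logWeight r / (2 * q))‖ := by
      have : Complex.exp (s * logWeight r / (2 * q)) =
        ((exp (s * logWeight r / (2 * q)) : ℝ) : ℂ) := by push_cast; rfl
      rw [this, Complex.norm_real, Real.norm_eq_abs, abs_of_pos (exp_pos _)]
      refine one_le_exp ?_
      have := logWeight_nonneg r
      positivity
    have h3 := congrArg norm h1
    rw [norm_mul, norm_mul, Complex.norm_natCast] at h3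
    rw [mul_comm _ (D : ℝ), ← h3]
    exact le_mul_of_one_le_left (norm_nonneg _) h2
  have hW0 : ∀ e, 0 ≤ W e := fun e => by positivity
  have hsize : ∑ e ∈ R, GoldenInt.sized.size (x e) * W e ≤ T ^ 3 * (D * A * exp (4 * S * T)) := by
    calc _ ≤ ∑ e ∈ R, ∑ l ∈ C.filter fun l => quotParity q l = e,
            GoldenInt.sized.size (y l) * W (quotParity q l) := by
          refine Finset.sum_le_sum fun e _ => ?_
          refine (mul_le_mul_of_nonneg_right (GoldenInt.sized.size_sum _ _) (hW0 e)).trans_eq ?_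
          rw [Finset.sum_mul]
          exact Finset.sum_congr rfl fun l hl => by rw [(Finset.mem_filter.1 hl).2]
      _ = ∑ l ∈ C, GoldenInt.sized.size (y l) * W (quotParity q l) :=
          Finset.sum_fiberwise_of_maps_to (fun l _ => quotParity_mem q l) _
      _ ≤ C.card • (D * A * exp (4 * S * T)) := Finset.sum_le_card_nsmul _ _ _ hysize
      _ ≤ _ := by
          rw [nsmul_eq_mul]
          exact mul_le_mul_of_nonneg_right (card_le_of_subset_cube hC) (by positivity)
  have hzero := GoldenInt.eq_zero_of_small x (by
    refine lt_of_le_of_lt (mul_le_mul hsum (pow_le_pow_left₀ ?_ ?_ 15) ?_ (by positivity)) hsmall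
    · exact Finset.sum_nonneg fun e _ => mul_nonneg (GoldenInt.sized.size_nonneg _) (hW0 e)
    · exact hsize.trans_eq (by ring)
    · exact pow_nonneg (Finset.sum_nonneg fun e _ =>
        mul_nonneg (GoldenInt.sized.size_nonneg _) (hW0 e)) _)
  by_cases he : e ∈ R
  · have := hx e
    rw [hzero e he, map_zero, zero_mul, mul_zero] at this
    exact (mul_eq_zero.1 this.symm).resolve_left hD0
  · rw [auxSum, Finset.filter_eq_empty_iff.2, Finset.sum_empty]
    rintro l _ rfl
    exact he (quotParity_mem q l)

/-- One step of the descent. -/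
theorem Vanishing.step {h T' T : ℕ} {p : ℕ × ℕ × ℕ → ℕ × ℕ → ℤ} {u v : ℕ × ℕ × ℕ → ℤ}
    {P B : ℝ} (hP : 0 ≤ P) (hp : ∀ l k, |(p l k : ℝ)| ≤ P) (hB : 1 ≤ B)
    (hu : ∀ l ∈ cube T, |(u l : ℝ)| ≤ B) (hv : ∀ l ∈ cube T, |(v l : ℝ)| ≤ B)
    {c d δ : ℝ} {t : ℕ × ℕ × ℕ → ℝ} (hw : ∀ l, logWeight l = c * u l + d * v l + t l)
    (ht : ∀ l ∈ cube T, |t l| ≤ δ) {J S k : ℕ} (hS : 0 < S)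
    (hδ : 2 * k * exp (π * k * (17 * ((2 ^ J : ℕ) * S))) * δ ≤ 1)
    (hvan : Vanishing h T' T p u v (2 ^ J) (2 ^ J * S) (4 * k)) {D : ℕ}
    (hD : D = (2 ^ (J + 2)) ^ (h * T') * Nat.lcmUpto h ^ (2 * k))
    (hsmall : (T ^ 3 * (T' * h * P * (exp 1 * (18 * S + h) / h) ^ (h * T') * B ^ (2 * k) *
        exp (36 * S * T + 1)) * (1 / 16) ^ (2 ^ J * S * (2 * k)) +
      T ^ 3 * (T' * h * P * (exp 1 * (2 * S + h) / h) ^ (h * T') * B ^ (2 * k) *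
        exp (4 * S * T) * (4 * k * δ))) * D *
      (T ^ 3 * (D * (T' * h * P * (exp 1 * (2 * S + h) / h) ^ (h * T') * B ^ (2 * k)) *
        exp (4 * S * T))) ^ 15 < 1) :
    Vanishing h T' T p u v (2 ^ (J + 1)) (2 ^ (J + 1) * S) (2 * k) := by
  intro r i hi σ hσ
  have e1 : 2 ^ (J + 1) = 2 * 2 ^ J := by ring
  have hi' : 2 * i + 1 ≤ 4 * (2 ^ J * S) := by
    rw [e1, mul_assoc] at hi
    omega
  have h1 := residueClass_two_mul T (2 ^ J) r
  rw [← e1] at h1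
  rw [h1]
  refine auxSum_filter_eq_zero hP hp hB hu hv _ hσ hi' hD (lt_of_le_of_lt ?_ hsmall) _
  have h2 := norm_auxSum_le hP hp hB hu hv hw ht (q := 2 ^ J) (by positivity) hS hδ hvan
    (r.1 % 2 ^ J, r.2.1 % 2 ^ J, r.2.2 % 2 ^ J) hσ hi'
  rw [← e1] at h2
  have hB0 : 0 ≤ B := by linarith
  gcongr

theorem lcmUpto_le_exp (h : ℕ) : (Nat.lcmUpto h : ℝ) ≤ exp (5.387 * h) := by
  have h1 := Chebyshev.psi_le_const_mul_self (x := (h : ℝ)) (by positivity)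
  have h2 := Chebyshev.psi_eq_log_lcmUpto h
  rw [h2] at h1
  have h3 : (0 : ℝ) < Nat.lcmUpto h := by exact_mod_cast Nat.lcmUpto_pos h
  rw [← log_le_iff_le_exp h3]
  refine h1.trans (mul_le_mul_of_nonneg_right ?_ (by positivity))
  have h4 : log 4 = 2 * log 2 := by
    rw [show (4 : ℝ) = 2 ^ 2 by norm_num, log_pow]; norm_num
  have := log_two_lt_d9
  rw [h4]
  linarith

theorem exp_one_mul_le {c x : ℝ} {h : ℕ} (hh : 1 ≤ h) (hc : 0 ≤ c) (hcx : c + 1 ≤ exp x) (n : ℕ) :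
    (exp 1 * (c * h + h) / h) ^ n ≤ exp ((1 + x) * n) := by
  have hr : (h : ℝ) ≠ 0 := by exact_mod_cast (by omega)
  have e1 : exp 1 * (c * h + h) / h = exp 1 * (c + 1) := by field_simp
  rw [e1, mul_comm (1 + x), exp_nat_mul, exp_add]
  gcongr

theorem le_exp_seven : (1201 : ℝ) ≤ exp 7.1 := by
  have h1 : exp 7.1 = exp 1 ^ 7 * exp 0.1 := by
    rw [← exp_nat_mul, ← exp_add]; norm_num
  have h2 := exp_one_gt_d9
  have h3 := add_one_le_exp (0.1 : ℝ)
  rw [h1]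
  calc (1201 : ℝ) ≤ 2.7182818283 ^ 7 * (0.1 + 1) := by norm_num
    _ ≤ _ := by gcongr

theorem le_exp_nine : (10801 : ℝ) ≤ exp 9.3 := by
  have h1 : exp 9.3 = exp 1 ^ 9 * exp 0.15 ^ 2 := by
    rw [← exp_nat_mul, ← exp_nat_mul, ← exp_add]; norm_num
  have h2 := exp_one_gt_d9
  have h3 := quadratic_le_exp_of_nonneg (show (0 : ℝ) ≤ 0.15 by norm_num)
  rw [h1]
  calc (10801 : ℝ) ≤ 2.7182818283 ^ 9 * (1 + 0.15 + 0.15 ^ 2 / 2) ^ 2 := by norm_num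
    _ ≤ _ := by gcongr

theorem descent_numerics {h J T T' S k D : ℕ} (hh : 1 ≤ h) (hJ : J ≤ 24) (hT : T = 2 ^ 25)
    (hT' : T' = 1001 * 2 ^ 21) (hS : S = 600 * h) (hk : k = 2 ^ (30 - J))
    (hD : D = (2 ^ (J + 2)) ^ (h * T') * Nat.lcmUpto h ^ (2 * k)) {P B δ : ℝ} (hP0 : 0 ≤ P)
    (hP : P ≤ exp ((107 + 36.137 * 2 ^ 32 + 8.1 * (1001 * 2 ^ 21)) / 4 * h))
    (hB : B = exp (12 * h)) (hδ0 : 0 ≤ δ) (hδ : δ ≤ 2 ^ 25 * exp (-(8016 * 2 ^ 32 * h))) :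
    2 * k * exp (π * k * (17 * ((2 ^ J : ℕ) * S))) * δ ≤ 1 ∧
    (T ^ 3 * (T' * h * P * (exp 1 * (18 * S + h) / h) ^ (h * T') * B ^ (2 * k) *
        exp (36 * S * T + 1)) * (1 / 16) ^ (2 ^ J * S * (2 * k)) +
      T ^ 3 * (T' * h * P * (exp 1 * (2 * S + h) / h) ^ (h * T') * B ^ (2 * k) *
        exp (4 * S * T) * (4 * k * δ))) * D *
      (T ^ 3 * (D * (T' * h * P * (exp 1 * (2 * S + h) / h) ^ (h * T') * B ^ (2 * k)) *
        exp (4 * S * T))) ^ 15 < 1 := by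
  have hH : (1 : ℝ) ≤ h := by exact_mod_cast hh
  have h2e : (2 : ℝ) ≤ exp 1 := by have := exp_one_gt_d9; linarith
  have hSr : (S : ℝ) = 600 * h := by rw [hS]; push_cast; rfl
  have hTr : (T : ℝ) = 2 ^ 25 := by rw [hT]; norm_num
  have hTr' : (T' : ℝ) = 1001 * 2 ^ 21 := by rw [hT']; norm_num
  have hkJ : k * 2 ^ J = 2 ^ 30 := by
    rw [hk, ← pow_add, Nat.sub_add_cancel (by omega)]
  have hkJr : (k : ℝ) * (2 ^ J : ℕ) = 2 ^ 30 := by exact_mod_cast hkJ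
  have hk30 : (k : ℝ) ≤ 2 ^ 30 := by
    rw [← hkJr]
    exact le_mul_of_one_le_right (by positivity) (by exact_mod_cast Nat.one_le_two_pow)
  have hl2 := log_two_lt_d9
  have hl2' := log_two_gt_d9
  have hpow2 : ∀ n : ℕ, (2 : ℝ) ^ n ≤ exp n := fun n => by
    rw [← mul_one (n : ℝ), exp_nat_mul]
    gcongr
  constructor
  · have e1 : π * k * (17 * ((2 ^ J : ℕ) * S)) = π * 17 * 2 ^ 30 * 600 * h := by
      rw [hSr]
      linear_combination (π * 17 * 600 * h) * hkJr
    have hpi := pi_lt_d4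
    rw [e1]
    calc _ ≤ 2 * 2 ^ 30 * exp (π * 17 * 2 ^ 30 * 600 * h) *
          (2 ^ 25 * exp (-(8016 * 2 ^ 32 * h))) := by gcongr
      _ = 2 ^ 56 * (exp (π * 17 * 2 ^ 30 * 600 * h) * exp (-(8016 * 2 ^ 32 * h))) := by ring
      _ ≤ exp (56 : ℕ) * (exp (π * 17 * 2 ^ 30 * 600 * h) * exp (-(8016 * 2 ^ 32 * h))) := by
        have := hpow2 56
        gcongr
      _ = exp (56 + (π * 17 * 2 ^ 30 * 600 * h - 8016 * 2 ^ 32 * h)) := by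
        rw [← exp_add, ← exp_add]; push_cast; ring_nf
      _ ≤ 1 := by
        rw [exp_le_one_iff]
        nlinarith
  set H : ℝ := (h : ℝ) with hHdef
  set p : ℝ := (107 + 36.137 * 2 ^ 32 + 8.1 * (1001 * 2 ^ 21)) / 4 * H with hp
  have hQ : (T : ℝ) ^ 3 * T' * H ≤ exp (107 * H) := by
    have h1 : (T : ℝ) ^ 3 * T' ≤ 2 ^ 106 := by rw [hTr, hTr']; norm_num
    calc _ ≤ (2 : ℝ) ^ 106 * H := by gcongr
      _ ≤ exp (106 : ℕ) * exp H := by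
        have := hpow2 106
        have h2 := add_one_le_exp H
        have h3 : H ≤ exp H := by linarith
        gcongr
      _ ≤ _ := by
        rw [← exp_add, exp_le_exp]
        push_cast
        linarith
  set E1 := (exp 1 * (2 * (S : ℝ) + H) / H) ^ (h * T') with hE1def
  set E18 := (exp 1 * (18 * (S : ℝ) + H) / H) ^ (h * T') with hE18def
  have hE1 : E1 ≤ exp (8.1 * (1001 * 2 ^ 21) * H) := by
    have := exp_one_mul_le (c := 1200) hh (by norm_num) (le_trans (by norm_num) le_exp_seven) (h * T')
    rw [hE1def, hSr]
    convert this using 2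
    · ring
    · push_cast; rw [hTr']; ring
  have hE18 : E18 ≤ exp (10.3 * (1001 * 2 ^ 21) * H) := by
    have := exp_one_mul_le (c := 10800) hh (by norm_num) (le_trans (by norm_num) le_exp_nine) (h * T')
    rw [hE18def, hSr]
    convert this using 2
    · ring
    · push_cast; rw [hTr']; ring
  have hE0 : 0 ≤ E1 := by positivity
  have hE180 : 0 ≤ E18 := by positivity
  have hE118 : E1 ≤ E18 := by
    rw [hE1def, hE18def]
    gcongr
    linarith [show (0 : ℝ) ≤ S by positivity]
  have hBm : B ^ (2 * k) = exp (24 * k * H) := by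
    rw [hB, ← exp_nat_mul]; push_cast; ring_nf
  have hDle : (D : ℝ) ≤ exp (((J + 2) * 0.6932 * (1001 * 2 ^ 21) + 2 * k * 5.387) * H) := by
    have h1 : ((2 : ℝ) ^ (J + 2)) ^ (h * T') ≤ exp ((J + 2) * 0.6932 * (1001 * 2 ^ 21) * H) := by
      have h2 : (2 : ℝ) ≤ exp 0.6932 := by
        rw [← log_le_iff_le_exp (by norm_num)]; linarith
      calc _ = (2 : ℝ) ^ ((J + 2) * (h * T')) := (pow_mul _ _ _).symm
        _ ≤ exp 0.6932 ^ ((J + 2) * (h * T')) := by gcongr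
        _ = _ := by rw [← exp_nat_mul]; push_cast; rw [hTr', hHdef]; ring_nf
    have h3 : (Nat.lcmUpto h : ℝ) ^ (2 * k) ≤ exp (2 * k * 5.387 * H) := by
      calc _ ≤ exp (5.387 * h) ^ (2 * k) := by
            have := lcmUpto_le_exp h
            gcongr
        _ = _ := by rw [← exp_nat_mul, hHdef]; push_cast; ring_nf
    rw [hD, add_mul, exp_add]
    push_cast
    exact mul_le_mul h1 h3 (by positivity) (by positivity)
  have hs16 : ((1 : ℝ) / 16) ^ (2 ^ J * S * (2 * k)) ≤ exp (-(2.7725 * 600 * 2 ^ 31 * H)) := by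
    have e1 : 2 ^ J * S * (2 * k) = 2 ^ 31 * 600 * h := by
      rw [hS]
      linear_combination (1200 * h) * hkJ
    have e2 : (1 : ℝ) / 16 ≤ exp (-2.7725) := by
      rw [← log_le_iff_le_exp (by norm_num), one_div, log_inv,
        show (16 : ℝ) = 2 ^ 4 by norm_num, log_pow]
      push_cast
      linarith
    rw [e1]
    calc _ ≤ exp (-2.7725) ^ (2 ^ 31 * 600 * h) := by gcongr
      _ = _ := by rw [← exp_nat_mul, hHdef]; push_cast; ring_nf
  have hs4 : 4 * k * δ ≤ exp (-(2.7725 * 600 * 2 ^ 31 * H)) := by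
    calc 4 * k * δ ≤ 4 * 2 ^ 30 * (2 ^ 25 * exp (-(8016 * 2 ^ 32 * H))) := by gcongr
      _ = 2 ^ 57 * exp (-(8016 * 2 ^ 32 * H)) := by ring
      _ ≤ exp (57 : ℕ) * exp (-(8016 * 2 ^ 32 * H)) := by
        have := hpow2 57
        gcongr
      _ ≤ _ := by
        rw [← exp_add, exp_le_exp]
        push_cast
        linarith
  have hs0 : 0 ≤ ((1 : ℝ) / 16) ^ (2 ^ J * S * (2 * k)) := by positivity
  generalize ((1 : ℝ) / 16) ^ (2 ^ J * S * (2 * k)) = s16 at hs16 hs0 ⊢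
  have hX36 : exp (36 * S * T + 1) = exp (36 * 600 * 2 ^ 25 * H + 1) := by rw [hSr, hTr]; ring_nf
  have hX4 : exp (4 * S * T) = exp (4 * 600 * 2 ^ 25 * H) := by rw [hSr, hTr]; ring_nf
  rw [hX36, hX4, hBm]
  set X := 107 * H + p + 10.3 * (1001 * 2 ^ 21) * H + 24 * k * H + (36 * 600 * 2 ^ 25 * H + 1) +
    -(2.7725 * 600 * 2 ^ 31 * H) with hX
  set d := ((J + 2) * 0.6932 * (1001 * 2 ^ 21) + 2 * k * 5.387) * H with hd
  set Y := 107 * H + p + 8.1 * (1001 * 2 ^ 21) * H + 24 * k * H + 4 * 600 * 2 ^ 25 * H + d with hY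
  have t1 : (T : ℝ) ^ 3 * (T' * H * P * E18 * exp (24 * k * H) * exp (36 * 600 * 2 ^ 25 * H + 1)) *
      s16 ≤ exp X := by
    calc _ = (T : ℝ) ^ 3 * T' * H * P * E18 * exp (24 * k * H) *
          exp (36 * 600 * 2 ^ 25 * H + 1) * s16 := by ring
      _ ≤ exp (107 * H) * exp p * exp (10.3 * (1001 * 2 ^ 21) * H) * exp (24 * k * H) *
          exp (36 * 600 * 2 ^ 25 * H + 1) * exp (-(2.7725 * 600 * 2 ^ 31 * H)) := by gcongr
      _ = _ := by simp only [hX, exp_add]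
  have t2 : (T : ℝ) ^ 3 * (T' * H * P * E1 * exp (24 * k * H) * exp (4 * 600 * 2 ^ 25 * H) *
      (4 * k * δ)) ≤ exp X := by
    calc _ = (T : ℝ) ^ 3 * T' * H * P * E1 * exp (24 * k * H) *
          exp (4 * 600 * 2 ^ 25 * H) * (4 * k * δ) := by ring
      _ ≤ exp (107 * H) * exp p * exp (10.3 * (1001 * 2 ^ 21) * H) * exp (24 * k * H) *
          exp (36 * 600 * 2 ^ 25 * H + 1) * exp (-(2.7725 * 600 * 2 ^ 31 * H)) := by
          have h1 : exp (4 * 600 * 2 ^ 25 * H) ≤ exp (36 * 600 * 2 ^ 25 * H + 1) := by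
            rw [exp_le_exp]; linarith
          have h2 := hE118.trans hE18
          gcongr
      _ = _ := by simp only [hX, exp_add]
  have t3 : (T : ℝ) ^ 3 * (D * (T' * H * P * E1 * exp (24 * k * H)) * exp (4 * 600 * 2 ^ 25 * H)) ≤
      exp Y := by
    calc _ = (T : ℝ) ^ 3 * T' * H * P * E1 * exp (24 * k * H) *
          exp (4 * 600 * 2 ^ 25 * H) * D := by ring
      _ ≤ exp (107 * H) * exp p * exp (8.1 * (1001 * 2 ^ 21) * H) * exp (24 * k * H) *
          exp (4 * 600 * 2 ^ 25 * H) * exp d := by gcongr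
      _ = _ := by simp only [hY, exp_add]
  calc _ ≤ (exp X + exp X) * exp d * exp Y ^ 15 := by gcongr
    _ = 2 * (exp X * exp d * exp Y ^ 15) := by ring
    _ ≤ exp 1 * (exp X * exp d * exp Y ^ 15) := by gcongr
    _ = exp (1 + (X + d + 15 * Y)) := by
      rw [← exp_nat_mul, ← exp_add, ← exp_add, ← exp_add]; push_cast; ring_nf
    _ < 1 := by
      rw [exp_lt_one_iff, hX, hY, hd, hp, hk]
      clear_value H
      clear * - hH hJ
      interval_cases J <;> norm_num <;> linarith

theorem X_sub_C_pow_dvd {P : Polynomial ℂ} {x : ℂ} {m : ℕ}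
    (h : ∀ i < m, (Polynomial.hasseDeriv i P).eval x = 0) : (Polynomial.X - Polynomial.C x) ^ m ∣ P := by
  rw [Polynomial.X_sub_C_pow_dvd_iff, ← Polynomial.taylor_apply, Polynomial.X_pow_dvd_iff]
  intro d hd
  rw [Polynomial.taylor_coeff, h d hd]

theorem natDegree_feldmanComb_lt {h T' : ℕ} (hh : 0 < h) (hT : 0 < T') (p : ℕ × ℕ → ℤ) :
    (feldmanComb h T' p).natDegree < h * T' := by
  have : (feldmanComb h T' p).natDegree ≤ h * T' - 1 := by
    refine Polynomial.natDegree_sum_le_of_forall_le _ _ fun k hk => ?_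
    rw [Finset.mem_product, Finset.mem_range, Finset.mem_range] at hk
    refine (Polynomial.natDegree_smul_le _ _).trans ?_
    rw [natDegree_feldman]
    have : h * (k.1 + 1) ≤ h * T' := Nat.mul_le_mul_left _ hk.1
    rw [mul_add] at this
    omega
  have := Nat.mul_pos hh hT
  omega

theorem feldmanComb_ne_zero {h T' : ℕ} {p : ℕ × ℕ → ℤ} {k : ℕ × ℕ}
    (hk : k ∈ Finset.range T' ×ˢ Finset.range h) (hpk : p k ≠ 0) : feldmanComb h T' p ≠ 0 :=
  sum_feldman_ne_zero (fun k => (p k : ℂ)) hk (by exact_mod_cast hpk)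

theorem Vanishing.eq_zero {h T' T : ℕ} {p : ℕ × ℕ × ℕ → ℕ × ℕ → ℤ} {u v : ℕ × ℕ × ℕ → ℤ}
    {q N m : ℕ} (hvan : Vanishing h T' T p u v q N m) (hh : 0 < h) (hT' : 0 < T') (hq : 0 < q)
    (hTq : T ≤ q) (hdeg : h * T' ≤ N * m) {l : ℕ × ℕ × ℕ} (hl : l ∈ cube T) {k : ℕ × ℕ}
    (hk : k ∈ Finset.range T' ×ˢ Finset.range h) : p l k = 0 := by
  by_contra hne
  have hP := feldmanComb_ne_zero hk hne
  have hC : residueClass T q l = {l} := by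
    ext x
    rw [Finset.mem_singleton, residueClass, Finset.mem_filter, mem_cube]
    obtain ⟨h1, h2, h3⟩ := mem_cube.1 hl
    constructor
    · rintro ⟨⟨a1, a2, a3⟩, b1, b2, b3⟩
      rw [Nat.mod_eq_of_lt (by omega)] at b1 b2 b3
      exact Prod.ext b1 (Prod.ext b2 b3)
    · rintro rfl
      exact ⟨⟨h1, h2, h3⟩, Nat.mod_eq_of_lt (by omega), Nat.mod_eq_of_lt (by omega),
        Nat.mod_eq_of_lt (by omega)⟩
  have hqc : (q : ℂ) ≠ 0 := by exact_mod_cast hq.ne'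
  have hzero : ∀ i ∈ Finset.range N,
      (Polynomial.X - Polynomial.C (((2 * i + 1 : ℕ) : ℂ) / q)) ^ m ∣ feldmanComb h T' (p l) := by
    intro i hi
    refine X_sub_C_pow_dvd fun j hj => ?_
    have := hvan l i (Finset.mem_range.1 hi) (j, 0, 0) (by simpa using hj)
    rw [auxSum, hC, Finset.sum_singleton] at this
    simpa [Complex.exp_ne_zero] using this
  have hdvd : ∏ i ∈ Finset.range N, (Polynomial.X - Polynomial.C (((2 * i + 1 : ℕ) : ℂ) / q)) ^ m ∣
      feldmanComb h T' (p l) := by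
    refine Finset.prod_dvd_of_coprime (fun i _ j _ hij => ?_) hzero
    refine IsCoprime.pow (Polynomial.pairwise_coprime_X_sub_C
      (s := fun i : ℕ => ((2 * i + 1 : ℕ) : ℂ) / q) (fun a b hab => ?_) hij)
    simp only at hab
    rw [div_left_inj' hqc] at hab
    have : 2 * a + 1 = 2 * b + 1 := by exact_mod_cast hab
    omega
  have h1 := Polynomial.natDegree_le_of_dvd hdvd hP
  rw [Polynomial.natDegree_prod_of_monic _ _ fun i _ => (Polynomial.monic_X_sub_C _).pow _] at h1
  simp only [Polynomial.natDegree_pow, Polynomial.natDegree_X_sub_C, mul_one, Finset.sum_const,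
    Finset.card_range, smul_eq_mul] at h1
  have h2 := natDegree_feldmanComb_lt hh hT' (p l)
  omega

/-- A lower bound for linear forms in `log φ`, `log √5` and `log 2`. -/
theorem exp_neg_le_abs_linear_form {h : ℕ} (hh : 1 ≤ h) {b₁ b₂ b₃ : ℤ} (hb₃ : b₃ ≠ 0) {B₀ : ℝ}
    (h₁ : |(b₁ : ℝ)| ≤ B₀) (h₂ : |(b₂ : ℝ)| ≤ B₀) (h₃ : |(b₃ : ℝ)| ≤ B₀)
    (hB : 2 ^ 26 * B₀ ≤ exp (12 * h)) :
    exp (-(8016 * 2 ^ 32 * h)) ≤ |b₁ * log goldenRatio + b₂ * log √5 + b₃ * log 2| := by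
  by_contra! hlt
  set Λ := b₁ * log goldenRatio + b₂ * log √5 + b₃ * log 2 with hΛ
  have hb₃r : (b₃ : ℝ) ≠ 0 := by exact_mod_cast hb₃
  have hb₃1 : 1 ≤ |(b₃ : ℝ)| := by exact_mod_cast Int.one_le_abs hb₃
  have hHr : (1 : ℝ) ≤ h := by exact_mod_cast hh
  obtain ⟨T, hT⟩ : ∃ T : ℕ, T = 2 ^ 25 := ⟨_, rfl⟩
  obtain ⟨T', hT'⟩ : ∃ T' : ℕ, T' = 1001 * 2 ^ 21 := ⟨_, rfl⟩
  obtain ⟨S, hS⟩ : ∃ S : ℕ, S = 600 * h := ⟨_, rfl⟩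
  obtain ⟨M, hM⟩ : ∃ M : ℕ, M = 2 ^ 32 := ⟨_, rfl⟩
  have hSr : (S : ℝ) = 600 * h := by rw [hS]; push_cast; rfl
  have hTr : (T : ℝ) = 2 ^ 25 := by rw [hT]; norm_num
  have hTr' : (T' : ℝ) = 1001 * 2 ^ 21 := by rw [hT']; norm_num
  have hMr : (M : ℝ) = 2 ^ 32 := by rw [hM]; norm_num
  obtain ⟨B, hBdef⟩ : ∃ B : ℝ, B = exp (12 * h) := ⟨_, rfl⟩
  have hB1 : 1 ≤ B := by rw [hBdef]; exact one_le_exp (by positivity)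
  let u : ℕ × ℕ × ℕ → ℤ := fun l => b₃ * l.1 - b₁ * l.2.2
  let v : ℕ × ℕ × ℕ → ℤ := fun l => b₃ * l.2.1 - b₂ * l.2.2
  let t : ℕ × ℕ × ℕ → ℝ := fun l => l.2.2 * (Λ / b₃)
  have key : ∀ (b b' : ℤ) (x y : ℕ), |(b : ℝ)| ≤ B₀ → |(b' : ℝ)| ≤ B₀ → x < T → y < T →
      |((b * x - b' * y : ℤ) : ℝ)| ≤ B := by
    intro b b' x y hb hb' hx hy
    have hx' : (x : ℝ) ≤ 2 ^ 25 := by rw [← hTr]; exact_mod_cast hx.le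
    have hy' : (y : ℝ) ≤ 2 ^ 25 := by rw [← hTr]; exact_mod_cast hy.le
    push_cast
    refine (abs_sub _ _).trans ?_
    rw [abs_mul, abs_mul, Nat.abs_cast, Nat.abs_cast]
    have hB00 := (abs_nonneg _).trans hb
    calc _ ≤ B₀ * 2 ^ 25 + B₀ * 2 ^ 25 := by gcongr
      _ = 2 ^ 26 * B₀ := by ring
      _ ≤ B := by rw [hBdef]; exact hB
  have hu : ∀ l ∈ cube T, |(u l : ℝ)| ≤ B := fun l hl =>
    key _ _ _ _ h₃ h₁ (mem_cube.1 hl).1 (mem_cube.1 hl).2.2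
  have hv : ∀ l ∈ cube T, |(v l : ℝ)| ≤ B := fun l hl =>
    key _ _ _ _ h₃ h₂ (mem_cube.1 hl).2.1 (mem_cube.1 hl).2.2
  have hw : ∀ l, logWeight l = log goldenRatio / b₃ * u l + log √5 / b₃ * v l + t l := by
    intro l
    simp only [u, v, t, hΛ, logWeight]
    generalize log goldenRatio = x
    push_cast
    field_simp
    ring
  obtain ⟨δ, hδdef⟩ : ∃ δ : ℝ, δ = 2 ^ 25 * exp (-(8016 * 2 ^ 32 * h)) := ⟨_, rfl⟩
  have ht : ∀ l ∈ cube T, |t l| ≤ δ := by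
    intro l hl
    have hy' : (l.2.2 : ℝ) ≤ 2 ^ 25 := by rw [← hTr]; exact_mod_cast (mem_cube.1 hl).2.2.le
    simp only [t]
    rw [abs_mul, Nat.abs_cast, abs_div, hδdef]
    have : |Λ| / |(b₃ : ℝ)| ≤ exp (-(8016 * 2 ^ 32 * h)) :=
      (div_le_self (abs_nonneg _) hb₃1).trans hlt.le
    gcongr
  obtain ⟨p, ⟨l, hl, k, hk, hpk⟩, hp, hvan⟩ := exists_vanishing_one (h := h) (T' := T') (T := T)
    u v hB1 hu hv (S := S) (M := M) (by omega) (by omega) hh (by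
      rw [hS, hM, hT', hT]
      have : 10 * (600 * h) * (2 ^ 32 * (2 ^ 32 + 1) * (2 ^ 32 + 2)) =
        (6000 * (2 ^ 32 * (2 ^ 32 + 1) * (2 ^ 32 + 2))) * h := by ring
      rw [this, show 6 * (1001 * 2 ^ 21 * h * (2 ^ 25) ^ 3) = 6 * (1001 * 2 ^ 21 * (2 ^ 25) ^ 3) * h by ring]
      exact Nat.mul_le_mul_right _ (by norm_num))
  obtain ⟨P, hPdef⟩ : ∃ P : ℝ, P = (T' * h * T ^ 3 * ((Nat.lcmUpto h : ℝ) ^ M *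
        (exp 1 * (2 * S + h) / h) ^ (h * T') * B ^ M * exp (4 * S * T))) ^ (1 / 4 : ℝ) := ⟨_, rfl⟩
  rw [← hPdef] at hp
  have hP0 : 0 ≤ P := (abs_nonneg _).trans (hp l k)
  have hP : P ≤ exp ((107 + 36.137 * 2 ^ 32 + 8.1 * (1001 * 2 ^ 21)) / 4 * h) := by
    have e1 : exp ((107 + 36.137 * 2 ^ 32 + 8.1 * (1001 * 2 ^ 21)) / 4 * h) =
        exp ((107 + 36.137 * 2 ^ 32 + 8.1 * (1001 * 2 ^ 21)) * h) ^ (1 / 4 : ℝ) := by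
      rw [← exp_mul]; ring_nf
    have hB0 : 0 ≤ B := by linarith
    rw [e1, hPdef]
    refine rpow_le_rpow (by positivity) ?_ (by norm_num)
    have hQ : (T' : ℝ) * h * T ^ 3 ≤ exp (107 * h) := by
      have h3 : (h : ℝ) ≤ exp h := by have := add_one_le_exp (h : ℝ); linarith
      calc _ = (1001 * 2 ^ 96 : ℝ) * h := by rw [hTr, hTr']; ring
        _ ≤ exp 106 * exp h := by
          have : (2 : ℝ) ≤ exp 1 := by have := exp_one_gt_d9; linarith
          have h4 : (1001 * 2 ^ 96 : ℝ) ≤ exp 106 := by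
            calc _ ≤ (2 : ℝ) ^ 106 := by norm_num
              _ ≤ exp 1 ^ 106 := by gcongr
              _ = _ := by rw [← exp_nat_mul]; norm_num
          gcongr
        _ ≤ _ := by rw [← exp_add, exp_le_exp]; linarith
    have hE1 : (exp 1 * (2 * S + h) / h) ^ (h * T') ≤ exp (8.1 * (1001 * 2 ^ 21) * h) := by
      have := exp_one_mul_le (c := 1200) hh (by norm_num) (le_trans (by norm_num) le_exp_seven) (h * T')
      rw [hSr]
      convert this using 2
      · ring
      · push_cast; rw [hTr']; ring
    have hl : (Nat.lcmUpto h : ℝ) ^ M ≤ exp (5.387 * 2 ^ 32 * h) := by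
      calc _ ≤ exp (5.387 * h) ^ M := by
            have := lcmUpto_le_exp h
            gcongr
        _ = _ := by rw [← exp_nat_mul, hMr]; ring_nf
    have hBM : B ^ M = exp (12 * 2 ^ 32 * h) := by rw [hBdef, ← exp_nat_mul, hMr]; ring_nf
    have h4 : exp (4 * S * T) = exp (18.75 * 2 ^ 32 * h) := by rw [hSr, hTr]; norm_num; ring_nf
    rw [hBM, h4]
    calc _ ≤ exp (107 * h) * (exp (5.387 * 2 ^ 32 * h) * exp (8.1 * (1001 * 2 ^ 21) * h) *
          exp (12 * 2 ^ 32 * h) * exp (18.75 * 2 ^ 32 * h)) := by gcongr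
      _ = _ := by
        simp only [← exp_add]
        ring_nf
  have hall : ∀ J ≤ 25, Vanishing h T' T p u v (2 ^ J) (2 ^ J * S) (2 ^ (32 - J)) := by
    intro J
    induction J with
    | zero =>
      intro _
      rw [hM] at hvan
      simpa only [pow_zero, one_mul, Nat.sub_zero] using hvan
    | succ J ih =>
      intro hJ
      have e4 : 2 ^ (32 - J) = 4 * 2 ^ (30 - J) := by
        rw [show 32 - J = 2 + (30 - J) by omega, pow_add]; norm_num
      have e2 : 2 ^ (32 - (J + 1)) = 2 * 2 ^ (30 - J) := by
        rw [show 32 - (J + 1) = 1 + (30 - J) by omega, pow_add, pow_one]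
      have hJv := ih (by omega)
      rw [e4] at hJv
      rw [e2]
      obtain ⟨n1, n2⟩ := descent_numerics hh (show J ≤ 24 by omega) hT hT' hS rfl rfl hP0 hP hBdef
        (by rw [hδdef]; positivity) hδdef.le
      exact hJv.step hP0 hp hB1 hu hv hw ht (by omega) n1 rfl n2
  refine hpk ((hall 25 le_rfl).eq_zero hh (by omega) (by positivity) hT.le ?_ hl hk)
  rw [hS, hT', show 32 - 25 = 7 by norm_num]
  have : 2 ^ 25 * (600 * h) * 2 ^ 7 = (2 ^ 25 * 600 * 2 ^ 7) * h := by ring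
  rw [this, mul_comm h]
  exact Nat.mul_le_mul_right _ (by norm_num)

/-- Perturbing a nonzero number by a small relative amount changes its logarithm by little. -/
theorem abs_log_abs_sub_le {r w η : ℝ} (hw : w ≠ 0) (hη : η ≤ 1 / 2) (h : |r - w| ≤ η * |w|) :
    |log |r| - log (|w|)| ≤ 2 * η := by
  have hw' : 0 < |w| := abs_pos.2 hw
  have h0 : 0 ≤ η := by
    by_contra! hc
    have := mul_neg_of_neg_of_pos hc hw'
    linarith [abs_nonneg (r - w)]
  have h1 : |r| ≤ (1 + η) * |w| := by
    have := abs_sub_abs_le_abs_sub r w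
    linarith
  have h2 : (1 - η) * |w| ≤ |r| := by
    have := abs_sub_abs_le_abs_sub w r
    rw [abs_sub_comm] at this
    linarith
  have hr : 0 < |r| := lt_of_lt_of_le (mul_pos (by linarith) hw') h2
  rw [← log_div hr.ne' hw'.ne', abs_le]
  have hq : 0 < |r| / |w| := by positivity
  constructor
  · have h3 : 1 - η ≤ |r| / |w| := by rwa [le_div_iff₀ hw']
    have h4 := one_sub_inv_le_log_of_pos hq
    have h5 : (|r| / |w|)⁻¹ ≤ (1 - η)⁻¹ := inv_anti₀ (by linarith) h3
    have h6 : (1 - η)⁻¹ ≤ 1 + 2 * η := by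
      rw [inv_le_comm₀ (by linarith) (by linarith), inv_le_iff_one_le_mul₀ (by linarith)]
      nlinarith
    linarith
  · have h3 : |r| / |w| ≤ 1 + η := by rwa [div_le_iff₀ hw']
    have := log_le_sub_one_of_pos hq
    linarith

/-- A cubic `t (t + d) (t + e) - 1` with `d`, `e` large has a root close to `0`. -/
theorem exists_small_root {d e M : ℝ} (hM : 10 ≤ M) (hd : M ≤ |d|) (he : M ≤ |e|) :
    ∃ t : ℝ, |t| ≤ 2 / M ^ 2 ∧ t * (t + d) * (t + e) = 1 := by
  have hε : 2 / M ^ 2 ≤ 1 := by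
    rw [div_le_one (by positivity)]; nlinarith
  have hε0 : 0 < 2 / M ^ 2 := by positivity
  obtain ⟨t₀, ht₀, ht₁⟩ : ∃ t₀ : ℝ, |t₀| = 2 / M ^ 2 ∧ 1 ≤ t₀ * (t₀ + d) * (t₀ + e) := by
    have key : ∀ t : ℝ, |t| = 2 / M ^ 2 → 1 ≤ |t * (t + d) * (t + e)| ∧
        0 ≤ ((t + d) * (t + e)) * (d * e) := by
      intro t ht
      have h1 : M - 1 ≤ |t + d| := by
        have := abs_sub_abs_le_abs_sub d (-t)
        rw [abs_neg, sub_neg_eq_add, add_comm d] at this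
        linarith
      have h2 : M - 1 ≤ |t + e| := by
        have := abs_sub_abs_le_abs_sub e (-t)
        rw [abs_neg, sub_neg_eq_add, add_comm e] at this
        linarith
      constructor
      · rw [abs_mul, abs_mul, ht]
        calc (1 : ℝ) ≤ 2 / M ^ 2 * (M - 1) * (M - 1) := by
              rw [div_mul_eq_mul_div, div_mul_eq_mul_div, le_div_iff₀ (by positivity)]
              nlinarith
          _ ≤ _ := by
              gcongr
              linarith
      · have hs : ∀ d : ℝ, M ≤ |d| → 0 ≤ (t + d) * d := by
          intro d hd
          have h3 : |t| ≤ |d| := by linarith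
          have h4 : |t * d| ≤ d * d := by
            rw [abs_mul, ← abs_mul_abs_self d]; gcongr
          have := neg_abs_le (t * d)
          nlinarith
        have := mul_nonneg (hs d hd) (hs e he)
        linarith
    rcases le_total 0 (d * e) with h | h
    · refine ⟨2 / M ^ 2, abs_of_pos hε0, ?_⟩
      obtain ⟨k1, k2⟩ := key (2 / M ^ 2) (abs_of_pos hε0)
      rwa [abs_of_nonneg] at k1
      have hde : 0 < d * e := lt_of_le_of_ne h (by
        intro h0
        rcases mul_eq_zero.1 h0.symm with h | h <;> subst h <;> simp at hd he <;> linarith)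
      have := nonneg_of_mul_nonneg_left k2 hde
      rw [mul_assoc]
      positivity
    · refine ⟨-(2 / M ^ 2), by rw [abs_neg, abs_of_pos hε0], ?_⟩
      obtain ⟨k1, k2⟩ := key (-(2 / M ^ 2)) (by rw [abs_neg, abs_of_pos hε0])
      rwa [abs_of_nonneg] at k1
      have hde : d * e < 0 := lt_of_le_of_ne h (by
        intro h0
        rcases mul_eq_zero.1 h0 with h | h <;> subst h <;> simp at hd he <;> linarith)
      have : (-(2 / M ^ 2) + d) * (-(2 / M ^ 2) + e) ≤ 0 := by
        by_contra! hc
        have := mul_neg_of_pos_of_neg hc hde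
        linarith
      rw [mul_assoc]
      nlinarith
  have hc : ContinuousOn (fun t : ℝ => t * (t + d) * (t + e)) (Set.uIcc 0 t₀) := by fun_prop
  obtain ⟨t, ht, h⟩ := intermediate_value_uIcc hc
    (show (1 : ℝ) ∈ Set.uIcc _ _ from by
      simp only [zero_mul]
      exact Set.mem_uIcc.2 (Or.inl ⟨zero_le_one, ht₁⟩))
  refine ⟨t, ?_, h⟩
  have := Set.abs_sub_left_of_mem_uIcc ht
  simpa [ht₀] using this

/-- The three roots of `(X - c₁) (X - c₂) (X - c₃) - 1`. -/
structure ShiftedRoots (c₁ c₂ c₃ : ℤ) (r₁ r₂ r₃ : ℝ) : Prop where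
  sum_eq : r₁ + r₂ + r₃ = c₁ + c₂ + c₃
  sum_mul_eq : r₁ * r₂ + r₁ * r₃ + r₂ * r₃ = c₁ * c₂ + c₁ * c₃ + c₂ * c₃
  prod_eq : r₁ * r₂ * r₃ = c₁ * c₂ * c₃ + 1

namespace ShiftedRoots

variable {c₁ c₂ c₃ : ℤ} {r₁ r₂ r₃ : ℝ}

theorem of_root (h₁ : (r₁ - c₁) * (r₁ - c₂) * (r₁ - c₃) = 1)
    (h₂ : (r₂ - c₁) * (r₂ - c₂) * (r₂ - c₃) = 1) (h₃ : (r₃ - c₁) * (r₃ - c₂) * (r₃ - c₃) = 1)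
    (h₁₂ : r₁ ≠ r₂) (h₁₃ : r₁ ≠ r₃) (h₂₃ : r₂ ≠ r₃) : ShiftedRoots c₁ c₂ c₃ r₁ r₂ r₃ := by
  have e12 : r₁ ^ 2 + r₁ * r₂ + r₂ ^ 2 - (c₁ + c₂ + c₃) * (r₁ + r₂) +
      (c₁ * c₂ + c₁ * c₃ + c₂ * c₃) = 0 := by
    apply mul_left_cancel₀ (sub_ne_zero.2 h₁₂)
    linear_combination h₁ - h₂
  have e13 : r₁ ^ 2 + r₁ * r₃ + r₃ ^ 2 - (c₁ + c₂ + c₃) * (r₁ + r₃) +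
      (c₁ * c₂ + c₁ * c₃ + c₂ * c₃) = 0 := by
    apply mul_left_cancel₀ (sub_ne_zero.2 h₁₃)
    linear_combination h₁ - h₃
  have s1 : r₁ + r₂ + r₃ = c₁ + c₂ + c₃ := by
    apply mul_left_cancel₀ (sub_ne_zero.2 h₂₃)
    linear_combination e12 - e13
  have s2 : r₁ * r₂ + r₁ * r₃ + r₂ * r₃ = c₁ * c₂ + c₁ * c₃ + c₂ * c₃ := by
    linear_combination (r₁ + r₂) * s1 - e12
  refine ⟨s1, s2, ?_⟩
  linear_combination h₁ - r₁ ^ 2 * s1 + r₁ * s2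

theorem root₁ (h : ShiftedRoots c₁ c₂ c₃ r₁ r₂ r₃) : (r₁ - c₁) * (r₁ - c₂) * (r₁ - c₃) = 1 := by
  linear_combination r₁ ^ 2 * h.sum_eq - r₁ * h.sum_mul_eq + h.prod_eq

theorem root₂ (h : ShiftedRoots c₁ c₂ c₃ r₁ r₂ r₃) : (r₂ - c₁) * (r₂ - c₂) * (r₂ - c₃) = 1 := by
  linear_combination r₂ ^ 2 * h.sum_eq - r₂ * h.sum_mul_eq + h.prod_eq

theorem root₃ (h : ShiftedRoots c₁ c₂ c₃ r₁ r₂ r₃) : (r₃ - c₁) * (r₃ - c₂) * (r₃ - c₃) = 1 := by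
  linear_combination r₃ ^ 2 * h.sum_eq - r₃ * h.sum_mul_eq + h.prod_eq

/-- The norm form attached to the roots. -/
theorem prod_sub_mul (h : ShiftedRoots c₁ c₂ c₃ r₁ r₂ r₃) (x y : ℝ) :
    (x - r₁ * y) * (x - r₂ * y) * (x - r₃ * y) =
      (x - c₁ * y) * (x - c₂ * y) * (x - c₃ * y) - y ^ 3 := by
  linear_combination -x ^ 2 * y * h.sum_eq + x * y ^ 2 * h.sum_mul_eq - y ^ 3 * h.prod_eq

/-- Norm of a shift of the root is a unit. -/
theorem prod_sub_const (h : ShiftedRoots c₁ c₂ c₃ r₁ r₂ r₃) (t : ℝ) :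
    (r₁ - t) * (r₂ - t) * (r₃ - t) = 1 - (t - c₁) * (t - c₂) * (t - c₃) := by
  linear_combination -(h.prod_sub_mul t 1)

/-- Traces of integral elements are integers. -/
theorem exists_trace_eq (h : ShiftedRoots c₁ c₂ c₃ r₁ r₂ r₃) (P : Polynomial ℤ) :
    ∃ t : ℤ, P.aeval r₁ + P.aeval r₂ + P.aeval r₃ = t := by
  have hpow : ∀ k : ℕ, ∃ t₀ t₁ t₂ : ℤ, r₁ ^ k + r₂ ^ k + r₃ ^ k = t₀ ∧
      r₁ ^ (k + 1) + r₂ ^ (k + 1) + r₃ ^ (k + 1) = t₁ ∧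
      r₁ ^ (k + 2) + r₂ ^ (k + 2) + r₃ ^ (k + 2) = t₂ := by
    intro k
    induction k with
    | zero =>
      refine ⟨3, c₁ + c₂ + c₃, (c₁ + c₂ + c₃) ^ 2 - 2 * (c₁ * c₂ + c₁ * c₃ + c₂ * c₃), ?_, ?_, ?_⟩
      · norm_num
      · push_cast; linear_combination h.sum_eq
      · push_cast
        linear_combination (r₁ + r₂ + r₃ + c₁ + c₂ + c₃) * h.sum_eq - 2 * h.sum_mul_eq
    | succ k ih =>
      obtain ⟨t₀, t₁, t₂, e₀, e₁, e₂⟩ := ih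
      refine ⟨t₁, t₂, (c₁ + c₂ + c₃) * t₂ - (c₁ * c₂ + c₁ * c₃ + c₂ * c₃) * t₁ +
        (c₁ * c₂ * c₃ + 1) * t₀, e₁, e₂, ?_⟩
      push_cast
      rw [← e₀, ← e₁, ← e₂]
      linear_combination r₁ ^ k * h.root₁ + r₂ ^ k * h.root₂ + r₃ ^ k * h.root₃
  induction P using Polynomial.induction_on' with
  | add p q hp hq =>
    obtain ⟨s, hs⟩ := hp
    obtain ⟨t, ht⟩ := hq
    refine ⟨s + t, ?_⟩
    push_cast
    rw [← hs, ← ht]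
    simp only [map_add]
    ring
  | monomial k a =>
    obtain ⟨t, -, -, ht, -⟩ := hpow k
    refine ⟨a * t, ?_⟩
    push_cast
    rw [← ht]
    simp only [Polynomial.aeval_monomial, eq_intCast]
    ring

/-- An integral unit all of whose conjugates have absolute value close to `1` has all of its
conjugates of absolute value exactly `1`. -/
theorem log_abs_aeval_eq_zero (h : ShiftedRoots c₁ c₂ c₃ r₁ r₂ r₃) (P : Polynomial ℤ)
    (hn : |P.aeval r₁ * P.aeval r₂ * P.aeval r₃| = 1) (h₁ : log |P.aeval r₁| ≤ 7 / 50)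
    (h₂ : log |P.aeval r₂| ≤ 7 / 50) (h₃ : log |P.aeval r₃| ≤ 7 / 50) :
    log |P.aeval r₁| = 0 ∧ log |P.aeval r₂| = 0 ∧ log |P.aeval r₃| = 0 := by
  obtain ⟨t, ht⟩ := h.exists_trace_eq (P ^ 2)
  simp only [map_pow] at ht
  generalize P.aeval r₁ = a at *
  generalize P.aeval r₂ = b at *
  generalize P.aeval r₃ = c at *
  have hne : a ≠ 0 ∧ b ≠ 0 ∧ c ≠ 0 := by
    refine ⟨?_, ?_, ?_⟩ <;> rintro rfl <;> simp at hn
  obtain ⟨ha, hb, hc⟩ := hne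
  have hlog : log |a| + log |b| + log |c| = 0 := by
    rw [← log_mul, ← log_mul, ← abs_mul, ← abs_mul, hn, log_one] <;> simp [ha, hb, hc]
  have hexp : exp (7 / 25) < 4 / 3 := by
    have h1 : exp (7 / 25) ^ 25 = exp 1 ^ 7 := by
      rw [← exp_nat_mul, ← exp_nat_mul]; norm_num
    by_contra! hcon
    have h2 : (4 / 3 : ℝ) ^ 25 ≤ exp (7 / 25) ^ 25 := by gcongr
    have h3 : exp 1 ^ 7 ≤ 2.7182818286 ^ 7 := by
      have := exp_one_lt_d9
      gcongr
    rw [h1] at h2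
    norm_num at h2 h3
    linarith
  have hsq : ∀ z : ℝ, z ≠ 0 → log |z| ≤ 7 / 50 → z ^ 2 < 4 / 3 := by
    intro z hz hl
    refine lt_of_le_of_lt ?_ hexp
    rw [← sq_abs, ← exp_log (abs_pos.2 hz), ← exp_nat_mul, exp_le_exp]
    push_cast
    linarith
  have hge : ∀ z : ℝ, z ≠ 0 → 2 * log |z| ≤ z ^ 2 - 1 := by
    intro z hz
    have := log_le_sub_one_of_pos (show 0 < z ^ 2 by positivity)
    rw [log_pow, ← log_abs] at this
    exact_mod_cast this
  have t4 : (t : ℝ) < 4 := by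
    rw [← ht]
    linarith [hsq a ha h₁, hsq b hb h₂, hsq c hc h₃]
  have t4' : t < 4 := by exact_mod_cast t4
  have t3 : (t : ℝ) ≤ 3 := by exact_mod_cast (show t ≤ 3 by omega)
  have heq : ∀ z : ℝ, z ≠ 0 → z ^ 2 - 1 ≤ 2 * log |z| → log |z| = 0 := by
    intro z hz hl
    by_cases h1 : z ^ 2 = 1
    · rcases sq_eq_one_iff.1 h1 with h | h <;> simp [h]
    · have := log_lt_sub_one_of_pos (show 0 < z ^ 2 by positivity) h1
      rw [log_pow, ← log_abs] at this
      push_cast at this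
      linarith
  have ga := hge a ha
  have gb := hge b hb
  have gc := hge c hc
  exact ⟨heq a ha (by linarith), heq b hb (by linarith), heq c hc (by linarith)⟩

end ShiftedRoots

/-- Simultaneous approximation of two real numbers by integers. -/
theorem exists_simultaneous_approx (a b : ℝ) {N : ℕ} (hN : 1 ≤ N) :
    ∃ I : ℕ, 1 ≤ I ∧ I ≤ N ^ 2 ∧ ∃ s t : ℤ, |I * a - s| ≤ 1 / N ∧ |I * b - t| ≤ 1 / N := by
  have hN' : (0 : ℝ) < N := by exact_mod_cast hN
  let f : ℕ → ℕ × ℕ := fun k => (⌊N * Int.fract (k * a)⌋₊, ⌊N * Int.fract (k * b)⌋₊)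
  have hmaps : ∀ k ∈ Finset.range (N ^ 2 + 1), f k ∈ Finset.range N ×ˢ Finset.range N := by
    intro k _
    have hlt : ∀ z : ℝ, ⌊N * Int.fract z⌋₊ < N := by
      intro z
      rw [Nat.floor_lt (by positivity)]
      have := Int.fract_lt_one z
      nlinarith
    simp [f, hlt]
  obtain ⟨k, hk, l, hl, hne, hkl⟩ := Finset.exists_ne_map_eq_of_card_lt_of_maps_to
    (by simp [sq]) hmaps
  wlog hlt : k < l generalizing k l
  · exact this l hl k hk hne.symm hkl.symm (by omega)
  have hclose : ∀ z : ℝ, ⌊N * Int.fract (k * z)⌋₊ = ⌊N * Int.fract (l * z)⌋₊ →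
      |((l - k : ℕ) : ℝ) * z - ((⌊(l : ℝ) * z⌋ - ⌊(k : ℝ) * z⌋ : ℤ) : ℝ)| ≤ 1 / N := by
    intro z hz
    have e : ((l - k : ℕ) : ℝ) * z - ((⌊(l : ℝ) * z⌋ - ⌊(k : ℝ) * z⌋ : ℤ) : ℝ) =
        Int.fract (l * z) - Int.fract (k * z) := by
      rw [Nat.cast_sub hlt.le, Int.cast_sub, ← Int.self_sub_floor, ← Int.self_sub_floor]
      ring
    rw [e, le_div_iff₀ hN', show ∀ d : ℝ, |d| * N = |d * N| from fun d => by rw [abs_mul, Nat.abs_cast]]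
    have p1 := Nat.floor_le (show 0 ≤ N * Int.fract (k * z) by positivity)
    have p2 := Nat.floor_le (show 0 ≤ N * Int.fract (l * z) by positivity)
    have p3 := Nat.lt_floor_add_one (N * Int.fract (k * z))
    have p4 := Nat.lt_floor_add_one (N * Int.fract (l * z))
    rw [hz] at p1 p3
    rw [abs_le]
    constructor <;> linarith
  simp only [Finset.mem_range] at hk hl
  simp only [f, Prod.mk.injEq] at hkl
  exact ⟨l - k, by omega, by omega, _, _, hclose a hkl.1, hclose b hkl.2⟩

namespace ShiftedRoots

variable {c₁ c₂ c₃ : ℤ} {r₁ r₂ r₃ : ℝ}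

/-- Some power of bounded exponent of a unit `x - r y` is multiplicatively dependent with the units
`r - c₁` and `r - c₂`, provided the latter are independent. -/
theorem exists_log_relation (h : ShiftedRoots c₁ c₂ c₃ r₁ r₂ r₃) {x y : ℤ}
    (hxy : |((x - c₁ * y) * (x - c₂ * y) * (x - c₃ * y) - y ^ 3 : ℝ)| = 1) {K : ℝ} {N : ℕ}
    (hN : 1 ≤ N) (hK : K / N ≤ 7 / 50)
    (hdet : log (r₁ - c₁) * log (r₂ - c₂) - log (r₁ - c₂) * log (r₂ - c₁) ≠ 0)
    (h₁ : |log (r₁ - c₁)| + |log (r₁ - c₂)| ≤ K) (h₂ : |log (r₂ - c₁)| + |log (r₂ - c₂)| ≤ K)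
    (h₃ : |log (r₃ - c₁)| + |log (r₃ - c₂)| ≤ K) :
    ∃ I : ℕ, 1 ≤ I ∧ I ≤ N ^ 2 ∧ ∃ a b : ℤ,
      I * log (x - r₁ * y) = a * log (r₁ - c₁) + b * log (r₁ - c₂) ∧
      I * log (x - r₂ * y) = a * log (r₂ - c₁) + b * log (r₂ - c₂) ∧
      I * log (x - r₃ * y) = a * log (r₃ - c₁) + b * log (r₃ - c₂) := by
  have hlogu : ∀ r : ℝ, (r - c₁) * (r - c₂) * (r - c₃) = 1 →
      r - c₁ ≠ 0 ∧ r - c₂ ≠ 0 ∧ r - c₃ ≠ 0 ∧ log (r - c₁) + log (r - c₂) + log (r - c₃) = 0 := by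
    intro r hr
    have n1 : r - c₁ ≠ 0 := by intro h0; simp [h0] at hr
    have n2 : r - c₂ ≠ 0 := by intro h0; simp [h0] at hr
    have n3 : r - c₃ ≠ 0 := by intro h0; simp [h0] at hr
    refine ⟨n1, n2, n3, ?_⟩
    rw [← log_mul, ← log_mul, hr, log_one] <;> simp [n1, n2, n3]
  have hprod := h.prod_sub_mul x y
  rw [← hprod] at hxy
  have hsum : ∀ a b c : ℝ, |a * b * c| = 1 →
      a ≠ 0 ∧ b ≠ 0 ∧ c ≠ 0 ∧ log (a) + log (b) + log (c) = 0 := by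
    intro a b c he
    have n1 : a ≠ 0 := by rintro rfl; simp at he
    have n2 : b ≠ 0 := by rintro rfl; simp at he
    have n3 : c ≠ 0 := by rintro rfl; simp at he
    refine ⟨n1, n2, n3, ?_⟩
    rw [← log_mul, ← log_mul, ← log_abs, he, log_one] <;> simp [n1, n2, n3]
  have hnorm : ∀ c : ℤ, ((c : ℝ) - c₁) * (c - c₂) * (c - c₃) = 0 →
      |(r₁ - c) * (r₂ - c) * (r₃ - c)| = 1 := by
    intro c hc
    rw [h.prod_sub_const, hc, sub_zero, abs_one]
  have hm1 := hnorm c₁ (by ring)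
  have hm2 := hnorm c₂ (by ring)
  have hm3 := hnorm c₃ (by ring)
  obtain ⟨a, b, hab₁, hab₂⟩ : ∃ a b : ℝ,
      log (x - r₁ * y) = a * log (r₁ - c₁) + b * log (r₁ - c₂) ∧
      log (x - r₂ * y) = a * log (r₂ - c₁) + b * log (r₂ - c₂) := by
    refine ⟨(log (x - r₁ * y) * log (r₂ - c₂) - log (x - r₂ * y) * log (r₁ - c₂)) /
      (log (r₁ - c₁) * log (r₂ - c₂) - log (r₁ - c₂) * log (r₂ - c₁)),
      (log (r₁ - c₁) * log (x - r₂ * y) - log (r₂ - c₁) * log (x - r₁ * y)) /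
      (log (r₁ - c₁) * log (r₂ - c₂) - log (r₁ - c₂) * log (r₂ - c₁)), ?_, ?_⟩ <;>
    · rw [div_mul_eq_mul_div, div_mul_eq_mul_div, ← add_div, eq_div_iff hdet]
      ring
  obtain ⟨nx1, nx2, nx3, sx⟩ := hsum _ _ _ hxy
  obtain ⟨-, -, -, s1⟩ := hsum _ _ _ hm1
  obtain ⟨-, -, -, s2⟩ := hsum _ _ _ hm2
  have hab₃ : log (x - r₃ * y) = a * log (r₃ - c₁) + b * log (r₃ - c₂) := by
    linear_combination sx - a * s1 - b * s2 - hab₁ - hab₂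
  obtain ⟨I, hI, hIN, s, t, hs, ht⟩ := exists_simultaneous_approx a b hN
  refine ⟨I, hI, hIN, s, t, ?_⟩
  let m : ℕ := s.natAbs + t.natAbs
  let P : Polynomial ℤ := (Polynomial.C x - Polynomial.C y * Polynomial.X) ^ I *
    (Polynomial.X - Polynomial.C c₁) ^ (m - s).toNat *
    (Polynomial.X - Polynomial.C c₂) ^ (m - t).toNat * (Polynomial.X - Polynomial.C c₃) ^ m
  have hP : ∀ r : ℝ, P.aeval r = (x - r * y) ^ I * (r - c₁) ^ (m - s).toNat *
      (r - c₂) ^ (m - t).toNat * (r - c₃) ^ m := by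
    intro r
    simp [P, mul_comm r]
  have hms : (((m - s).toNat : ℕ) : ℝ) = m - s := by
    have : (((m - s).toNat : ℕ) : ℤ) = m - s := Int.toNat_of_nonneg (by omega)
    exact_mod_cast this
  have hmt : (((m - t).toNat : ℕ) : ℝ) = m - t := by
    have : (((m - t).toNat : ℕ) : ℤ) = m - t := Int.toNat_of_nonneg (by omega)
    exact_mod_cast this
  have hlogP : ∀ r : ℝ, (r - c₁) * (r - c₂) * (r - c₃) = 1 → x - r * y ≠ 0 →
      log (P.aeval r) = I * log (x - r * y) - s * log (r - c₁) - t * log (r - c₂) := by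
    intro r hr hx
    obtain ⟨n1, n2, n3, hl⟩ := hlogu r hr
    rw [hP, log_mul (by positivity) (by positivity), log_mul (by positivity) (by positivity),
      log_mul (by positivity) (by positivity), log_pow, log_pow, log_pow, log_pow, hms, hmt]
    linear_combination (m : ℝ) * hl
  have hPn : |P.aeval r₁ * P.aeval r₂ * P.aeval r₃| = 1 := by
    have e : P.aeval r₁ * P.aeval r₂ * P.aeval r₃ =
        ((x - r₁ * y) * (x - r₂ * y) * (x - r₃ * y)) ^ I *
        ((r₁ - c₁) * (r₂ - c₁) * (r₃ - c₁)) ^ (m - s).toNat *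
        ((r₁ - c₂) * (r₂ - c₂) * (r₃ - c₂)) ^ (m - t).toNat *
        ((r₁ - c₃) * (r₂ - c₃) * (r₃ - c₃)) ^ m := by
      simp only [hP, mul_pow]; ring
    rw [e]
    simp only [abs_mul _ (_ ^ _), abs_pow, hxy, hm1, hm2, hm3, one_pow, mul_one]
  have hsmall : ∀ L U V : ℝ, L = a * U + b * V → |U| + |V| ≤ K →
      I * L - s * U - t * V ≤ 7 / 50 := by
    intro L U V hL hUV
    calc I * L - s * U - t * V = (I * a - s) * U + (I * b - t) * V := by rw [hL]; ring
      _ ≤ |(I * a - s) * U| + |(I * b - t) * V| := add_le_add (le_abs_self _) (le_abs_self _)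
      _ ≤ 1 / N * |U| + 1 / N * |V| := by
        rw [abs_mul, abs_mul]; gcongr
      _ = (|U| + |V|) / N := by ring
      _ ≤ K / N := by gcongr
      _ ≤ _ := hK
  have l1 := hlogP r₁ h.root₁ nx1
  have l2 := hlogP r₂ h.root₂ nx2
  have l3 := hlogP r₃ h.root₃ nx3
  have hz := h.log_abs_aeval_eq_zero P hPn (by rw [log_abs, l1]; exact hsmall _ _ _ hab₁ h₁)
    (by rw [log_abs, l2]; exact hsmall _ _ _ hab₂ h₂)
    (by rw [log_abs, l3]; exact hsmall _ _ _ hab₃ h₃)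
  rw [log_abs, log_abs, log_abs, l1, l2, l3] at hz
  obtain ⟨z1, z2, z3⟩ := hz
  refine ⟨?_, ?_, ?_⟩ <;> linarith

/-- If every conjugate of `x - r y` has the absolute value of the conjugate of `r - c`, then
`y = ±1`. -/
theorem abs_eq_one_of_abs_eq {x y c r₁ r₂ r₃ : ℝ} (h₁₂ : r₁ ≠ r₂) (h₁₃ : r₁ ≠ r₃) (h₂₃ : r₂ ≠ r₃)
    (h₁ : |x - r₁ * y| = |r₁ - c|) (h₂ : |x - r₂ * y| = |r₂ - c|)
    (h₃ : |x - r₃ * y| = |r₃ - c|) : |y| = 1 := by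
  have key : ∀ r s : ℝ, r ≠ s → ((x - r * y = r - c ∧ x - s * y = s - c) ∨
      (x - r * y = -(r - c) ∧ x - s * y = -(s - c))) → |y| = 1 := by
    rintro r s hrs (⟨h, h'⟩ | ⟨h, h'⟩)
    · have : y = -1 := by
        apply mul_left_cancel₀ (sub_ne_zero.2 hrs)
        linear_combination h' - h
      rw [this, abs_neg, abs_one]
    · have : y = 1 := by
        apply mul_left_cancel₀ (sub_ne_zero.2 hrs)
        linear_combination h' - h
      rw [this, abs_one]
  rcases abs_eq_abs.1 h₁ with e₁ | e₁ <;> rcases abs_eq_abs.1 h₂ with e₂ | e₂ <;>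
    rcases abs_eq_abs.1 h₃ with e₃ | e₃
  · exact key _ _ h₁₂ (Or.inl ⟨e₁, e₂⟩)
  · exact key _ _ h₁₂ (Or.inl ⟨e₁, e₂⟩)
  · exact key _ _ h₁₃ (Or.inl ⟨e₁, e₃⟩)
  · exact key _ _ h₂₃ (Or.inr ⟨e₂, e₃⟩)
  · exact key _ _ h₂₃ (Or.inl ⟨e₂, e₃⟩)
  · exact key _ _ h₁₃ (Or.inr ⟨e₁, e₃⟩)
  · exact key _ _ h₁₂ (Or.inr ⟨e₁, e₂⟩)
  · exact key _ _ h₁₂ (Or.inr ⟨e₁, e₂⟩)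

end ShiftedRoots

theorem abs_log_sub_log_le {r w η : ℝ} (hw : w ≠ 0) (hη : η ≤ 1 / 2) (h : |r - w| ≤ η * |w|) :
    |log r - log w| ≤ 2 * η := by
  have := abs_log_abs_sub_le hw hη h
  rwa [log_abs, log_abs] at this

namespace ShiftedRoots

variable {c₁ c₂ c₃ : ℤ} {r₁ r₂ r₃ : ℝ}

theorem abs_log_sub_const_le {c d r M : ℝ} (hM : 10 ≤ M) (hr : |r - c| ≤ 2 / M ^ 2)
    (hcd : M ≤ |c - d|) : |log (r - d) - log (c - d)| ≤ 4 * (1 / M ^ 3) := by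
  have h0 : 0 < |c - d| := by linarith
  have h1 : 2 * (1 / M ^ 3) ≤ 1 / 2 := by
    have : (10 : ℝ) ^ 3 ≤ M ^ 3 := by gcongr
    rw [mul_one_div, div_le_div_iff₀ (by positivity) (by norm_num)]
    linarith
  have := abs_log_sub_log_le (r := r - d) (abs_pos.1 h0) h1 (by
    rw [sub_sub_sub_cancel_right]
    refine hr.trans ?_
    calc 2 / M ^ 2 = 2 * (1 / M ^ 3) * M := by field_simp
      _ ≤ _ := by gcongr)
  linarith

theorem abs_sub_mul_le {b₁ b₂ b₃ M : ℝ} (hM : 10 ≤ M) (hb : |b₁ * b₂ * b₃| = 1)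
    (h₁ : M - 1 ≤ |b₁|) (h₂ : M - 1 ≤ |b₂|) : |b₃| ≤ 2 / M ^ 2 := by
  rw [le_div_iff₀ (by positivity)]
  rw [abs_mul, abs_mul] at hb
  have : (M - 1) * (M - 1) ≤ |b₁| * |b₂| := by gcongr; linarith
  have h3 : M ^ 2 ≤ 2 * (|b₁| * |b₂|) := by nlinarith
  have := mul_le_mul_of_nonneg_left h3 (abs_nonneg b₃)
  linarith

theorem abs_log_linear_le {x y c c' r r' M : ℝ} (hM : 10 ≤ M) (hy : 2 ≤ |y|)
    (hr : |r - c| ≤ 2 / M ^ 2) (hr' : |r' - c'| ≤ 2 / M ^ 2) (hx : |x - r' * y| ≤ 2 / M ^ 2)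
    (hcc : M ≤ |c - c'|) :
    |log (x - r * y) - (log |y| + log (c - c'))| ≤ 10 * (1 / M ^ 3) := by
  have h0 : 0 < |c - c'| := by linarith
  have hy0 : 0 < |y| := by linarith
  have h1 : 5 * (1 / M ^ 3) ≤ 1 / 2 := by
    have : (10 : ℝ) ^ 3 ≤ M ^ 3 := by gcongr
    rw [mul_one_div, div_le_div_iff₀ (by positivity) (by norm_num)]
    linarith
  have := abs_log_sub_log_le (r := x - r * y) (w := y * (c' - c))
    (mul_ne_zero (abs_pos.1 hy0) (by rw [← neg_sub, neg_ne_zero]; exact abs_pos.1 h0)) h1 (by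
    rw [show x - r * y - y * (c' - c) = (x - r' * y) + (r' - c') * y - (r - c) * y by ring, abs_mul,
      abs_sub_comm c' c]
    calc _ ≤ |x - r' * y| + |(r' - c') * y| + |(r - c) * y| :=
          (abs_sub _ _).trans (by gcongr; exact abs_add_le _ _)
      _ ≤ 2 / M ^ 2 + 2 / M ^ 2 * |y| + 2 / M ^ 2 * |y| := by
        rw [abs_mul, abs_mul]; gcongr
      _ ≤ 5 * (1 / M ^ 2) * |y| := by
        have : 0 < 1 / M ^ 2 := by positivity
        rw [show (2 : ℝ) / M ^ 2 = 2 * (1 / M ^ 2) by ring]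
        nlinarith
      _ = 5 * (1 / M ^ 3) * (|y| * M) := by field_simp
      _ ≤ _ := by gcongr)
  rw [log_mul (abs_pos.1 hy0) (by rw [← neg_sub, neg_ne_zero]; exact abs_pos.1 h0),
    ← neg_sub c c', log_neg_eq_log] at this
  rw [log_abs]
  linarith

theorem abs_form_le {a b I L ε V₁ W₁ U₂ W₂ B₁ B₂ D₁₂ D₁₃ D₂₃ : ℝ} (hI : 0 ≤ I) (hL : 0 ≤ L)
    (hε0 : 0 < ε) (hε : ε ≤ 1 / 1000) (D12 : 11 ≤ D₁₂) (D13 : 11 ≤ D₁₃) (D23 : 11 ≤ D₂₃)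
    (v1 : |V₁ - D₁₂| ≤ 4 * ε) (w1 : |W₁ - D₁₃| ≤ 4 * ε) (u2 : |U₂ - D₁₂| ≤ 4 * ε)
    (w2 : |W₂ - D₂₃| ≤ 4 * ε) (b1 : |B₁ - (L + D₁₃)| ≤ 10 * ε) (b2 : |B₂ - (L + D₂₃)| ≤ 10 * ε)
    (e1 : I * B₁ = a * (-V₁ - W₁) + b * V₁) (e2 : I * B₂ = a * U₂ + b * (-U₂ - W₂)) :
    |a| ≤ I * (L + 2) ∧ |b| ≤ I * (L + 2) ∧
      |(a + I) * D₁₃ - (b + I) * D₂₃ + 2 * (a + I - (b + I)) * D₁₂| ≤ I * (L + 3) * (104 * ε) := by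
  have habI : |a| ≤ I * (L + 2) ∧ |b| ≤ I * (L + 2) := by
    have key : ∀ a b B D V W : ℝ, 11 ≤ D → |W - D| ≤ 4 * ε → |B - (L + D)| ≤ 10 * ε → 0 ≤ V →
        I * B = a * (-V - W) + b * V → |b| ≤ |a| → |a| ≤ I * (L + 2) := by
      intro a b B D V W hD hW hB hV he hba
      have hB' : |B| ≤ L + D + 1 := by
        have k1 := abs_le.1 hB
        rw [abs_le]; constructor <;> linarith
      have hW' := (abs_le.1 hW).1
      have k1 : |a| * (V + W) ≤ |b| * V + I * |B| := by
        have : |a * (V + W)| ≤ |b * V| + |I * B| := by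
          rw [show a * (V + W) = b * V - I * B by linarith]
          exact abs_sub _ _
        rwa [abs_mul, abs_mul, abs_mul, abs_of_nonneg hV, abs_of_pos (show 0 < V + W by linarith),
          abs_of_nonneg hI] at this
      have k2 : |b| * V ≤ |a| * V := by gcongr
      have k3 : |a| * W ≤ I * (L + D + 1) := by
        have : (I : ℝ) * |B| ≤ I * (L + D + 1) := by gcongr
        linarith
      have k4 : L + D + 1 ≤ (L + 2) * W := by nlinarith
      have k5 : |a| * W ≤ I * (L + 2) * W := by
        rw [mul_assoc]
        exact k3.trans (by gcongr)
      exact le_of_mul_le_mul_right k5 (by linarith)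
    have hV : 0 ≤ V₁ := by linarith [(abs_le.1 v1).1]
    have hU : 0 ≤ U₂ := by linarith [(abs_le.1 u2).1]
    rcases le_total |b| |a| with hba | hba
    · have := key a b B₁ D₁₃ V₁ W₁ D13 w1 b1 hV e1 hba
      exact ⟨this, hba.trans this⟩
    · have := key b a B₂ D₂₃ U₂ W₂ D23 w2 b2 hU (by linarith) hba
      exact ⟨hba.trans this, this⟩
  obtain ⟨haI, hbI⟩ := habI
  refine ⟨haI, hbI, ?_⟩
  have e : (a + I) * D₁₃ - (b + I) * D₂₃ + 2 * (a + I - (b + I)) * D₁₂ =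
      I * ((B₂ - (L + D₂₃)) - (B₁ - (L + D₁₃))) - a * ((V₁ - D₁₂) + (W₁ - D₁₃) + (U₂ - D₁₂)) +
        b * ((V₁ - D₁₂) + (U₂ - D₁₂) + (W₂ - D₂₃)) := by
    linear_combination e1 - e2
  have t1 : |(B₂ - (L + D₂₃)) - (B₁ - (L + D₁₃))| ≤ 20 * ε := by
    have := abs_sub (B₂ - (L + D₂₃)) (B₁ - (L + D₁₃))
    linarith
  have t2 : |(V₁ - D₁₂) + (W₁ - D₁₃) + (U₂ - D₁₂)| ≤ 12 * ε := by
    have := abs_add_three (V₁ - D₁₂) (W₁ - D₁₃) (U₂ - D₁₂)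
    linarith
  have t3 : |(V₁ - D₁₂) + (U₂ - D₁₂) + (W₂ - D₂₃)| ≤ 12 * ε := by
    have := abs_add_three (V₁ - D₁₂) (U₂ - D₁₂) (W₂ - D₂₃)
    linarith
  rw [e]
  calc _ ≤ |I * ((B₂ - (L + D₂₃)) - (B₁ - (L + D₁₃)))| +
        |a * ((V₁ - D₁₂) + (W₁ - D₁₃) + (U₂ - D₁₂))| +
        |b * ((V₁ - D₁₂) + (U₂ - D₁₂) + (W₂ - D₂₃))| :=
        (abs_add_le _ _).trans (by gcongr; exact abs_sub _ _)
    _ ≤ I * (20 * ε) + I * (L + 2) * (12 * ε) + I * (L + 2) * (12 * ε) := by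
      rw [abs_mul, abs_mul, abs_mul, abs_of_nonneg hI]
      gcongr
    _ ≤ I * (L + 3) * (104 * ε) := by
      have : 0 ≤ I * ε := by positivity
      nlinarith [mul_nonneg this hL]

set_option maxHeartbeats 1000000 in
/-- A nontrivial solution of the Thue equation produces a small linear form in the logarithms of
the differences `c₁ - c₂`, `c₁ - c₃`, `c₂ - c₃`. -/
theorem exists_small_linear_form (h : ShiftedRoots c₁ c₂ c₃ r₁ r₂ r₃) {M G : ℝ} {N : ℕ}
    (hM : exp 11 ≤ M) (h₁ : |r₁ - c₁| ≤ 2 / M ^ 2) (h₂ : |r₂ - c₂| ≤ 2 / M ^ 2)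
    (h₃ : |r₃ - c₃| ≤ 2 / M ^ 2) (h₁₂ : M ≤ |(c₁ - c₂ : ℝ)|) (h₁₃ : M ≤ |(c₁ - c₃ : ℝ)|)
    (h₂₃ : M ≤ |(c₂ - c₃ : ℝ)|) (g₁₂ : log (c₁ - c₂) ≤ G) (g₁₃ : log (c₁ - c₃) ≤ G)
    (g₂₃ : log (c₂ - c₃) ≤ G) (hN : 1 ≤ N) (hG : 3 * (G + 1) / N ≤ 7 / 50) {x y : ℤ}
    (hxy : |((x - c₁ * y) * (x - c₂ * y) * (x - c₃ * y) - y ^ 3 : ℝ)| = 1) (hy : 2 ≤ |(y : ℝ)|)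
    (hx₁ : |x - r₃ * y| ≤ |x - r₁ * y|) (hx₂ : |x - r₃ * y| ≤ |x - r₂ * y|) :
    ∃ p q : ℤ, (p ≠ 0 ∨ q ≠ 0) ∧ |(p : ℝ)| ≤ N ^ 2 * (log |(y : ℝ)| + 3) ∧
      |(q : ℝ)| ≤ N ^ 2 * (log |(y : ℝ)| + 3) ∧
      |p * log (c₁ - c₃) - q * log (c₂ - c₃) + 2 * (p - q) * log (c₁ - c₂)| ≤
        N ^ 2 * (log |(y : ℝ)| + 3) * (104 / M ^ 3) := by
  have hM10 : 10 ≤ M := by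
    have := add_one_le_exp (11 : ℝ)
    linarith
  have hMlog : ∀ z : ℝ, M ≤ |z| → 11 ≤ log z := by
    intro z hz
    rw [← log_abs, le_log_iff_exp_le (by linarith)]
    linarith
  have hε : 1 / M ^ 3 ≤ 1 / 1000 := by
    have : (10 : ℝ) ^ 3 ≤ M ^ 3 := by gcongr
    exact one_div_le_one_div_of_le (by norm_num) (by linarith)
  have hε0 : 0 < 1 / M ^ 3 := by positivity
  have hε2 : 2 / M ^ 2 ≤ 1 / 4 := by
    rw [div_le_div_iff₀ (by positivity) (by norm_num)]
    nlinarith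
  have hsep : ∀ {r c r' c' : ℝ}, |r - c| ≤ 2 / M ^ 2 → |r' - c'| ≤ 2 / M ^ 2 → M ≤ |c - c'| →
      M - 1 ≤ |r - r'| := by
    intro r c r' c' k1 k2 k3
    have : |c - c'| ≤ |r - r'| + |r - c| + |r' - c'| := by
      rw [show c - c' = (r - r') - (r - c) + (r' - c') by ring]
      exact (abs_add_le _ _).trans (by gcongr; exact abs_sub _ _)
    linarith
  have n₁₂ : r₁ ≠ r₂ := by
    intro e; have := hsep h₁ h₂ h₁₂; simp [e] at this; linarith
  have n₁₃ : r₁ ≠ r₃ := by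
    intro e; have := hsep h₁ h₃ h₁₃; simp [e] at this; linarith
  have n₂₃ : r₂ ≠ r₃ := by
    intro e; have := hsep h₂ h₃ h₂₃; simp [e] at this; linarith
  have hfar : ∀ {r : ℝ}, M - 1 ≤ |r - r₃| → |x - r₃ * y| ≤ |x - r * y| → M - 1 ≤ |x - r * y| := by
    intro r k1 k2
    have k3 : |(r - r₃) * y| ≤ |x - r₃ * y| + |x - r * y| := by
      rw [show (r - r₃) * y = (x - r₃ * y) - (x - r * y) by ring]
      exact abs_sub _ _
    rw [abs_mul] at k3
    have : (M - 1) * 2 ≤ |r - r₃| * |(y : ℝ)| := by gcongr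
    linarith
  have hprod := h.prod_sub_mul x y
  have hx₃ : |x - r₃ * y| ≤ 2 / M ^ 2 := abs_sub_mul_le hM10 (by rw [hprod]; exact hxy)
    (hfar (hsep h₁ h₃ h₁₃) hx₁) (hfar (hsep h₂ h₃ h₂₃) hx₂)
  have hlogu : ∀ r : ℝ, (r - c₁) * (r - c₂) * (r - c₃) = 1 →
      log (r - c₁) + log (r - c₂) + log (r - c₃) = 0 := by
    intro r hr
    have n1 : r - c₁ ≠ 0 := by intro h0; simp [h0] at hr
    have n2 : r - c₂ ≠ 0 := by intro h0; simp [h0] at hr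
    have n3 : r - c₃ ≠ 0 := by intro h0; simp [h0] at hr
    rw [← log_mul, ← log_mul, hr, log_one] <;> simp [n1, n2, n3]
  have s1 := hlogu r₁ h.root₁
  have s2 := hlogu r₂ h.root₂
  have s3 := hlogu r₃ h.root₃
  have v1 := abs_log_sub_const_le hM10 h₁ h₁₂
  have w1 := abs_log_sub_const_le hM10 h₁ h₁₃
  have u2 := abs_log_sub_const_le (d := c₁) hM10 h₂ (by rwa [abs_sub_comm])
  have w2 := abs_log_sub_const_le hM10 h₂ h₂₃
  have u3 := abs_log_sub_const_le (d := c₁) hM10 h₃ (by rwa [abs_sub_comm])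
  have v3 := abs_log_sub_const_le (d := c₂) hM10 h₃ (by rwa [abs_sub_comm])
  have b1 := abs_log_linear_le hM10 hy h₁ h₃ hx₃ h₁₃
  have b2 := abs_log_linear_le hM10 hy h₂ h₃ hx₃ h₂₃
  have sym : ∀ a b : ℝ, log (a - b) = log (b - a) := by
    intro a b; rw [← neg_sub, log_neg_eq_log]
  rw [sym c₂ c₁] at u2
  rw [sym c₃ c₁] at u3
  rw [sym c₃ c₂] at v3
  have D12 := hMlog _ h₁₂
  have D13 := hMlog _ h₁₃
  have D23 := hMlog _ h₂₃
  have hL : 0 ≤ log |(y : ℝ)| := log_nonneg (by linarith)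
  generalize hεdef : 1 / M ^ 3 = ε at *
  have hε4 : 104 / M ^ 3 = 104 * ε := by rw [← hεdef]; ring
  rw [hε4]
  obtain ⟨I, hI, hIN, a, b, e1, e2, e3⟩ := h.exists_log_relation (x := x) (y := y) hxy hN hG
    (by
      have p1 : 0 < log (r₁ - c₂) := by linarith [(abs_le.1 v1).1]
      have p2 : 0 < log (r₁ - c₃) := by linarith [(abs_le.1 w1).1]
      have p3 : 0 < log (r₂ - c₁) := by linarith [(abs_le.1 u2).1]
      have p4 : 0 < log (r₂ - c₃) := by linarith [(abs_le.1 w2).1]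
      rw [show log (r₁ - c₁) = -log (r₁ - c₂) - log (r₁ - c₃) by linarith,
        show log (r₂ - c₂) = -log (r₂ - c₁) - log (r₂ - c₃) by linarith]
      have := mul_pos p1 p4
      have := mul_pos p2 p3
      have := mul_pos p2 p4
      nlinarith)
    (by
      rw [show log (r₁ - c₁) = -(log (r₁ - c₂) + log (r₁ - c₃)) by linarith, abs_neg,
        abs_of_pos (by linarith [(abs_le.1 v1).1, (abs_le.1 w1).1]),
        abs_of_pos (by linarith [(abs_le.1 v1).1])]
      linarith [(abs_le.1 v1).2, (abs_le.1 w1).2])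
    (by
      rw [show log (r₂ - c₂) = -(log (r₂ - c₁) + log (r₂ - c₃)) by linarith, abs_neg,
        abs_of_pos (by linarith [(abs_le.1 u2).1]),
        abs_of_pos (by linarith [(abs_le.1 u2).1, (abs_le.1 w2).1])]
      linarith [(abs_le.1 u2).2, (abs_le.1 w2).2])
    (by
      rw [abs_of_pos (by linarith [(abs_le.1 u3).1]), abs_of_pos (by linarith [(abs_le.1 v3).1])]
      linarith [(abs_le.1 u3).2, (abs_le.1 v3).2])
  have hI1 : (1 : ℝ) ≤ I := by exact_mod_cast hI
  have hIN' : (I : ℝ) ≤ N ^ 2 := by exact_mod_cast hIN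
  have hnon : a + I ≠ 0 ∨ b + I ≠ 0 := by
    by_contra! hab
    have ha : (a : ℝ) = -I := by exact_mod_cast eq_neg_of_add_eq_zero_left hab.1
    have hb : (b : ℝ) = -I := by exact_mod_cast eq_neg_of_add_eq_zero_left hab.2
    have habs : ∀ r : ℝ, (r - c₁) * (r - c₂) * (r - c₃) = 1 → x - r * y ≠ 0 →
        I * log (x - r * y) = a * log (r - c₁) + b * log (r - c₂) → |x - r * y| = |r - c₃| := by
      intro r hr hx he
      have n3 : r - c₃ ≠ 0 := by intro h0; simp [h0] at hr
      have hl : log (x - r * y) = log (r - c₃) := by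
        have hI0 : (I : ℝ) ≠ 0 := by linarith
        apply mul_left_cancel₀ hI0
        rw [he, ha, hb]
        linear_combination (-(I : ℝ)) * hlogu r hr
      rw [← log_abs, ← log_abs (r - c₃)] at hl
      exact log_injOn_pos (abs_pos.2 hx) (abs_pos.2 n3) hl
    have nx : ∀ b₁ b₂ b₃ : ℝ, |b₁ * b₂ * b₃| = 1 → b₁ ≠ 0 ∧ b₂ ≠ 0 ∧ b₃ ≠ 0 := by
      intro b₁ b₂ b₃ hb
      refine ⟨?_, ?_, ?_⟩ <;> rintro rfl <;> simp at hb
    obtain ⟨nx1, nx2, nx3⟩ := nx _ _ _ (hprod ▸ hxy)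
    have := abs_eq_one_of_abs_eq n₁₂ n₁₃ n₂₃ (habs r₁ h.root₁ nx1 e1) (habs r₂ h.root₂ nx2 e2)
      (habs r₃ h.root₃ nx3 e3)
    linarith
  rw [show log (r₁ - c₁) = -log (r₁ - c₂) - log (r₁ - c₃) by linarith] at e1
  rw [show log (r₂ - c₂) = -log (r₂ - c₁) - log (r₂ - c₃) by linarith] at e2
  obtain ⟨haI, hbI, hform⟩ := abs_form_le (by linarith) hL hε0 hε D12 D13 D23 v1 w1 u2 w2 b1 b2 e1 e2
  have hL3 : (I : ℝ) * (log |(y : ℝ)| + 3) ≤ N ^ 2 * (log |(y : ℝ)| + 3) := by gcongr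
  refine ⟨a + I, b + I, hnon, ?_, ?_, ?_⟩
  · push_cast
    have := abs_add_le (a : ℝ) I
    rw [Nat.abs_cast] at this
    linarith
  · push_cast
    have := abs_add_le (b : ℝ) I
    rw [Nat.abs_cast] at this
    linarith
  · push_cast
    exact hform.trans (mul_le_mul_of_nonneg_right hL3 (by linarith))

end ShiftedRoots

namespace ShiftedRoots

theorem exists_root_near {c₁ c₂ c₃ : ℤ} {M : ℝ} (hM : 10 ≤ M) (h₁₂ : M ≤ |(c₁ - c₂ : ℝ)|)
    (h₁₃ : M ≤ |(c₁ - c₃ : ℝ)|) :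
    ∃ r : ℝ, |r - c₁| ≤ 2 / M ^ 2 ∧ (r - c₁) * (r - c₂) * (r - c₃) = 1 := by
  obtain ⟨t, ht, h⟩ := exists_small_root hM h₁₂ h₁₃
  refine ⟨c₁ + t, by simpa using ht, ?_⟩
  rw [← h]
  ring

/-- Version of `exists_small_linear_form` in which the logarithms of the differences are replaced
by approximations. -/
theorem exists_small_approx_form {c₁ c₂ c₃ : ℤ} {r₁ r₂ r₃ M K E δ₁₂ δ₁₃ δ₂₃ : ℝ} {n : ℕ}
    (hn : 1 ≤ n) (hM : exp 11 ≤ M) (hE : E ≤ 1 / 6) (hME : 104 / M ^ 3 ≤ E)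
    (hr₁ : (r₁ - c₁) * (r₁ - c₂) * (r₁ - c₃) = 1) (hr₂ : (r₂ - c₁) * (r₂ - c₂) * (r₂ - c₃) = 1)
    (hr₃ : (r₃ - c₁) * (r₃ - c₂) * (r₃ - c₃) = 1) (h₁ : |r₁ - c₁| ≤ 2 / M ^ 2)
    (h₂ : |r₂ - c₂| ≤ 2 / M ^ 2) (h₃ : |r₃ - c₃| ≤ 2 / M ^ 2) (h₁₂ : M ≤ |(c₁ - c₂ : ℝ)|)
    (h₁₃ : M ≤ |(c₁ - c₃ : ℝ)|) (h₂₃ : M ≤ |(c₂ - c₃ : ℝ)|)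
    (d₁₂ : |log (c₁ - c₂) - δ₁₂| ≤ 6 * E) (d₁₃ : |log (c₁ - c₃) - δ₁₃| ≤ 6 * E)
    (d₂₃ : |log (c₂ - c₃) - δ₂₃| ≤ 6 * E) (k₁₂ : δ₁₂ ≤ K) (k₁₃ : δ₁₃ ≤ K) (k₂₃ : δ₂₃ ≤ K)
    (hK : 3 * (K + 2) ≤ 2.1 * n) {x y : ℤ}
    (hxy : |((x - c₁ * y) * (x - c₂ * y) * (x - c₃ * y) - y ^ 3 : ℝ)| = 1) (hy : 2 ≤ |(y : ℝ)|)
    (hx₁ : |x - r₃ * y| ≤ |x - r₁ * y|) (hx₂ : |x - r₃ * y| ≤ |x - r₂ * y|) :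
    ∃ p q : ℤ, (p ≠ 0 ∨ q ≠ 0) ∧ |(p : ℝ)| ≤ 225 * n ^ 2 * (log |(y : ℝ)| + 3) ∧
      |(q : ℝ)| ≤ 225 * n ^ 2 * (log |(y : ℝ)| + 3) ∧
      |p * δ₁₃ - q * δ₂₃ + 2 * (p - q) * δ₁₂| ≤ 37 * (225 * n ^ 2 * (log |(y : ℝ)| + 3)) * E := by
  have hM10 : 10 ≤ M := by
    have := add_one_le_exp (11 : ℝ)
    linarith
  have hε2 : 2 / M ^ 2 ≤ 1 / 4 := by
    rw [div_le_div_iff₀ (by positivity) (by norm_num)]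
    nlinarith
  have hne : ∀ {r c r' c' : ℝ}, |r - c| ≤ 2 / M ^ 2 → |r' - c'| ≤ 2 / M ^ 2 → M ≤ |c - c'| →
      r ≠ r' := by
    rintro r c r' c' k1 k2 k3 rfl
    have : |c - c'| ≤ |r - c| + |r - c'| := by
      rw [show c - c' = (r - c') - (r - c) by ring, add_comm]
      exact abs_sub _ _
    linarith
  have hS : ShiftedRoots c₁ c₂ c₃ r₁ r₂ r₃ :=
    of_root hr₁ hr₂ hr₃ (hne h₁ h₂ h₁₂) (hne h₁ h₃ h₁₃) (hne h₂ h₃ h₂₃)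
  have hn0 : (0 : ℝ) < n := by exact_mod_cast hn
  obtain ⟨p, q, hpq, hp, hq, hΛ⟩ := hS.exists_small_linear_form (G := K + 1) (N := 15 * n) hM h₁ h₂
    h₃ h₁₂ h₁₃ h₂₃ (by linarith [(abs_le.1 d₁₂).2]) (by linarith [(abs_le.1 d₁₃).2])
    (by linarith [(abs_le.1 d₂₃).2]) (by omega) (by
      push_cast
      rw [div_le_div_iff₀ (by positivity) (by norm_num)]
      linarith) hxy hy hx₁ hx₂
  have e15 : (((15 * n : ℕ) : ℝ)) ^ 2 * (log |(y : ℝ)| + 3) =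
      225 * n ^ 2 * (log |(y : ℝ)| + 3) := by push_cast; ring
  rw [e15] at hp hq hΛ
  have hH0 := (abs_nonneg _).trans hp
  generalize 225 * (n : ℝ) ^ 2 * (log |(y : ℝ)| + 3) = H at *
  refine ⟨p, q, hpq, hp, hq, ?_⟩
  generalize log ((c₁ : ℝ) - c₂) = D₁₂ at *
  generalize log ((c₁ : ℝ) - c₃) = D₁₃ at *
  generalize log ((c₂ : ℝ) - c₃) = D₂₃ at *
  have hpq' : |(p - q : ℝ)| ≤ 2 * H := by
    have := abs_sub (p : ℝ) q
    linarith
  have e : p * δ₁₃ - q * δ₂₃ + 2 * (p - q) * δ₁₂ = (p * D₁₃ - q * D₂₃ + 2 * (p - q) * D₁₂) -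
      (p * (D₁₃ - δ₁₃) - q * (D₂₃ - δ₂₃) + 2 * ((p - q) * (D₁₂ - δ₁₂))) := by ring
  have t1 : |p * (D₁₃ - δ₁₃)| ≤ H * (6 * E) := by rw [abs_mul]; gcongr
  have t2 : |q * (D₂₃ - δ₂₃)| ≤ H * (6 * E) := by rw [abs_mul]; gcongr
  have t3 : |(p - q) * (D₁₂ - δ₁₂)| ≤ 2 * H * (6 * E) := by rw [abs_mul]; gcongr
  have t4 : H * (104 / M ^ 3) ≤ H * E := by gcongr
  rw [abs_le] at *
  rw [e]
  constructor <;> linarith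

end ShiftedRoots

theorem fib_le_two_mul_fib_pred {n : ℕ} (hn : 2 ≤ n) : Nat.fib n ≤ 2 * Nat.fib (n - 1) := by
  obtain ⟨m, rfl⟩ := Nat.exists_eq_add_of_le' hn
  rw [Nat.fib_add_two, show m + 2 - 1 = m + 1 by omega]
  have := Nat.fib_le_fib_succ (n := m)
  omega

theorem abs_goldenConj_pow (n : ℕ) :
    |goldenConj ^ n| = goldenRatio ^ n * exp (-(2 * n * log goldenRatio)) := by
  have h1 : |goldenConj| = goldenRatio⁻¹ := by
    rw [inv_goldenRatio, abs_of_neg goldenConj_neg]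
  have h2 : goldenRatio = exp (log goldenRatio) := (exp_log goldenRatio_pos).symm
  rw [abs_pow, h1]
  nth_rewrite 1 [h2]
  nth_rewrite 2 [h2]
  rw [← exp_neg, ← exp_nat_mul, ← exp_nat_mul, ← exp_add]
  ring_nf

theorem abs_log_fib_sub_le {n : ℕ} {E : ℝ} (hE : E = exp (-(2 * n * log goldenRatio)))
    (hE2 : E ≤ 1 / 2) : |log (Nat.fib n) - (n * log goldenRatio - log √5)| ≤ 2 * E := by
  have hw : 0 < goldenRatio ^ n / √5 := by have := goldenRatio_pos; positivity
  have := abs_log_sub_log_le (r := Nat.fib n) hw.ne' hE2 (by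
    rw [coe_fib_eq, ← sub_div, sub_sub_cancel_left, abs_div, abs_neg, abs_goldenConj_pow, ← hE,
      abs_of_pos hw, abs_of_pos (by positivity : (0 : ℝ) < √5)]
    exact le_of_eq (by ring))
  rwa [log_div (pow_pos goldenRatio_pos n).ne' (by positivity), log_pow] at this

theorem lucas_succ (n : ℕ) : lucas (n + 1) = Nat.fib (n + 1) + 2 * Nat.fib n := by
  suffices h : lucas (n + 1) = Nat.fib (n + 1) + 2 * Nat.fib n ∧
      lucas (n + 2) = Nat.fib (n + 2) + 2 * Nat.fib (n + 1) from h.1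
  induction n with
  | zero => simp [lucas]
  | succ n ih =>
    refine ⟨ih.2, ?_⟩
    rw [lucas, ih.1, ih.2, Nat.fib_add_two (n := n + 1), Nat.fib_add_two (n := n)]
    push_cast
    ring

theorem lucas_sub_fib {n : ℕ} (hn : 1 ≤ n) : lucas n - Nat.fib n = 2 * Nat.fib (n - 1) := by
  obtain ⟨m, rfl⟩ := Nat.exists_eq_add_of_le' hn
  rw [lucas_succ, Nat.add_sub_cancel]
  ring

theorem coe_lucas_eq (n : ℕ) : (lucas n : ℝ) = goldenRatio ^ n + goldenConj ^ n := by
  suffices h : (lucas n : ℝ) = goldenRatio ^ n + goldenConj ^ n ∧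
      (lucas (n + 1) : ℝ) = goldenRatio ^ (n + 1) + goldenConj ^ (n + 1) from h.1
  induction n with
  | zero => norm_num [lucas, goldenRatio_add_goldenConj]
  | succ n ih =>
    refine ⟨ih.2, ?_⟩
    rw [lucas, Int.cast_add, ih.1, ih.2]
    linear_combination -goldenRatio ^ n * goldenRatio_sq - goldenConj ^ n * goldenConj_sq

theorem abs_log_lucas_sub_le {n : ℕ} {E : ℝ} (hE : E = exp (-(2 * n * log goldenRatio)))
    (hE2 : E ≤ 1 / 2) : |log (lucas n) - n * log goldenRatio| ≤ 2 * E := by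
  have hw : 0 < goldenRatio ^ n := by have := goldenRatio_pos; positivity
  have := abs_log_sub_log_le (r := lucas n) hw.ne' hE2 (by
    rw [coe_lucas_eq, add_sub_cancel_left, abs_goldenConj_pow, ← hE, abs_of_pos hw, mul_comm])
  rwa [log_pow] at this

theorem exp_le_fib {n : ℕ} (hn : exp (-(2 * n * log goldenRatio)) ≤ 1 / 4) :
    exp (n * log goldenRatio) / 3 ≤ Nat.fib n := by
  have e : exp (n * log goldenRatio) = goldenRatio ^ n := by
    rw [exp_nat_mul, exp_log goldenRatio_pos]
  have hw : 0 < goldenRatio ^ n := by have := goldenRatio_pos; positivity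
  rw [e, coe_fib_eq]
  have h1 := le_abs_self (goldenConj ^ n)
  rw [abs_goldenConj_pow] at h1
  have h2 : goldenRatio ^ n * exp (-(2 * n * log goldenRatio)) ≤ goldenRatio ^ n * (1 / 4) := by
    gcongr
  have h5 : √5 ≤ 9 / 4 := by rw [sqrt_le_left (by norm_num)]; norm_num
  rw [div_le_div_iff₀ (by norm_num) (by positivity)]
  generalize goldenRatio ^ n = w at *
  nlinarith

/-- If the logarithmic form is smaller than the lower bound of Baker type allows, the coefficient
of `log 2` vanishes. -/
theorem eq_zero_of_abs_linear_form_le {b₁ b₂ b₃ : ℤ} {X R : ℝ} (hX : 30 ≤ X)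
    (hR : 11500000000000 * X < R) (h₁ : |(b₁ : ℝ)| ≤ exp (3 * X)) (h₂ : |(b₂ : ℝ)| ≤ exp (3 * X))
    (h₃ : |(b₃ : ℝ)| ≤ exp (3 * X))
    (h : |b₁ * log goldenRatio + b₂ * log √5 + b₃ * log 2| ≤ exp (3 * X) * exp (-R)) : b₃ = 0 := by
  by_contra hb₃
  have hk := Nat.le_ceil ((3 * X + 18.03) / 12)
  have hk' := Nat.ceil_lt_add_one (show 0 ≤ (3 * X + 18.03) / 12 by linarith)
  generalize ⌈(3 * X + 18.03) / 12⌉₊ = k at *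
  have hk1 : 1 ≤ k := by
    have : (0 : ℝ) < k := by linarith
    exact_mod_cast this
  have hB : 2 ^ 26 * exp (3 * X) ≤ exp (12 * k) := by
    have h2 : (2 : ℝ) ^ 26 ≤ exp 18.03 := by
      rw [← exp_log (show (0 : ℝ) < 2 by norm_num), ← exp_nat_mul, exp_le_exp]
      have := log_two_lt_d9
      push_cast
      linarith
    calc _ ≤ exp 18.03 * exp (3 * X) := by gcongr
      _ ≤ _ := by rw [← exp_add, exp_le_exp]; linarith
  have := (exp_neg_le_abs_linear_form hk1 hb₃ h₁ h₂ h₃ hB).trans h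
  rw [← exp_add, exp_le_exp] at this
  norm_num at this hR
  linarith

theorem log_goldenRatio_bounds : 0.47 ≤ log goldenRatio ∧ log goldenRatio ≤ 0.5 := by
  have h5 : 2.236 ≤ √5 := le_sqrt_of_sq_le (by norm_num)
  have hφ : 1.618 ≤ goldenRatio := by
    rw [goldenRatio, le_div_iff₀ (by norm_num)]
    linarith
  have hpos := goldenRatio_pos
  have hsq := goldenRatio_sq
  generalize goldenRatio = φ at *
  constructor
  · rw [le_log_iff_exp_le hpos]
    refine le_trans ?_ hφ
    have h1 : exp 0.47 ^ 100 = exp 1 ^ 47 := by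
      rw [← exp_nat_mul, ← exp_nat_mul]; norm_num
    refine le_of_pow_le_pow_left₀ (n := 100) (by norm_num) (by norm_num) ?_
    rw [h1]
    calc exp 1 ^ 47 ≤ 2.7182818286 ^ 47 := by
          have := exp_one_lt_d9
          gcongr
      _ ≤ _ := by norm_num
  · have h1 : φ ^ 2 ≤ exp 1 := by
      have := exp_one_gt_d9
      nlinarith
    have := log_le_log (by positivity) h1
    rw [log_pow, log_exp] at this
    push_cast at this
    linarith

theorem log_sqrt_five_bounds : 0.8 ≤ log √5 ∧ log √5 ≤ 1 := by
  rw [log_sqrt (by norm_num)]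
  constructor
  · have h : exp 1 ^ 8 ≤ 5 ^ 5 := by
      calc exp 1 ^ 8 ≤ 2.7182818286 ^ 8 := by
            have := exp_one_lt_d9
            gcongr
        _ ≤ _ := by norm_num
    have := log_le_log (by positivity) h
    rw [log_pow, log_pow, log_exp] at this
    push_cast at this
    linarith
  · have h : (5 : ℝ) ≤ exp 1 ^ 2 := by
      have := exp_one_gt_d9
      nlinarith
    have := log_le_log (by positivity) h
    rw [log_pow, log_exp] at this
    push_cast at this
    linarith

theorem le_Cconst : 11500000000000 ≤ Cconst := by
  have h12 : 2.4 ≤ log 12 := by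
    have h : exp 1 ^ 12 ≤ 12 ^ 5 := by
      calc exp 1 ^ 12 ≤ 2.7182818286 ^ 12 := by
            have := exp_one_lt_d9
            gcongr
        _ ≤ _ := by norm_num
    have := log_le_log (by positivity) h
    rw [log_pow, log_pow, log_exp] at this
    push_cast at this
    linarith
  have hα : 0.47 ≤ log alpha := log_goldenRatio_bounds.1
  have h5 := log_sqrt_five_bounds.1
  have h2 : 0.69 ≤ log 2 := by have := log_two_gt_d9; linarith
  unfold Cconst
  calc (11500000000000 : ℝ) ≤ 17496 * 64 ^ 5 * 2.4 * 0.47 * 0.8 * 0.69 := by norm_num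
    _ ≤ _ := by gcongr

theorem abs_le_of_int_form {n : ℕ} {p q : ℤ} {H Y : ℝ} (hn : 1 ≤ n) (hp : |(p : ℝ)| ≤ H)
    (hq : |(q : ℝ)| ≤ H) (hY : 7 * n * H ≤ Y) :
    |((3 * n * (p - q) - 2 * (p - q) : ℤ) : ℝ)| ≤ Y ∧ |((3 * n * (p - q) + q : ℤ) : ℝ)| ≤ Y ∧
    |((-p - 2 * (p - q) : ℤ) : ℝ)| ≤ Y ∧ |((q - p : ℤ) : ℝ)| ≤ Y ∧
    |((q - 2 * (p - q) : ℤ) : ℝ)| ≤ Y ∧ |((2 * (p - q) : ℤ) : ℝ)| ≤ Y ∧ |((-q : ℤ) : ℝ)| ≤ Y := by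
  have hn' : (1 : ℝ) ≤ n := by exact_mod_cast hn
  have hH : 0 ≤ H := (abs_nonneg _).trans hp
  have hnH : H ≤ n * H := by nlinarith
  push_cast
  have hpq : |(p - q : ℝ)| ≤ 2 * H := by
    have := abs_sub (p : ℝ) q
    linarith
  have hnpq : |n * (p - q : ℝ)| ≤ n * (2 * H) := by
    rw [abs_mul, Nat.abs_cast]
    gcongr
  rw [abs_le] at hp hq hpq hnpq
  simp only [abs_le]
  refine ⟨⟨?_, ?_⟩, ⟨?_, ?_⟩, ⟨?_, ?_⟩, ⟨?_, ?_⟩, ⟨?_, ?_⟩, ⟨?_, ?_⟩, ?_, ?_⟩ <;> nlinarith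

/-- The final contradiction, for each of the three possible positions of the closest root. -/
theorem forms_not_small {n : ℕ} {p q : ℤ} {X H : ℝ} (hn : 10 ≤ n) (hX : 30 ≤ X)
    (hR : 11500000000000 * X < 2 * n * log goldenRatio) (hpq : p ≠ 0 ∨ q ≠ 0) (hp : |(p : ℝ)| ≤ H)
    (hq : |(q : ℝ)| ≤ H) (hH : 7 * n * H ≤ exp (3 * X)) :
    37 * H * exp (-(2 * n * log goldenRatio)) <
      |p * (n * log goldenRatio - log √5) - q * (n * log goldenRatio) +
        2 * (p - q) * ((n - 1) * log goldenRatio + log 2 - log √5)| ∧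
    37 * H * exp (-(2 * n * log goldenRatio)) <
      |p * (n * log goldenRatio - log √5) -
        q * ((n - 1) * log goldenRatio + log 2 - log √5) +
        2 * (p - q) * (n * log goldenRatio)| ∧
    37 * H * exp (-(2 * n * log goldenRatio)) <
      |p * (n * log goldenRatio) - q * ((n - 1) * log goldenRatio + log 2 - log √5) +
        2 * (p - q) * (n * log goldenRatio - log √5)| := by
  have hn' : (10 : ℝ) ≤ n := by exact_mod_cast hn
  have hH0 : 0 ≤ H := (abs_nonneg _).trans hp
  obtain ⟨a1, a2, a3, a4, a5, a6, a7⟩ := abs_le_of_int_form (by omega) hp hq hH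
  have hl := log_goldenRatio_bounds
  have hs := log_sqrt_five_bounds
  have hle : 37 * H * exp (-(2 * n * log goldenRatio)) ≤
      exp (3 * X) * exp (-(2 * n * log goldenRatio)) := by
    gcongr
    nlinarith
  have hhalf : 37 * H * exp (-(2 * n * log goldenRatio)) < 1 / 2 := by
    refine lt_of_le_of_lt hle ?_
    rw [← exp_add]
    refine lt_of_le_of_lt (exp_le_exp.2 (show _ ≤ (-1 : ℝ) by norm_num at hR; linarith)) ?_
    rw [exp_neg, inv_lt_comm₀ (exp_pos 1) (by norm_num)]
    have := exp_one_gt_d9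
    linarith
  have hone : ∀ z : ℤ, z ≠ 0 → (1 : ℝ) ≤ |(z : ℝ)| := by
    intro z hz
    exact_mod_cast Int.one_le_abs hz
  have key := fun (b₁ b₂ b₃ : ℤ) k1 k2 k3 k4 =>
    eq_zero_of_abs_linear_form_le (b₁ := b₁) (b₂ := b₂) (b₃ := b₃) hX hR k1 k2 k3 k4
  have hnl : 4.7 ≤ n * log goldenRatio := by
    calc (4.7 : ℝ) = 10 * 0.47 := by norm_num
      _ ≤ _ := by gcongr; exact hl.1
  generalize log goldenRatio = l at *
  generalize log √5 = s at *
  generalize 37 * H * exp (-(2 * n * l)) = ε at *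
  refine ⟨?_, ?_, ?_⟩ <;> by_contra! hcon
  · have e : p * (n * l - s) - q * (n * l) + 2 * (p - q) * ((n - 1) * l + log 2 - s) =
        ((3 * n * (p - q) - 2 * (p - q) : ℤ) : ℝ) * l + ((-p - 2 * (p - q) : ℤ) : ℝ) * s +
          ((2 * (p - q) : ℤ) : ℝ) * log 2 := by push_cast; ring
    have hz := key _ _ _ a1 a3 a6 (by rw [← e]; exact hcon.trans hle)
    have hpq' : p = q := by omega
    subst hpq'
    have h1 := hone p (by tauto)
    rw [show p * (n * l - s) - p * (n * l) + 2 * (p - p) * ((n - 1) * l + log 2 - s) =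
      -(p * s) by ring, abs_neg, abs_mul, abs_of_pos (show 0 < s by linarith)] at hcon
    nlinarith
  · have e : p * (n * l - s) - q * ((n - 1) * l + log 2 - s) + 2 * (p - q) * (n * l) =
        ((3 * n * (p - q) + q : ℤ) : ℝ) * l + ((q - p : ℤ) : ℝ) * s +
          ((-q : ℤ) : ℝ) * log 2 := by push_cast; ring
    have hz := key _ _ _ a2 a4 a7 (by rw [← e]; exact hcon.trans hle)
    have hq0 : q = 0 := by omega
    subst hq0
    have h1 := hone p (by tauto)
    rw [show p * (n * l - s) - ((0 : ℤ) : ℝ) * ((n - 1) * l + log 2 - s) +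
      2 * (p - ((0 : ℤ) : ℝ)) * (n * l) = p * (3 * (n * l) - s) by push_cast; ring, abs_mul,
      abs_of_pos (show 0 < 3 * (n * l) - s by linarith)] at hcon
    nlinarith
  · have e : p * (n * l) - q * ((n - 1) * l + log 2 - s) + 2 * (p - q) * (n * l - s) =
        ((3 * n * (p - q) + q : ℤ) : ℝ) * l + ((q - 2 * (p - q) : ℤ) : ℝ) * s +
          ((-q : ℤ) : ℝ) * log 2 := by push_cast; ring
    have hz := key _ _ _ a2 a5 a7 (by rw [← e]; exact hcon.trans hle)
    have hq0 : q = 0 := by omega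
    subst hq0
    have h1 := hone p (by tauto)
    rw [show p * (n * l) - ((0 : ℤ) : ℝ) * ((n - 1) * l + log 2 - s) +
      2 * (p - ((0 : ℤ) : ℝ)) * (n * l - s) = p * (3 * (n * l) - 2 * s) by push_cast; ring, abs_mul,
      abs_of_pos (show 0 < 3 * (n * l) - 2 * s by linarith)] at hcon
    nlinarith

/-- Numerical consequences of the failure of the bound. -/
theorem size_bounds {n : ℕ} {L : ℝ} (hn : 10 ≤ n) (hL : 0.69 ≤ L)
    (h : L < exp (2 * log alpha / (1 + Cconst) * n - log n - 5)) :
    ∃ X : ℝ, 30 ≤ X ∧ 11500000000000 * X < 2 * n * log goldenRatio ∧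
      7 * n * (225 * n ^ 2 * (L + 3)) ≤ exp (3 * X) := by
  have hn' : (10 : ℝ) ≤ n := by exact_mod_cast hn
  have hC := le_Cconst
  have hL0 : 0 < L := by linarith
  have hl := log_goldenRatio_bounds
  have hα : log alpha = log goldenRatio := rfl
  rw [← log_lt_iff_lt_exp hL0, hα] at h
  generalize log goldenRatio = l at *
  have hlogL : -0.5 ≤ log L := by
    have h1 := one_sub_inv_le_log_of_pos hL0
    have h2 : L⁻¹ ≤ 1.5 := by
      rw [inv_le_comm₀ hL0 (by norm_num)]
      norm_num at hL ⊢
      linarith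
    linarith
  have hX : (1 + Cconst) * (log L + 5 + log n) < 2 * n * l := by
    have h1 : log L + 5 + log n < 2 * l / (1 + Cconst) * n := by linarith
    rw [div_mul_eq_mul_div, lt_div_iff₀ (by norm_num at hC; linarith)] at h1
    linarith
  have hlogn : 0 ≤ log n := log_nonneg (by linarith)
  have hX' : 11500000000000 * (log L + 5 + log n) < 2 * n * l := by
    refine lt_of_le_of_lt ?_ hX
    have : 0 ≤ log L + 5 + log n := by linarith
    gcongr
    linarith
  have hnbig : exp 31 ≤ n := by
    have h1 : exp 31 ≤ 50000000000000 := by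
      calc exp 31 = exp 1 ^ 31 := by rw [← exp_nat_mul]; norm_num
        _ ≤ 2.7182818286 ^ 31 := by
          have := exp_one_lt_d9
          gcongr
        _ ≤ _ := by norm_num
    have h2 : 2 * n * l ≤ n := by nlinarith
    norm_num at hX' h1 hlogL ⊢
    linarith
  have hlogn' : 31 ≤ log n := (le_log_iff_exp_le (by linarith)).2 hnbig
  refine ⟨log L + 5 + log n, by linarith, hX', ?_⟩
  have e : exp (3 * (log L + 5 + log n)) = L ^ 3 * exp 1 ^ 15 * n ^ 3 := by
    rw [show 3 * (log L + 5 + log n) = (3 : ℕ) * log L + (15 : ℕ) * 1 + (3 : ℕ) * log n by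
      push_cast; ring, exp_add, exp_add, exp_nat_mul, exp_nat_mul, exp_nat_mul, exp_log hL0,
      exp_log (by linarith)]
  rw [e]
  have h15 : 1000000 ≤ exp 1 ^ 15 := by
    calc (1000000 : ℝ) ≤ 2.7182818283 ^ 15 := by norm_num
      _ ≤ _ := by
        have := exp_one_gt_d9
        gcongr
  have hL3 : 1575 * (L + 3) ≤ L ^ 3 * 1000000 := by
    have : 0.4 ≤ L ^ 2 := by nlinarith
    have : 0.4 * L ≤ L ^ 3 := by nlinarith
    linarith
  calc 7 * (n : ℝ) * (225 * n ^ 2 * (L + 3)) = 1575 * (L + 3) * n ^ 3 := by ring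
    _ ≤ L ^ 3 * 1000000 * n ^ 3 := by gcongr
    _ ≤ _ := by gcongr

theorem log_y_lower_bound (n : ℕ) (hn : 10 ≤ n) (x y : ℤ) (hy : 2 ≤ |y|)
    (heq : (x - (Nat.fib n : ℤ) * y) * (x - lucas n * y) * x - y ^ 3 = 1 ∨
      (x - (Nat.fib n : ℤ) * y) * (x - lucas n * y) * x - y ^ 3 = -1) :
    Real.exp (2 * Real.log alpha / (1 + Cconst) * (n : ℝ) - Real.log (n : ℝ) - 5)
      ≤ Real.log |(y : ℝ)| := by
  by_contra! hcon
  have hy' : 2 ≤ |(y : ℝ)| := by exact_mod_cast hy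
  have hL : 0.69 ≤ log |(y : ℝ)| := by
    have h1 := log_le_log (by norm_num) hy'
    have := log_two_gt_d9
    linarith
  obtain ⟨X, hX, hR, hH⟩ := size_bounds hn hL hcon
  have hl := log_goldenRatio_bounds
  have hs := log_sqrt_five_bounds
  have hn' : (10 : ℝ) ≤ n := by exact_mod_cast hn
  have hnl : 1000 ≤ n * log goldenRatio := by linarith
  obtain ⟨E, hE⟩ : ∃ E, E = exp (-(2 * n * log goldenRatio)) := ⟨_, rfl⟩
  have hEs : E ≤ 1 / 100 := by
    rw [hE, exp_neg, one_div]
    refine inv_anti₀ (by norm_num) ?_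
    have := add_one_le_exp (2 * n * log goldenRatio)
    linarith
  have hE0 : 0 < E := hE ▸ exp_pos _
  have hM := exp_le_fib (n := n) (by rw [← hE]; linarith)
  have hM11 : exp 11 ≤ Nat.fib n := by
    refine le_trans ?_ hM
    rw [le_div_iff₀ (by norm_num)]
    have h3 : (3 : ℝ) ≤ exp 2 := by have := add_one_le_exp (2 : ℝ); linarith
    calc exp 11 * 3 ≤ exp 11 * exp 2 := by gcongr
      _ ≤ _ := by rw [← exp_add, exp_le_exp]; linarith
  have hM0 : (0 : ℝ) < Nat.fib n := lt_of_lt_of_le (exp_pos _) hM11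
  have hM10 : (10 : ℝ) ≤ Nat.fib n := by
    have := add_one_le_exp (11 : ℝ)
    linarith
  have hME : 104 / (Nat.fib n : ℝ) ^ 3 ≤ E := by
    have h1 : (exp (n * log goldenRatio) / 3) ^ 3 ≤ (Nat.fib n : ℝ) ^ 3 := by gcongr
    have h2 : E * exp (n * log goldenRatio) ^ 3 = exp (n * log goldenRatio) := by
      rw [hE, ← exp_nat_mul, ← exp_add]
      push_cast
      ring_nf
    have h3 : 2808 ≤ exp (n * log goldenRatio) := by
      have h4 := add_one_le_exp (n * log goldenRatio / 2)
      have h5 : exp (n * log goldenRatio) = exp (n * log goldenRatio / 2) ^ 2 := by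
        rw [← exp_nat_mul]; push_cast; ring_nf
      rw [h5]
      nlinarith
    rw [div_le_iff₀ (by positivity)]
    calc (104 : ℝ) ≤ E * exp (n * log goldenRatio) ^ 3 / 27 := by rw [h2]; linarith
      _ = E * (exp (n * log goldenRatio) / 3) ^ 3 := by ring
      _ ≤ _ := by gcongr
  have hdiff : (lucas n : ℝ) - Nat.fib n = 2 * Nat.fib (n - 1) := by
    exact_mod_cast lucas_sub_fib (n := n) (by omega)
  have hpred : (Nat.fib n : ℝ) ≤ 2 * Nat.fib (n - 1) := by
    exact_mod_cast fib_le_two_mul_fib_pred (n := n) (by omega)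
  have hcast : (((n - 1 : ℕ)) : ℝ) = n - 1 := by
    rw [Nat.cast_sub (by omega), Nat.cast_one]
  have dF := abs_log_fib_sub_le hE (by linarith)
  have dL := abs_log_lucas_sub_le hE (by linarith)
  have dD : |log ((lucas n : ℝ) - Nat.fib n) - ((n - 1) * log goldenRatio + log 2 - log √5)| ≤
      6 * E := by
    have h1 : exp (-(2 * ((n - 1 : ℕ) : ℝ) * log goldenRatio)) ≤ 3 * E := by
      rw [hcast, show -(2 * ((n : ℝ) - 1) * log goldenRatio) =
        2 * log goldenRatio + -(2 * n * log goldenRatio) by ring, exp_add, ← hE]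
      gcongr
      calc exp (2 * log goldenRatio) ≤ exp 1 := exp_le_exp.2 (by linarith)
        _ ≤ 3 := by have := exp_one_lt_d9; linarith
    have h2 := abs_log_fib_sub_le (n := n - 1) rfl (by linarith)
    have h3 : (0 : ℝ) < Nat.fib (n - 1) := by linarith
    rw [hdiff, log_mul (by norm_num) h3.ne']
    rw [hcast] at h2
    rw [show log 2 + log (Nat.fib (n - 1)) - ((n - 1) * log goldenRatio + log 2 - log √5) =
      log (Nat.fib (n - 1)) - ((n - 1) * log goldenRatio - log √5) by ring]
    rw [hcast] at h1
    linarith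
  have hxy : |((x - Nat.fib n * y) * (x - lucas n * y) * (x - 0 * y) - y ^ 3 : ℝ)| = 1 := by
    have : ((x - Nat.fib n * y) * (x - lucas n * y) * (x - 0 * y) - y ^ 3 : ℝ) =
        (((x - (Nat.fib n : ℤ) * y) * (x - lucas n * y) * x - y ^ 3 : ℤ) : ℝ) := by
      push_cast; ring
    rw [this]
    rcases heq with h | h <;> rw [h] <;> norm_num
  have sep₁ : (Nat.fib n : ℝ) ≤ |((Nat.fib n : ℤ) : ℝ) - ((0 : ℤ) : ℝ)| := by
    simp
  have sep₂ : (Nat.fib n : ℝ) ≤ |((lucas n : ℤ) : ℝ) - ((0 : ℤ) : ℝ)| := by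
    rw [Int.cast_zero, sub_zero]
    exact le_trans (by linarith) (le_abs_self _)
  have sep₃ : (Nat.fib n : ℝ) ≤ |((Nat.fib n : ℤ) : ℝ) - ((lucas n : ℤ) : ℝ)| := by
    rw [Int.cast_natCast, abs_sub_comm, hdiff]
    exact hpred.trans (le_abs_self _)
  have sym : ∀ a b : ℝ, log (a - b) = log (b - a) := by
    intro a b; rw [← neg_sub, log_neg_eq_log]
  have g₁ : |log (((Nat.fib n : ℤ) : ℝ) - ((0 : ℤ) : ℝ)) - (n * log goldenRatio - log √5)| ≤
      6 * E := by
    rw [Int.cast_natCast, Int.cast_zero, sub_zero]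
    linarith
  have g₂ : |log (((lucas n : ℤ) : ℝ) - ((0 : ℤ) : ℝ)) - n * log goldenRatio| ≤ 6 * E := by
    rw [Int.cast_zero, sub_zero]
    linarith
  have g₃ : |log (((Nat.fib n : ℤ) : ℝ) - ((lucas n : ℤ) : ℝ)) -
      ((n - 1) * log goldenRatio + log 2 - log √5)| ≤ 6 * E := by
    rw [Int.cast_natCast, sym]
    exact dD
  have hlog2 := log_two_lt_d9
  have k₁ : n * log goldenRatio - log √5 ≤ n * log goldenRatio := by linarith
  have k₃ : (n - 1) * log goldenRatio + log 2 - log √5 ≤ n * log goldenRatio := by linarith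
  have hK : 3 * (n * log goldenRatio + 2) ≤ 2.1 * n := by nlinarith
  have hxyF : |((x - ((Nat.fib n : ℤ) : ℝ) * y) * (x - ((lucas n : ℤ) : ℝ) * y) *
      (x - ((0 : ℤ) : ℝ) * y) - y ^ 3 : ℝ)| = 1 := by
    rw [Int.cast_natCast, Int.cast_zero]; exact hxy
  generalize ((Nat.fib n : ℕ) : ℤ) = A at *
  generalize lucas n = B at *
  generalize (0 : ℤ) = Z at *
  generalize (Nat.fib n : ℝ) = M at *
  have sep₁' := sep₁
  have sep₂' := sep₂
  have sep₃' := sep₃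
  rw [abs_sub_comm] at sep₁' sep₂' sep₃'
  obtain ⟨r₁, h₁, hr₁⟩ := ShiftedRoots.exists_root_near hM10 sep₃ sep₁
  obtain ⟨r₂, h₂, hr₂⟩ := ShiftedRoots.exists_root_near hM10 sep₃' sep₂
  obtain ⟨r₃, h₃, hr₃⟩ := ShiftedRoots.exists_root_near hM10 sep₁' sep₂'
  have hforms := fun (p q : ℤ) hpq hp hq => forms_not_small (p := p) (q := q) hn hX hR hpq hp hq hH
  rw [← hE] at hforms
  have hE6 : E ≤ 1 / 6 := by linarith
  obtain hc | hc | hc : (|x - r₃ * y| ≤ |x - r₁ * y| ∧ |x - r₃ * y| ≤ |x - r₂ * y|) ∨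
      (|x - r₁ * y| ≤ |x - r₃ * y| ∧ |x - r₁ * y| ≤ |x - r₂ * y|) ∨
      (|x - r₂ * y| ≤ |x - r₃ * y| ∧ |x - r₂ * y| ≤ |x - r₁ * y|) := by
    grind
  · obtain ⟨p, q, hpq, hp, hq, hΛ⟩ := ShiftedRoots.exists_small_approx_form (c₁ := A) (c₂ := B)
      (c₃ := Z) (by omega) hM11 hE6 hME hr₁ (by linarith) (by linarith) h₁ h₂ h₃ sep₃ sep₁ sep₂ g₃ g₁
      g₂ k₃ k₁ le_rfl hK hxyF hy' hc.1 hc.2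
    exact absurd hΛ (not_le.2 (hforms p q hpq hp hq).1)
  · obtain ⟨p, q, hpq, hp, hq, hΛ⟩ := ShiftedRoots.exists_small_approx_form (c₁ := Z) (c₂ := B)
      (c₃ := A) (by omega) hM11 hE6 hME (by linarith) (by linarith) (by linarith) h₃ h₂ h₁ sep₂' sep₁'
      sep₃' (by rw [sym]; exact g₂) (by rw [sym]; exact g₁) (by rw [sym]; exact g₃) le_rfl k₁ k₃ hK
      (by rw [← hxyF]; congr 1; ring) hy' hc.1 hc.2
    exact absurd hΛ (not_le.2 (hforms p q hpq hp hq).2.1)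
  · obtain ⟨p, q, hpq, hp, hq, hΛ⟩ := ShiftedRoots.exists_small_approx_form (c₁ := Z) (c₂ := A)
      (c₃ := B) (by omega) hM11 hE6 hME (by linarith) (by linarith) (by linarith) h₃ h₁ h₂ sep₁' sep₂'
      sep₃ (by rw [sym]; exact g₁) (by rw [sym]; exact g₂) g₃ k₁ le_rfl k₃ hK
      (by rw [← hxyF]; congr 1; ring) hy' hc.1 hc.2
    exact absurd hΛ (not_le.2 (hforms p q hpq hp hq).2.2)
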